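/- Let Ω ⊂ ℝ² be a bounded domain with smooth boundary, ν > 0, κ > 0, let q ∈ (2,∞), and let w ∈ L^∞(Ω) with ∇w ∈ L^q(Ω). Let v be the unique solution of the stationary Stokes system −Δv + ∇π = −(2κ/(ν+κ))∇^⊥ w, ∇·v = 0 in Ω, v = 0 on ∂Ω. Then ‖∇v‖_{L^∞(Ω)} ≤ C (1 + ‖w‖_{L^∞(Ω)}) ln(e + ‖∇w‖_{L^q(Ω)}), where C depends only on Ω, q, ν and κ. -/

import Mathlib

open MeasureTheory Set
open scoped ENNReal NNReal

noncomputable section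

/-- The Euclidean plane `ℝ²`. -/
abbrev Vec2 : Type := EuclideanSpace ℝ (Fin 2)

/-- A (nonempty) bounded domain in `ℝⁿ` with smooth boundary: a bounded open set which is
the sublevel set of a globally smooth defining function whose gradient does not vanish
on the boundary. -/
def IsBoundedSmoothDomain {n : ℕ} (Ω : Set (EuclideanSpace ℝ (Fin n))) : Prop :=
  IsOpen Ω ∧ Ω.Nonempty ∧ Bornology.IsBounded Ω ∧
    ∃ ρ : EuclideanSpace ℝ (Fin n) → ℝ, ContDiff ℝ (⊤ : ℕ∞) ρ ∧
      Ω = {x | ρ x < 0} ∧ ∀ x ∈ frontier Ω, fderiv ℝ ρ x ≠ 0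

/-- The `L^p(Ω)` norm (valued in `ℝ≥0∞`). -/
def lpnorm {n : ℕ} {F : Type*} [NormedAddCommGroup F]
    (Ω : Set (EuclideanSpace ℝ (Fin n))) (p : ℝ≥0∞)
    (f : EuclideanSpace ℝ (Fin n) → F) : ℝ≥0∞ :=
  eLpNorm f p (volume.restrict Ω)

/-- The `W^{m,p}(Ω)` norm: sum of the `L^p(Ω)` norms of all derivatives up to order `m`. -/
def sobNorm {n : ℕ} {F : Type*} [NormedAddCommGroup F] [NormedSpace ℝ F]
    (Ω : Set (EuclideanSpace ℝ (Fin n))) (m : ℕ) (p : ℝ≥0∞)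
    (f : EuclideanSpace ℝ (Fin n) → F) : ℝ≥0∞ :=
  ∑ j ∈ Finset.range (m + 1), lpnorm Ω p (fun x => iteratedFDeriv ℝ j f x)

/-- The `i`-th standard basis vector of `ℝ²`. -/
def e2 (i : Fin 2) : Vec2 := EuclideanSpace.single i 1

/-- The partial derivative `∂ᵢ f`. -/
def pd {F : Type*} [NormedAddCommGroup F] [NormedSpace ℝ F]
    (i : Fin 2) (f : Vec2 → F) (x : Vec2) : F :=
  fderiv ℝ f x (e2 i)

/-- The gradient `∇f = (∂₁ f, ∂₂ f)` of a scalar function on `ℝ²`. -/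
def grad2 (f : Vec2 → ℝ) (x : Vec2) : Vec2 :=
  (EuclideanSpace.equiv (Fin 2) ℝ).symm ![pd 0 f x, pd 1 f x]

/-- The perpendicular gradient `∇^⊥ f = (-∂₂ f, ∂₁ f)`. -/
def perpGrad (f : Vec2 → ℝ) (x : Vec2) : Vec2 :=
  (EuclideanSpace.equiv (Fin 2) ℝ).symm ![-(pd 1 f x), pd 0 f x]

/-- The divergence `∇·u = ∂₁ u₁ + ∂₂ u₂` of a vector field on `ℝ²`. -/
def div2 (u : Vec2 → Vec2) (x : Vec2) : ℝ := ∑ i, pd i u x i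

/-- The scalar curl `∇^⊥·u = ∂₁ u₂ − ∂₂ u₁` of a vector field on `ℝ²`. -/
def curl2 (u : Vec2 → Vec2) (x : Vec2) : ℝ := pd 0 u x 1 - pd 1 u x 0

/-- The Laplacian `Δf = ∂₁₁ f + ∂₂₂ f` (componentwise for vector valued `f`). -/
def lapl {F : Type*} [NormedAddCommGroup F] [NormedSpace ℝ F]
    (f : Vec2 → F) (x : Vec2) : F :=
  ∑ i : Fin 2, iteratedFDeriv ℝ 2 f x ![e2 i, e2 i]

/-- The `L^p(0,T;·)` norm in time of a nonnegative quantity `φ t`. -/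
def tLp (p : ℝ) (T : ℝ) (φ : ℝ → ℝ≥0∞) : ℝ≥0∞ :=
  (∫⁻ t in Set.Ioc (0 : ℝ) T, φ t ^ p) ^ (1 / p)

/-- The `L^∞(0,T;·)` norm in time (for time-continuous quantities) of `φ t`. -/
def tLinf (T : ℝ) (φ : ℝ → ℝ≥0∞) : ℝ≥0∞ :=
  ⨆ t ∈ Set.Icc (0 : ℝ) T, φ t

/-- `(v, π)` is a classical solution of the stationary Stokes system in `Ω` with source `f`
and no-slip boundary condition. -/
def IsStokesSol (Ω : Set Vec2) (f : Vec2 → Vec2) (v : Vec2 → Vec2) (π : Vec2 → ℝ) : Prop :=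
  (∀ x ∈ Ω, -lapl v x + grad2 π x = f x) ∧
  (∀ x ∈ Ω, div2 v x = 0) ∧
  (∀ x ∈ frontier Ω, v x = 0)

/-- `(u, w, π)` is a (global-in-time) smooth solution of the 2D micropolar system without
angular viscosity on `Ω`, with no-slip boundary condition for `u` and initial data `(u₀, w₀)`. -/
structure IsMicropolarSol (Ω : Set Vec2) (ν κ : ℝ)
    (u : ℝ → Vec2 → Vec2) (w : ℝ → Vec2 → ℝ) (π : ℝ → Vec2 → ℝ)
    (u0 : Vec2 → Vec2) (w0 : Vec2 → ℝ) : Prop where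
  smooth_u : ContDiffOn ℝ (⊤ : ℕ∞) (Function.uncurry u) (Set.Ici (0 : ℝ) ×ˢ closure Ω)
  smooth_w : ContDiffOn ℝ (⊤ : ℕ∞) (Function.uncurry w) (Set.Ici (0 : ℝ) ×ˢ closure Ω)
  smooth_π : ContDiffOn ℝ (⊤ : ℕ∞) (Function.uncurry π) (Set.Ici (0 : ℝ) ×ˢ closure Ω)
  momentum : ∀ t > (0 : ℝ), ∀ x ∈ Ω,
    deriv (fun s => u s x) t - (ν + κ) • lapl (u t) x + fderiv ℝ (u t) x (u t x)
      + grad2 (π t) x = -(2 * κ) • perpGrad (w t) x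
  micro : ∀ t > (0 : ℝ), ∀ x ∈ Ω,
    deriv (fun s => w s x) t + 4 * κ * w t x + fderiv ℝ (w t) x (u t x)
      = 2 * κ * curl2 (u t) x
  incomp : ∀ t ≥ (0 : ℝ), ∀ x ∈ Ω, div2 (u t) x = 0
  noslip : ∀ t ≥ (0 : ℝ), ∀ x ∈ frontier Ω, u t x = 0
  init_u : ∀ x ∈ closure Ω, u 0 x = u0 x
  init_w : ∀ x ∈ closure Ω, w 0 x = w0 x

end

namespace LogStokes

open Complex ComplexConjugate

/-- The real-linear map `v ↦ p v + q v̄` of the complex plane. -/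
noncomputable def wirtMap (p q : ℂ) : ℂ →L[ℝ] ℂ :=
  p • (ContinuousLinearMap.id ℝ ℂ) + q • (conjCLE : ℂ →L[ℝ] ℂ)

@[simp] lemma wirtMap_apply (p q v : ℂ) : wirtMap p q v = p * v + q * conj v := by
  simp [wirtMap]

/-- `u` is real differentiable at `z` with Wirtinger derivatives `∂u = p` and `∂̄u = q`. -/
def HasWirt (u : ℂ → ℂ) (p q z : ℂ) : Prop := HasFDerivAt u (wirtMap p q) z

/-- The Wirtinger derivative `∂u`. -/
noncomputable def dz (u : ℂ → ℂ) (z : ℂ) : ℂ := (fderiv ℝ u z 1 - I * fderiv ℝ u z I) / 2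

/-- The Wirtinger derivative `∂̄u`. -/
noncomputable def db (u : ℂ → ℂ) (z : ℂ) : ℂ := (fderiv ℝ u z 1 + I * fderiv ℝ u z I) / 2

lemma wirtMap_of_clm (A : ℂ →L[ℝ] ℂ) :
    wirtMap ((A 1 - I * A I) / 2) ((A 1 + I * A I) / 2) = A := by
  ext v
  have hv : A v = v.re * A 1 + v.im * A I := by
    conv_lhs => rw [← re_add_im v]
    rw [map_add, show (v.re : ℂ) = v.re • (1 : ℂ) by simp,
      show (v.im : ℂ) * I = v.im • I by simp, map_smul, map_smul]
    simp
  rw [hv, wirtMap_apply]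
  conv_lhs => rw [← re_add_im v]
  simp only [map_add, map_mul, conj_ofReal, conj_I]
  linear_combination (-(v.im : ℂ) * A I) * I_sq

lemma fderiv_eq_wirtMap (u : ℂ → ℂ) (z : ℂ) : fderiv ℝ u z = wirtMap (dz u z) (db u z) :=
  (wirtMap_of_clm _).symm

lemma hasWirt_of_diff {u : ℂ → ℂ} {z : ℂ} (h : DifferentiableAt ℝ u z) :
    HasWirt u (dz u z) (db u z) z := by
  unfold HasWirt; rw [← fderiv_eq_wirtMap]; exact h.hasFDerivAt

namespace HasWirt

variable {u v : ℂ → ℂ} {p q p' q' z : ℂ}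

lemma dz_eq (h : HasWirt u p q z) : dz u z = p := by
  rw [dz, HasFDerivAt.fderiv h]; simp
  linear_combination (-(p - q) / 2) * I_sq

lemma db_eq (h : HasWirt u p q z) : db u z = q := by
  rw [db, HasFDerivAt.fderiv h]; simp
  linear_combination ((p - q) / 2) * I_sq

lemma differentiableAt (h : HasWirt u p q z) : DifferentiableAt ℝ u z :=
  HasFDerivAt.differentiableAt h

lemma congr_coeff (h : HasWirt u p q z) (hp : p = p') (hq : q = q') : HasWirt u p' q' z := by
  subst hp; subst hq; exact h

lemma congr_fun (h : HasWirt u p q z) (huv : v =ᶠ[nhds z] u) : HasWirt v p q z :=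
  HasFDerivAt.congr_of_eventuallyEq h huv

lemma add (hu : HasWirt u p q z) (hv : HasWirt v p' q' z) :
    HasWirt (fun y => u y + v y) (p + p') (q + q') z := by
  have := HasFDerivAt.add hu hv
  refine this.congr_fderiv ?_
  ext w; simp; ring

lemma sub (hu : HasWirt u p q z) (hv : HasWirt v p' q' z) :
    HasWirt (fun y => u y - v y) (p - p') (q - q') z := by
  have := HasFDerivAt.sub hu hv
  refine this.congr_fderiv ?_
  ext w; simp; ring

lemma neg (hu : HasWirt u p q z) : HasWirt (fun y => - u y) (-p) (-q) z := by
  have := HasFDerivAt.neg hu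
  refine this.congr_fderiv ?_
  ext w; simp; ring

lemma mul (hu : HasWirt u p q z) (hv : HasWirt v p' q' z) :
    HasWirt (fun y => u y * v y) (p * v z + u z * p') (q * v z + u z * q') z := by
  have := HasFDerivAt.mul hu hv
  refine this.congr_fderiv ?_
  ext w; simp; ring

lemma conjugate (hu : HasWirt u p q z) :
    HasWirt (fun y => conj (u y)) (conj q) (conj p) z := by
  have := (conjCLE : ℂ →L[ℝ] ℂ).hasFDerivAt.comp z hu
  refine this.congr_fderiv ?_
  ext w; simp; ring

lemma comp_holo {h : ℂ → ℂ} {h' : ℂ} (hh : HasDerivAt h h' (u z)) (hu : HasWirt u p q z) :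
    HasWirt (fun y => h (u y)) (h' * p) (h' * q) z := by
  have := (hh.hasFDerivAt.restrictScalars ℝ).comp z hu
  refine this.congr_fderiv ?_
  ext w; simp; ring

end HasWirt

lemma hasWirt_const (c z : ℂ) : HasWirt (fun _ => c) 0 0 z := by
  have := hasFDerivAt_const (𝕜 := ℝ) c z
  refine this.congr_fderiv ?_
  ext w; simp

lemma hasWirt_id (z : ℂ) : HasWirt (fun y => y) 1 0 z := by
  have := hasFDerivAt_id (𝕜 := ℝ) z
  refine this.congr_fderiv ?_
  ext w; simp

lemma hasWirt_of_deriv {h : ℂ → ℂ} {h' z : ℂ} (hh : HasDerivAt h h' z) : HasWirt h h' 0 z := by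
  have := HasWirt.comp_holo hh (hasWirt_id z)
  simpa using this

/-- The Wirtinger derivative `∂r` of a real-valued function. -/
noncomputable def dzr (r : ℂ → ℝ) (z : ℂ) : ℂ := (fderiv ℝ r z 1 - I * fderiv ℝ r z I) / 2

lemma fderiv_eq_dzr (r : ℂ → ℝ) (z v : ℂ) :
    ((fderiv ℝ r z v : ℝ) : ℂ) = dzr r z * v + conj (dzr r z) * conj v := by
  have hv : fderiv ℝ r z v = v.re * fderiv ℝ r z 1 + v.im * fderiv ℝ r z I := by
    conv_lhs => rw [← re_add_im v]
    rw [map_add, show (v.re : ℂ) = v.re • (1 : ℂ) by simp,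
      show (v.im : ℂ) * I = v.im • I by simp, map_smul, map_smul]
    simp
  rw [hv, dzr]
  conv_rhs => rw [← re_add_im v]
  simp only [map_add, map_sub, map_div₀, map_mul, conj_ofReal, conj_I, ofReal_add, ofReal_mul,
    map_ofNat]
  linear_combination ((v.im : ℂ) * (fderiv ℝ r z I : ℝ)) * I_sq

lemma hasWirt_ofReal {r : ℂ → ℝ} {z : ℂ} (h : DifferentiableAt ℝ r z) :
    HasWirt (fun y => (r y : ℂ)) (dzr r z) (conj (dzr r z)) z := by
  have := ofRealCLM.hasFDerivAt.comp z h.hasFDerivAt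
  refine this.congr_fderiv ?_
  ext v
  simp [fderiv_eq_dzr]

lemma norm_dz_le (u : ℂ → ℂ) (z : ℂ) : ‖dz u z‖ ≤ ‖fderiv ℝ u z‖ := by
  have h1 : ‖fderiv ℝ u z 1‖ ≤ ‖fderiv ℝ u z‖ := by
    simpa using (fderiv ℝ u z).le_opNorm 1
  have h2 : ‖fderiv ℝ u z I‖ ≤ ‖fderiv ℝ u z‖ := by
    simpa using (fderiv ℝ u z).le_opNorm I
  calc ‖dz u z‖ = ‖fderiv ℝ u z 1 - I * fderiv ℝ u z I‖ / 2 := by simp [dz]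
    _ ≤ (‖fderiv ℝ u z 1‖ + ‖I * fderiv ℝ u z I‖) / 2 := by gcongr; exact norm_sub_le _ _
    _ ≤ _ := by simp; linarith

lemma norm_db_le (u : ℂ → ℂ) (z : ℂ) : ‖db u z‖ ≤ ‖fderiv ℝ u z‖ := by
  have h1 : ‖fderiv ℝ u z 1‖ ≤ ‖fderiv ℝ u z‖ := by
    simpa using (fderiv ℝ u z).le_opNorm 1
  have h2 : ‖fderiv ℝ u z I‖ ≤ ‖fderiv ℝ u z‖ := by
    simpa using (fderiv ℝ u z).le_opNorm I
  calc ‖db u z‖ = ‖fderiv ℝ u z 1 + I * fderiv ℝ u z I‖ / 2 := by simp [db]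
    _ ≤ (‖fderiv ℝ u z 1‖ + ‖I * fderiv ℝ u z I‖) / 2 := by gcongr; exact norm_add_le _ _
    _ ≤ _ := by simp; linarith

lemma norm_dzr_le (r : ℂ → ℝ) (z : ℂ) : ‖dzr r z‖ ≤ ‖fderiv ℝ r z‖ := by
  have h1 : ‖fderiv ℝ r z 1‖ ≤ ‖fderiv ℝ r z‖ := by
    simpa using (fderiv ℝ r z).le_opNorm 1
  have h2 : ‖fderiv ℝ r z I‖ ≤ ‖fderiv ℝ r z‖ := by
    simpa using (fderiv ℝ r z).le_opNorm I
  calc ‖dzr r z‖ = ‖(fderiv ℝ r z 1 : ℂ) - I * fderiv ℝ r z I‖ / 2 := by simp [dzr]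
    _ ≤ (‖(fderiv ℝ r z 1 : ℂ)‖ + ‖I * (fderiv ℝ r z I : ℂ)‖) / 2 := by
        gcongr; exact norm_sub_le _ _
    _ ≤ _ := by simp at *; linarith

lemma norm_fderiv_le_dz_add_db (u : ℂ → ℂ) (z : ℂ) : ‖fderiv ℝ u z‖ ≤ ‖dz u z‖ + ‖db u z‖ := by
  refine ContinuousLinearMap.opNorm_le_bound _ (by positivity) fun v => ?_
  rw [fderiv_eq_wirtMap, wirtMap_apply]
  calc _ ≤ ‖dz u z * v‖ + ‖db u z * conj v‖ := norm_add_le _ _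
    _ = _ := by simp; ring

lemma norm_fderiv_le_dzr (r : ℂ → ℝ) (z : ℂ) : ‖fderiv ℝ r z‖ ≤ 2 * ‖dzr r z‖ := by
  refine ContinuousLinearMap.opNorm_le_bound _ (by positivity) fun v => ?_
  have : ‖fderiv ℝ r z v‖ = ‖((fderiv ℝ r z v : ℝ) : ℂ)‖ := by simp
  rw [this, fderiv_eq_dzr]
  calc _ ≤ ‖dzr r z * v‖ + ‖conj (dzr r z) * conj v‖ := norm_add_le _ _
    _ = _ := by simp; ring

lemma integral_radial (φ : ℝ → ℝ) (x : ℂ) :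
    ∫ y : ℂ, φ ‖y - x‖ = 2 * Real.pi * ∫ t in Ioi (0 : ℝ), t * φ t := by
  rw [integral_sub_right_eq_self (fun y : ℂ => φ ‖y‖) x,
    integral_fun_norm_addHaar (μ := (volume : Measure ℂ)) φ]
  have hv : (volume : Measure ℂ).real (Metric.ball 0 1) = Real.pi := by
    simp [Measure.real, Complex.volume_ball]
  rw [hv]
  simp [finrank_real_complex]
  ring

lemma integrable_radial {φ : ℝ → ℝ} (h : IntegrableOn (fun t => t * φ t) (Ioi 0)) (x : ℂ) :
    Integrable (fun y : ℂ => φ ‖y - x‖) := by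
  refine Integrable.comp_sub_right (f := fun y : ℂ => φ ‖y‖) ?_ x
  rw [integrable_fun_norm_addHaar]
  simpa [finrank_real_complex] using h

/-- Integrability of a negative power of the distance over a disc. -/
lemma integrableOn_ball_rpow {a : ℝ} (ha : a < 2) (x : ℂ) (s : ℝ) :
    IntegrableOn (fun y : ℂ => ‖y - x‖ ^ (-a)) (Metric.ball x s) := by
  have h : Integrable (fun y : ℂ => (fun t => (Ioo 0 s).indicator (fun t => t ^ (-a)) t) ‖y - x‖) := by
    apply integrable_radial
    have h1 : IntegrableOn (fun t : ℝ => t ^ (1 - a)) (Ioo 0 s) := by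
      rcases le_or_gt s 0 with hs | hs
      · rw [Ioo_eq_empty (by simpa using hs)]; simp
      rw [intervalIntegral.integrableOn_Ioo_rpow_iff hs]; linarith
    have h2 : (fun t : ℝ => t * (Ioo 0 s).indicator (fun t => t ^ (-a)) t)
        = (Ioo 0 s).indicator (fun t : ℝ => t ^ (1 - a)) := by
      ext t
      by_cases ht : t ∈ Ioo 0 s
      · simp only [indicator_of_mem ht]
        rw [sub_eq_add_neg, Real.rpow_add ht.1, Real.rpow_one]
      · simp [indicator_of_notMem ht]
    rw [h2]
    exact (integrable_indicator_iff measurableSet_Ioo).2 h1 |>.integrableOn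
  rw [← integrable_indicator_iff Metric.isOpen_ball.measurableSet]
  refine h.congr ?_
  have hx : ∀ᵐ y : ℂ, y ≠ x := by simp [ae_iff]
  filter_upwards [hx] with y hy
  have : 0 < ‖y - x‖ := norm_pos_iff.2 (sub_ne_zero.2 hy)
  simp [indicator, this, dist_eq]

lemma integral_ball_rpow {a : ℝ} (ha : a < 2) (x : ℂ) {s : ℝ} (hs : 0 ≤ s) :
    ∫ y in Metric.ball x s, ‖y - x‖ ^ (-a) = 2 * Real.pi / (2 - a) * s ^ (2 - a) := by
  rw [← integral_indicator Metric.isOpen_ball.measurableSet]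
  have h1 : (Metric.ball x s).indicator (fun y : ℂ => ‖y - x‖ ^ (-a)) =
      fun y => (fun t => (Iio s).indicator (fun t => t ^ (-a)) t) ‖y - x‖ := by
    ext y; simp [indicator, dist_eq]
  rw [h1, integral_radial]
  have h2 : ∫ t in Ioi (0 : ℝ), t * (Iio s).indicator (fun t => t ^ (-a)) t
      = ∫ t in Ioi (0:ℝ), (Iio s).indicator (fun t : ℝ => t ^ (1 - a)) t := by
    refine setIntegral_congr_fun measurableSet_Ioi fun t ht => ?_
    by_cases h : t < s
    · simp only [indicator, mem_Iio, h, if_true]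
      rw [sub_eq_add_neg, Real.rpow_add ht, Real.rpow_one]
    · simp [indicator, h]
  rw [h2, setIntegral_indicator measurableSet_Iio, Ioi_inter_Iio, ← integral_Ioc_eq_integral_Ioo,
    ← intervalIntegral.integral_of_le hs, integral_rpow (Or.inl (by linarith))]
  rw [show 1 - a + 1 = 2 - a by ring, Real.zero_rpow (by linarith)]
  ring

/-- The scaling of the integrable kernel `(|y - x| + δ)^{-a}`, `a > 2`. -/
lemma integrable_add_rpow {a : ℝ} (ha : 2 < a) (x : ℂ) {δ : ℝ} (hδ : 0 < δ) :
    Integrable (fun y : ℂ => (‖y - x‖ + δ) ^ (-a)) := by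
  have h0 : Integrable (fun y : ℂ => (1 + ‖y‖) ^ (-a)) := by
    apply integrable_one_add_norm; simpa [finrank_real_complex] using ha
  have h1 := (h0.comp_smul (inv_ne_zero hδ.ne')).const_mul (δ ^ (-a))
  have h2 := h1.comp_sub_right x
  refine h2.congr (Filter.Eventually.of_forall fun y => ?_)
  simp only
  rw [norm_smul, ← Real.mul_rpow hδ.le (by positivity)]
  congr 1
  rw [Real.norm_of_nonneg (by positivity)]
  field_simp
  ring

lemma integral_add_rpow {a : ℝ} (x : ℂ) {δ : ℝ} (hδ : 0 < δ) :
    ∫ y : ℂ, (‖y - x‖ + δ) ^ (-a) = (∫ y : ℂ, (1 + ‖y‖) ^ (-a)) * δ ^ (2 - a) := by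
  rw [integral_sub_right_eq_self (fun y : ℂ => (‖y‖ + δ) ^ (-a)) x]
  have h1 := Measure.integral_comp_smul (μ := (volume : Measure ℂ))
    (fun y : ℂ => (1 + ‖y‖) ^ (-a)) δ⁻¹
  have h2 : ∀ y : ℂ, (‖y‖ + δ) ^ (-a) = δ ^ (-a) * (1 + ‖δ⁻¹ • y‖) ^ (-a) := by
    intro y
    rw [norm_smul, ← Real.mul_rpow hδ.le (by positivity)]
    congr 1
    rw [Real.norm_of_nonneg (by positivity)]
    field_simp
    ring
  simp_rw [h2]
  rw [integral_const_mul, h1, finrank_real_complex, smul_eq_mul,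
    show 2 - a = -a + 2 by ring, Real.rpow_add hδ]
  rw [abs_of_nonneg (by positivity)]
  norm_cast
  field_simp

lemma isClosed_annulus (x : ℂ) (s t : ℝ) : IsClosed {y : ℂ | s ≤ ‖y - x‖ ∧ ‖y - x‖ ≤ t} :=
  (isClosed_le continuous_const (by fun_prop : Continuous fun y : ℂ => ‖y - x‖)).inter
    (isClosed_le (by fun_prop : Continuous fun y : ℂ => ‖y - x‖) continuous_const)

lemma integrableOn_annulus_inv_sq (x : ℂ) {s t : ℝ} (hs : 0 < s) :
    IntegrableOn (fun y : ℂ => (‖y - x‖ ^ 2)⁻¹) {y | s ≤ ‖y - x‖ ∧ ‖y - x‖ ≤ t} := by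
  have hc : IsCompact {y : ℂ | s ≤ ‖y - x‖ ∧ ‖y - x‖ ≤ t} := by
    refine (isCompact_closedBall x t).of_isClosed_subset ?_ ?_
    · exact isClosed_annulus x s t
    · intro y hy; simpa [dist_eq] using hy.2
  refine ContinuousOn.integrableOn_compact hc ?_
  refine ContinuousOn.inv₀ (by fun_prop) fun y hy => ?_
  have := hs.trans_le hy.1
  positivity

lemma integral_annulus_inv_sq (x : ℂ) {s t : ℝ} (hs : 0 < s) (hst : s ≤ t) :
    ∫ y in {y : ℂ | s ≤ ‖y - x‖ ∧ ‖y - x‖ ≤ t}, (‖y - x‖ ^ 2)⁻¹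
      = 2 * Real.pi * Real.log (t / s) := by
  have hm : MeasurableSet {y : ℂ | s ≤ ‖y - x‖ ∧ ‖y - x‖ ≤ t} :=
    (isClosed_annulus x s t).measurableSet
  rw [← integral_indicator hm]
  have h1 : ({y : ℂ | s ≤ ‖y - x‖ ∧ ‖y - x‖ ≤ t}).indicator (fun y : ℂ => (‖y - x‖ ^ 2)⁻¹) =
      fun y => (fun r => (Icc s t).indicator (fun r => (r ^ 2)⁻¹) r) ‖y - x‖ := by
    ext y; simp [indicator]
  rw [h1, integral_radial]
  have h2 : ∫ r in Ioi (0 : ℝ), r * (Icc s t).indicator (fun r => (r ^ 2)⁻¹) r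
      = ∫ r in Ioi (0:ℝ), (Icc s t).indicator (fun r : ℝ => r⁻¹) r := by
    refine setIntegral_congr_fun measurableSet_Ioi fun r hr => ?_
    have : r ≠ 0 := ne_of_gt hr
    by_cases h : r ∈ Icc s t
    · simp only [indicator_of_mem h]; field_simp
    · simp [indicator_of_notMem h]
  rw [h2, setIntegral_indicator measurableSet_Icc,
    show Ioi (0 : ℝ) ∩ Icc s t = Icc s t from
      inter_eq_self_of_subset_right (fun r hr => hs.trans_le hr.1),
    integral_Icc_eq_integral_Ioc, ← intervalIntegral.integral_of_le hst,
    integral_inv_of_pos hs (hs.trans_le hst)]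

lemma contDiff_mul_of_tsupport {u X : ℂ → ℂ} {U : Set ℂ} {n : WithTop ℕ∞} (hU : IsOpen U)
    (hu : ContDiffOn ℝ n u U) (hX : ContDiff ℝ n X) (hs : tsupport X ⊆ U) :
    ContDiff ℝ n (fun y => u y * X y) := by
  rw [contDiff_iff_contDiffAt]
  intro y
  by_cases hy : y ∈ tsupport X
  · exact (hu.contDiffAt (hU.mem_nhds (hs hy))).mul hX.contDiffAt
  · have h0 : X =ᶠ[nhds y] 0 := notMem_tsupport_iff_eventuallyEq.1 hy
    refine (contDiffAt_const (c := (0 : ℂ))).congr_of_eventuallyEq ?_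
    filter_upwards [h0] with z hz
    simp [hz]

lemma continuous_mul_of_tsupport {u X : ℂ → ℂ} {U : Set ℂ} (hU : IsOpen U)
    (hu : ContinuousOn u U) (hX : Continuous X) (hs : tsupport X ⊆ U) :
    Continuous (fun y => u y * X y) := by
  rw [continuous_iff_continuousAt]
  intro y
  by_cases hy : y ∈ tsupport X
  · exact (hu.continuousAt (hU.mem_nhds (hs hy))).mul hX.continuousAt
  · have h0 : X =ᶠ[nhds y] 0 := notMem_tsupport_iff_eventuallyEq.1 hy
    refine (continuousAt_const (y := (0 : ℂ))).congr ?_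
    filter_upwards [h0] with z hz
    simp [hz]

lemma integral_fderiv_eq_zero {X : ℂ → ℂ} (hX : ContDiff ℝ 1 X) (hc : HasCompactSupport X)
    (v : ℂ) : ∫ y, fderiv ℝ X y v = 0 := by
  have hi : Integrable (fun y => fderiv ℝ X y v) :=
    ((hX.continuous_fderiv one_ne_zero).clm_apply continuous_const).integrable_of_hasCompactSupport
      (hc.fderiv_apply ℝ v)
  have := integral_mul_fderiv_eq_neg_fderiv_mul_of_integrable (𝕜 := ℂ) (μ := (volume : Measure ℂ))
    (f := fun _ => (1 : ℂ)) (g := X) (v := v) (by simp) (by simpa using hi)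
    (by simpa using hX.continuous.integrable_of_hasCompactSupport hc)
    (fun x _ => differentiableAt_const _) (fun x _ => (hX.differentiable one_ne_zero) x)
  simpa using this

lemma integrable_fderiv_apply {X : ℂ → ℂ} (hX : ContDiff ℝ 1 X) (hc : HasCompactSupport X)
    (v : ℂ) : Integrable (fun y => fderiv ℝ X y v) :=
  ((hX.continuous_fderiv one_ne_zero).clm_apply continuous_const).integrable_of_hasCompactSupport
    (hc.fderiv_apply ℝ v)

lemma integral_db_eq_zero {X : ℂ → ℂ} (hX : ContDiff ℝ 1 X) (hc : HasCompactSupport X) :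
    ∫ y, db X y = 0 := by
  unfold db
  rw [integral_div, integral_add (integrable_fderiv_apply hX hc 1)
    ((integrable_fderiv_apply hX hc I).const_mul I), integral_const_mul,
    integral_fderiv_eq_zero hX hc, integral_fderiv_eq_zero hX hc]
  simp

lemma integral_dz_eq_zero {X : ℂ → ℂ} (hX : ContDiff ℝ 1 X) (hc : HasCompactSupport X) :
    ∫ y, dz X y = 0 := by
  unfold dz
  rw [integral_div, integral_sub (integrable_fderiv_apply hX hc 1)
    ((integrable_fderiv_apply hX hc I).const_mul I), integral_const_mul,
    integral_fderiv_eq_zero hX hc, integral_fderiv_eq_zero hX hc]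
  simp

lemma continuousOn_db {u : ℂ → ℂ} {U : Set ℂ} (hU : IsOpen U) (hu : ContDiffOn ℝ 1 u U) :
    ContinuousOn (db u) U := by
  have := hu.continuousOn_fderiv_of_isOpen hU le_rfl
  unfold db
  fun_prop

lemma continuousOn_dz {u : ℂ → ℂ} {U : Set ℂ} (hU : IsOpen U) (hu : ContDiffOn ℝ 1 u U) :
    ContinuousOn (dz u) U := by
  have := hu.continuousOn_fderiv_of_isOpen hU le_rfl
  unfold dz
  fun_prop

lemma continuous_db {u : ℂ → ℂ} (hu : ContDiff ℝ 1 u) : Continuous (db u) :=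
  continuousOn_univ.1 (continuousOn_db isOpen_univ hu.contDiffOn)

lemma continuous_dz {u : ℂ → ℂ} (hu : ContDiff ℝ 1 u) : Continuous (dz u) :=
  continuousOn_univ.1 (continuousOn_dz isOpen_univ hu.contDiffOn)

lemma tsupport_db_subset (X : ℂ → ℂ) : tsupport (db X) ⊆ tsupport X := by
  refine closure_minimal (fun y hy => ?_) (isClosed_tsupport X)
  by_contra h
  have h0 : X =ᶠ[nhds y] fun _ => 0 := notMem_tsupport_iff_eventuallyEq.1 h
  exact hy (by simp [db, h0.fderiv_eq])

lemma tsupport_dz_subset (X : ℂ → ℂ) : tsupport (dz X) ⊆ tsupport X := by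
  refine closure_minimal (fun y hy => ?_) (isClosed_tsupport X)
  by_contra h
  have h0 : X =ᶠ[nhds y] fun _ => 0 := notMem_tsupport_iff_eventuallyEq.1 h
  exact hy (by simp [dz, h0.fderiv_eq])

lemma db_mul_of_tsupport {u X : ℂ → ℂ} {U : Set ℂ} (hU : IsOpen U)
    (hu : ContDiffOn ℝ 1 u U) (hX : ContDiff ℝ 1 X) (hs : tsupport X ⊆ U) (y : ℂ) :
    db (fun y => u y * X y) y = db u y * X y + u y * db X y := by
  by_cases hy : y ∈ tsupport X
  · exact ((hasWirt_of_diff ((hu.contDiffAt (hU.mem_nhds (hs hy))).differentiableAt one_ne_zero)).mul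
      (hasWirt_of_diff (hX.differentiable one_ne_zero y))).db_eq
  · have h0 : X =ᶠ[nhds y] fun _ => 0 := notMem_tsupport_iff_eventuallyEq.1 hy
    have h1 : (fun y => u y * X y) =ᶠ[nhds y] fun _ => 0 := by
      filter_upwards [h0] with z hz; simp [hz]
    simp [db, h0.fderiv_eq, h1.fderiv_eq, h0.self_of_nhds]

lemma dz_mul_of_tsupport {u X : ℂ → ℂ} {U : Set ℂ} (hU : IsOpen U)
    (hu : ContDiffOn ℝ 1 u U) (hX : ContDiff ℝ 1 X) (hs : tsupport X ⊆ U) (y : ℂ) :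
    dz (fun y => u y * X y) y = dz u y * X y + u y * dz X y := by
  by_cases hy : y ∈ tsupport X
  · exact ((hasWirt_of_diff ((hu.contDiffAt (hU.mem_nhds (hs hy))).differentiableAt one_ne_zero)).mul
      (hasWirt_of_diff (hX.differentiable one_ne_zero y))).dz_eq
  · have h0 : X =ᶠ[nhds y] fun _ => 0 := notMem_tsupport_iff_eventuallyEq.1 hy
    have h1 : (fun y => u y * X y) =ᶠ[nhds y] fun _ => 0 := by
      filter_upwards [h0] with z hz; simp [hz]
    simp [dz, h0.fderiv_eq, h1.fderiv_eq, h0.self_of_nhds]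

lemma ibp_db {u X : ℂ → ℂ} {U : Set ℂ} (hU : IsOpen U) (hu : ContDiffOn ℝ 1 u U)
    (hX : ContDiff ℝ 1 X) (hc : HasCompactSupport X) (hs : tsupport X ⊆ U) :
    ∫ y, db u y * X y = - ∫ y, u y * db X y := by
  have h := integral_db_eq_zero (contDiff_mul_of_tsupport hU hu hX hs) hc.mul_left
  simp_rw [db_mul_of_tsupport hU hu hX hs] at h
  rw [integral_add] at h
  · exact eq_neg_of_add_eq_zero_left h
  · exact (continuous_mul_of_tsupport hU (continuousOn_db hU hu) hX.continuous
      hs).integrable_of_hasCompactSupport hc.mul_left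
  · exact (continuous_mul_of_tsupport hU hu.continuousOn (continuous_db hX)
      ((tsupport_db_subset X).trans hs)).integrable_of_hasCompactSupport
      (HasCompactSupport.mul_left (hc.of_isClosed_subset (isClosed_tsupport _) (tsupport_db_subset X)))

lemma ibp_dz {u X : ℂ → ℂ} {U : Set ℂ} (hU : IsOpen U) (hu : ContDiffOn ℝ 1 u U)
    (hX : ContDiff ℝ 1 X) (hc : HasCompactSupport X) (hs : tsupport X ⊆ U) :
    ∫ y, dz u y * X y = - ∫ y, u y * dz X y := by
  have h := integral_dz_eq_zero (contDiff_mul_of_tsupport hU hu hX hs) hc.mul_left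
  simp_rw [dz_mul_of_tsupport hU hu hX hs] at h
  rw [integral_add] at h
  · exact eq_neg_of_add_eq_zero_left h
  · exact (continuous_mul_of_tsupport hU (continuousOn_dz hU hu) hX.continuous
      hs).integrable_of_hasCompactSupport hc.mul_left
  · exact (continuous_mul_of_tsupport hU hu.continuousOn (continuous_dz hX)
      ((tsupport_dz_subset X).trans hs)).integrable_of_hasCompactSupport
      (HasCompactSupport.mul_left (hc.of_isClosed_subset (isClosed_tsupport _) (tsupport_dz_subset X)))

/-- A smooth profile which is `1` on `(-∞, 1/2]` and `0` on `[1, ∞)`. -/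
noncomputable def prof (t : ℝ) : ℝ := Real.smoothTransition (2 - 2 * t)

lemma contDiff_prof {n : ℕ∞} : ContDiff ℝ n prof :=
  Real.smoothTransition.contDiff.comp (by fun_prop)

lemma prof_nonneg (t : ℝ) : 0 ≤ prof t := Real.smoothTransition.nonneg _
lemma prof_le_one (t : ℝ) : prof t ≤ 1 := Real.smoothTransition.le_one _
lemma prof_one {t : ℝ} (h : t ≤ 1 / 2) : prof t = 1 :=
  Real.smoothTransition.one_of_one_le (by linarith)
lemma prof_zero {t : ℝ} (h : 1 ≤ t) : prof t = 0 :=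
  Real.smoothTransition.zero_of_nonpos (by linarith)

lemma deriv_prof_of_lt {t : ℝ} (h : t < 1 / 2) : deriv prof t = 0 := by
  have : prof =ᶠ[nhds t] fun _ => 1 := by
    filter_upwards [eventually_lt_nhds h] with u hu using prof_one hu.le
  rw [this.deriv_eq]; simp

lemma deriv_prof_of_gt {t : ℝ} (h : 1 < t) : deriv prof t = 0 := by
  have : prof =ᶠ[nhds t] fun _ => 0 := by
    filter_upwards [eventually_gt_nhds h] with u hu using prof_zero hu.le
  rw [this.deriv_eq]; simp

lemma hasDerivAt_prof (t : ℝ) : HasDerivAt prof (deriv prof t) t :=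
  ((contDiff_prof (n := 1)).differentiable one_ne_zero t).hasDerivAt

/-- The smooth function `t ↦ prof' t / t`. -/
noncomputable def profB (t : ℝ) : ℝ := deriv prof t / t

lemma contDiff_deriv_prof : ContDiff ℝ 1 (deriv prof) := by
  have h : ContDiff ℝ ((1 : ℕ∞) + 1) prof := contDiff_prof (n := 2)
  exact (contDiff_succ_iff_deriv.1 h).2.2

lemma contDiff_profB : ContDiff ℝ 1 profB := by
  rw [contDiff_iff_contDiffAt]
  intro t
  rcases lt_or_ge t (1 / 2) with h | h
  · refine (contDiffAt_const (c := (0 : ℝ))).congr_of_eventuallyEq ?_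
    filter_upwards [eventually_lt_nhds h] with u hu
    simp [profB, deriv_prof_of_lt hu]
  · exact contDiff_deriv_prof.contDiffAt.div contDiffAt_id (by simp; linarith)

lemma profB_of_lt {t : ℝ} (h : t < 1 / 2) : profB t = 0 := by simp [profB, deriv_prof_of_lt h]
lemma profB_of_gt {t : ℝ} (h : 1 < t) : profB t = 0 := by simp [profB, deriv_prof_of_gt h]

lemma mul_profB (t : ℝ) : t * profB t = deriv prof t := by
  rcases eq_or_ne t 0 with h | h
  · subst h; simp [deriv_prof_of_lt]
  · unfold profB; field_simp

/-- A primitive of `profB` vanishing on `[1, ∞)`. -/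
noncomputable def profZ (t : ℝ) : ℝ := ∫ u in (1 : ℝ)..t, profB u

lemma hasDerivAt_profZ (t : ℝ) : HasDerivAt profZ (profB t) t :=
  (contDiff_profB.continuous.integral_hasStrictDerivAt 1 t).hasDerivAt

lemma deriv_profZ : deriv profZ = profB := funext fun t => (hasDerivAt_profZ t).deriv

lemma contDiff_profZ : ContDiff ℝ 1 profZ := by
  rw [contDiff_one_iff_deriv]
  exact ⟨fun t => (hasDerivAt_profZ t).differentiableAt, by
    rw [deriv_profZ]; exact contDiff_profB.continuous⟩

lemma profB_one : profB 1 = 0 := by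
  have h : Filter.Tendsto profB (nhdsWithin 1 (Ioi 1)) (nhds (profB 1)) :=
    contDiff_profB.continuous.continuousAt.tendsto.mono_left nhdsWithin_le_nhds
  have h2 : Filter.Tendsto profB (nhdsWithin 1 (Ioi 1)) (nhds 0) := by
    refine tendsto_const_nhds.congr' ?_
    filter_upwards [self_mem_nhdsWithin] with u hu
    exact (profB_of_gt hu).symm
  exact tendsto_nhds_unique h h2

lemma profZ_zero {t : ℝ} (h : 1 ≤ t) : profZ t = 0 := by
  unfold profZ
  rw [intervalIntegral.integral_congr (g := fun _ => 0)]
  · simp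
  · intro u hu
    rw [uIcc_of_le h] at hu
    rcases hu.1.eq_or_lt with h1 | h1
    · rw [← h1]; exact profB_one
    · exact profB_of_gt h1

lemma exists_profile_bound : ∃ K : ℝ, 1 ≤ K ∧ (∀ t, |profB t| ≤ K) ∧ (∀ t, |deriv profB t| ≤ K) ∧
    (∀ t, |deriv prof t| ≤ K) ∧ (∀ t, 0 ≤ t → |profZ t| ≤ K) := by
  have hb' : Continuous (deriv profB) := contDiff_profB.continuous_deriv le_rfl
  obtain ⟨K1, h1⟩ := (isCompact_Icc (a := (0 : ℝ)) (b := 1)).exists_bound_of_continuousOn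
    contDiff_profB.continuous.continuousOn
  obtain ⟨K2, h2⟩ := (isCompact_Icc (a := (0 : ℝ)) (b := 1)).exists_bound_of_continuousOn
    hb'.continuousOn
  obtain ⟨K3, h3⟩ := (isCompact_Icc (a := (0 : ℝ)) (b := 1)).exists_bound_of_continuousOn
    contDiff_deriv_prof.continuous.continuousOn
  obtain ⟨K4, h4⟩ := (isCompact_Icc (a := (0 : ℝ)) (b := 1)).exists_bound_of_continuousOn
    contDiff_profZ.continuous.continuousOn
  have d0 : ∀ t, t < 0 → deriv profB t = 0 := fun t ht => by
    have : profB =ᶠ[nhds t] fun _ => 0 := by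
      filter_upwards [eventually_lt_nhds ht] with u hu using profB_of_lt (by linarith)
    rw [this.deriv_eq]; simp
  have d1 : ∀ t, 1 < t → deriv profB t = 0 := fun t ht => by
    have : profB =ᶠ[nhds t] fun _ => 0 := by
      filter_upwards [eventually_gt_nhds ht] with u hu using profB_of_gt (by linarith)
    rw [this.deriv_eq]; simp
  refine ⟨max 1 (max (max K1 K2) (max K3 K4)), le_max_left _ _, fun t => ?_, fun t => ?_,
    fun t => ?_, fun t ht => ?_⟩
  · by_cases h : t ∈ Icc (0 : ℝ) 1
    · exact (h1 t h).trans (by simp)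
    · have : profB t = 0 := by
        rcases lt_or_ge t 0 with h0 | h0
        · exact profB_of_lt (by linarith)
        · exact profB_of_gt (by by_contra h'; exact h ⟨h0, by linarith⟩)
      rw [this]; simp
  · by_cases h : t ∈ Icc (0 : ℝ) 1
    · exact (h2 t h).trans (by simp)
    · have : deriv profB t = 0 := by
        rcases lt_or_ge t 0 with h0 | h0
        · exact d0 t h0
        · exact d1 t (by by_contra h'; exact h ⟨h0, by linarith⟩)
      rw [this]; simp
  · by_cases h : t ∈ Icc (0 : ℝ) 1
    · exact (h3 t h).trans (by simp)
    · have : deriv prof t = 0 := by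
        rcases lt_or_ge t 0 with h0 | h0
        · exact deriv_prof_of_lt (by linarith)
        · exact deriv_prof_of_gt (by by_contra h'; exact h ⟨h0, by linarith⟩)
      rw [this]; simp
  · by_cases h : t ∈ Icc (0 : ℝ) 1
    · exact (h4 t h).trans (by simp)
    · rw [profZ_zero (by by_contra h'; exact h ⟨ht, by linarith⟩)]; simp

/-- The square of the distance to `x` in units of `s`. -/
noncomputable def rsq (x : ℂ) (s : ℝ) (y : ℂ) : ℝ := normSq (y - x) / s ^ 2

lemma rsq_eq (x : ℂ) (s : ℝ) (y : ℂ) : rsq x s y = (‖y - x‖ / s) ^ 2 := by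
  rw [rsq, normSq_eq_norm_sq, div_pow]

lemma rsq_nonneg (x : ℂ) (s : ℝ) (y : ℂ) : 0 ≤ rsq x s y := by rw [rsq_eq]; positivity

lemma contDiff_rsq (x : ℂ) (s : ℝ) {n : WithTop ℕ∞} : ContDiff ℝ n (rsq x s) := by
  have : rsq x s = fun y => ‖y - x‖ ^ 2 / s ^ 2 := by
    ext y; rw [rsq_eq, div_pow]
  rw [this]
  exact ((contDiff_id.sub contDiff_const).norm_sq ℝ).div_const _

lemma hasWirt_rsq (x : ℂ) (s : ℝ) (y : ℂ) :
    HasWirt (fun y => (rsq x s y : ℂ)) (conj (y - x) / s ^ 2) ((y - x) / s ^ 2) y := by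
  have h := ((hasWirt_id y).sub (hasWirt_const x y))
  have h2 := (h.mul h.conjugate).mul (hasWirt_const (((s : ℂ) ^ 2)⁻¹) y)
  refine (h2.congr_fun (Filter.Eventually.of_forall fun z => ?_)).congr_coeff ?_ ?_
  · simp only [rsq]
    push_cast
    rw [← mul_conj]; simp; ring
  · simp; ring
  · simp; ring

/-- Chain rule for real functions of a real variable. -/
lemma HasWirt.comp_real {φ : ℝ → ℝ} {φ' : ℝ} {r : ℂ → ℝ} {p q z : ℂ}
    (hr : HasWirt (fun y => (r y : ℂ)) p q z) (hφ : HasDerivAt φ φ' (r z)) :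
    HasWirt (fun y => (φ (r y) : ℂ)) (φ' * p) (φ' * q) z := by
  have h1 : HasFDerivAt r (reCLM.comp (wirtMap p q)) z := by
    have := reCLM.hasFDerivAt.comp z hr
    simpa [Function.comp_def] using this
  have h2 := (ofRealCLM.hasFDerivAt.comp z (hφ.comp_hasFDerivAt z h1))
  have h3 : ∀ v, ((wirtMap p q v).re : ℂ) = wirtMap p q v := fun v => by
    have h4 := ofRealCLM.hasFDerivAt.comp z h1
    have h5 := HasFDerivAt.unique h4 hr
    have := congrArg (fun A : ℂ →L[ℝ] ℂ => A v) h5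
    simpa using this
  refine HasFDerivAt.congr_fderiv h2 ?_
  ext v
  have := h3 v
  simp only [wirtMap_apply] at this
  simp [wirtMap_apply] at *
  linear_combination (φ' : ℂ) * this

lemma hasWirt_radial {φ : ℝ → ℝ} {φ' : ℝ} (x : ℂ) (s : ℝ) (y : ℂ)
    (h : HasDerivAt φ φ' (rsq x s y)) :
    HasWirt (fun y => (φ (rsq x s y) : ℂ)) (φ' * (conj (y - x) / s ^ 2))
      (φ' * ((y - x) / s ^ 2)) y :=
  (hasWirt_rsq x s y).comp_real h

/-- The radial cutoff, `1` on the disc of radius `s / √2` and supported in the disc of radius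
`s`. -/
noncomputable def cut (x : ℂ) (s : ℝ) (y : ℂ) : ℂ := prof (rsq x s y)

/-- The kernel `∂̄(cut) / (y - x)²`. -/
noncomputable def ker2 (x : ℂ) (s : ℝ) (y : ℂ) : ℂ :=
  profB (rsq x s y) * conj (y - x) / s ^ 4

/-- The radial potential with `∂(pot) = s² ker2`. -/
noncomputable def pot (x : ℂ) (s : ℝ) (y : ℂ) : ℂ := profZ (rsq x s y)

variable {x y : ℂ} {s : ℝ}

lemma contDiff_cut {n : ℕ∞} : ContDiff ℝ n (cut x s) :=
  ofRealCLM.contDiff.comp (contDiff_prof.comp (contDiff_rsq x s))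

lemma contDiff_ker2 : ContDiff ℝ 1 (ker2 x s) := by
  unfold ker2
  refine ((ofRealCLM.contDiff.comp (contDiff_profB.comp (contDiff_rsq x s))).mul ?_).div_const _
  exact (conjCLE : ℂ →L[ℝ] ℂ).contDiff.comp (contDiff_id.sub contDiff_const)

lemma contDiff_pot : ContDiff ℝ 1 (pot x s) :=
  ofRealCLM.contDiff.comp (contDiff_profZ.comp (contDiff_rsq x s))

lemma one_lt_rsq (hs : 0 < s) (h : s < ‖y - x‖) : 1 < rsq x s y := by
  rw [rsq_eq]
  have : 1 < ‖y - x‖ / s := by rwa [lt_div_iff₀ hs, one_mul]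
  nlinarith

lemma one_le_rsq (hs : 0 < s) (h : s ≤ ‖y - x‖) : 1 ≤ rsq x s y := by
  rw [rsq_eq]
  have : 1 ≤ ‖y - x‖ / s := by rwa [le_div_iff₀ hs, one_mul]
  nlinarith

lemma rsq_lt_half (hs : 0 < s) (h : ‖y - x‖ ≤ s / 2) : rsq x s y < 1 / 2 := by
  rw [rsq_eq]
  have : ‖y - x‖ / s ≤ 1 / 2 := by rw [div_le_iff₀ hs]; linarith
  have h0 : 0 ≤ ‖y - x‖ / s := by positivity
  nlinarith

lemma cut_eq_zero (hs : 0 < s) (h : s ≤ ‖y - x‖) : cut x s y = 0 := by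
  simp [cut, prof_zero (one_le_rsq hs h)]

lemma cut_eq_one (hs : 0 < s) (h : ‖y - x‖ ≤ s / 2) : cut x s y = 1 := by
  simp [cut, prof_one (rsq_lt_half hs h).le]

lemma ker2_eq_zero (hs : 0 < s) (h : s < ‖y - x‖) : ker2 x s y = 0 := by
  simp [ker2, profB_of_gt (one_lt_rsq hs h)]

lemma ker2_eq_zero_of_le (hs : 0 < s) (h : ‖y - x‖ ≤ s / 2) : ker2 x s y = 0 := by
  simp [ker2, profB_of_lt (rsq_lt_half hs h)]

lemma pot_eq_zero (hs : 0 < s) (h : s ≤ ‖y - x‖) : pot x s y = 0 := by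
  simp [pot, profZ_zero (one_le_rsq hs h)]

lemma norm_cut_le : ‖cut x s y‖ ≤ 1 := by
  rw [cut, norm_real, Real.norm_of_nonneg (prof_nonneg _)]; exact prof_le_one _

lemma norm_one_sub_cut_le : ‖1 - cut x s y‖ ≤ 1 := by
  rw [cut, ← ofReal_one, ← ofReal_sub, norm_real,
    Real.norm_of_nonneg (by linarith [prof_le_one (rsq x s y)])]
  linarith [prof_nonneg (rsq x s y)]

lemma tsupport_subset_closedBall {X : ℂ → ℂ} (h : ∀ y, s < ‖y - x‖ → X y = 0) :
    tsupport X ⊆ Metric.closedBall x s := by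
  refine closure_minimal (fun y hy => ?_) Metric.isClosed_closedBall
  by_contra hn
  exact hy (h y (by simpa [dist_eq] using hn))

lemma hasCompactSupport_of_ball {X : ℂ → ℂ} (h : ∀ y, s < ‖y - x‖ → X y = 0) :
    HasCompactSupport X :=
  (isCompact_closedBall x s).of_isClosed_subset (isClosed_tsupport _)
    (tsupport_subset_closedBall h)

lemma hasWirt_cut (hs : s ≠ 0) : HasWirt (cut x s) (conj ((y - x) ^ 2 * ker2 x s y))
    ((y - x) ^ 2 * ker2 x s y) y := by
  have hs' : (s : ℂ) ≠ 0 := by exact_mod_cast hs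
  have h := hasWirt_radial x s y (hasDerivAt_prof (rsq x s y))
  have e : ((deriv prof (rsq x s y) : ℝ) : ℂ) = (y - x) * conj (y - x) / s ^ 2 * profB (rsq x s y) := by
    rw [← mul_profB, mul_conj]; simp [rsq]
  refine h.congr_coeff ?_ ?_
  · rw [e, ker2]; simp; field_simp
  · rw [e, ker2]; field_simp

lemma hasWirt_pot (hs : s ≠ 0) : HasWirt (pot x s) (s ^ 2 * ker2 x s y)
    (s ^ 2 * conj (ker2 x s y)) y := by
  have hs' : (s : ℂ) ≠ 0 := by exact_mod_cast hs
  have h := hasWirt_radial x s y (hasDerivAt_profZ (rsq x s y))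
  refine h.congr_coeff ?_ ?_
  · rw [ker2]; field_simp
  · rw [ker2]; simp; field_simp

lemma hasWirt_ker2 (hs : s ≠ 0) : HasWirt (ker2 x s)
    (deriv profB (rsq x s y) * conj (y - x) ^ 2 / s ^ 6)
    ((deriv profB (rsq x s y) * rsq x s y + profB (rsq x s y)) / s ^ 4) y := by
  have hs' : (s : ℂ) ≠ 0 := by exact_mod_cast hs
  have h := hasWirt_radial x s y
    (contDiff_profB.differentiable one_ne_zero (rsq x s y)).hasDerivAt
  have h2 := (h.mul ((hasWirt_id y).sub (hasWirt_const x y)).conjugate).mul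
    (hasWirt_const (((s : ℂ) ^ 4)⁻¹) y)
  refine (h2.congr_fun (Filter.Eventually.of_forall fun z => ?_)).congr_coeff ?_ ?_
  · simp [ker2, div_eq_mul_inv]
  · simp; field_simp
  · have : (rsq x s y : ℂ) = (y - x) * conj (y - x) / s ^ 2 := by
      rw [mul_conj]; simp [rsq]
    rw [this]; simp; field_simp

lemma integral_inv_one_add_sq_sq : ∫ u : ℂ, ((1 + ‖u‖ ^ 2) ^ 2)⁻¹ = Real.pi := by
  have h := integral_radial (fun t => ((1 + t ^ 2) ^ 2)⁻¹) 0
  simp only [sub_zero] at h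
  rw [h]
  have hd : ∀ t ∈ Ici (0 : ℝ), HasDerivAt (fun t : ℝ => -(1 / 2) * (1 + t ^ 2)⁻¹)
      (t * ((1 + t ^ 2) ^ 2)⁻¹) t := by
    intro t _
    have h1 : HasDerivAt (fun t : ℝ => 1 + t ^ 2) (2 * t) t := by
      simpa using (hasDerivAt_pow 2 t).const_add 1
    refine ((h1.inv (by positivity)).const_mul (-(1 / 2))).congr_deriv ?_
    field_simp
  have hl : Filter.Tendsto (fun t : ℝ => -(1 / 2) * (1 + t ^ 2)⁻¹) Filter.atTop (nhds (-(1/2) * 0)) := by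
    refine Filter.Tendsto.const_mul _ (Filter.Tendsto.inv_tendsto_atTop ?_)
    exact Filter.tendsto_atTop_add_const_left _ _ (Filter.tendsto_pow_atTop two_ne_zero)
  have := integral_Ioi_of_hasDerivAt_of_nonneg' hd
    (fun t ht => mul_nonneg (le_of_lt ht) (by positivity)) hl
  rw [this]; norm_num; ring

lemma integrable_inv_one_add_sq_sq : Integrable fun u : ℂ => ((1 + ‖u‖ ^ 2) ^ 2)⁻¹ := by
  by_contra h
  have := integral_undef h
  rw [integral_inv_one_add_sq_sq] at this
  exact Real.pi_ne_zero this

lemma integrable_of_bound_inv {ψ : ℂ → ℂ} (h : Continuous ψ) (hc : HasCompactSupport ψ) (x : ℂ) :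
    Integrable fun y => ‖ψ y‖ * ‖y - x‖⁻¹ := by
  obtain ⟨B, hB⟩ := h.bounded_above_of_compact_support hc
  obtain ⟨s, hs⟩ := (hc.isCompact.isBounded).subset_ball x
  have h1 := (integrableOn_ball_rpow (a := 1) (by norm_num) x s).const_mul B
  have h2 : IntegrableOn (fun y => ‖ψ y‖ * ‖y - x‖⁻¹) (Metric.ball x s) := by
    refine Integrable.mono' h1 ?_ (Filter.Eventually.of_forall fun y => ?_)
    · exact (h.norm.measurable.mul ((measurable_id.sub_const x).norm.inv)).aestronglyMeasurable
    · rw [Real.norm_of_nonneg (by positivity), Real.rpow_neg_one]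
      gcongr
      exact hB y
  refine (integrableOn_iff_integrable_of_support_subset ?_).1 h2
  intro y hy
  refine hs (subset_tsupport _ ?_)
  intro h0
  exact hy (by simp [h0])

/-- The regularised Cauchy kernel. -/
noncomputable def rker (x : ℂ) (e : ℝ) (y : ℂ) : ℂ := conj (y - x) * (‖y - x‖ ^ 2 + e ^ 2 : ℝ)⁻¹

lemma hasWirt_rker (x : ℂ) {e : ℝ} (he : e ≠ 0) (y : ℂ) :
    HasWirt (rker x e) (-conj (y - x) ^ 2 * ((‖y - x‖ ^ 2 + e ^ 2 : ℝ)⁻¹) ^ 2)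
      (e ^ 2 * ((‖y - x‖ ^ 2 + e ^ 2 : ℝ)⁻¹) ^ 2) y := by
  have hn : ∀ z : ℂ, ((‖z - x‖ ^ 2 + e ^ 2 : ℝ) : ℂ) = (z - x) * conj (z - x) + e ^ 2 := by
    intro z; rw [mul_conj, normSq_eq_norm_sq]; push_cast; ring
  have h0 : ((‖y - x‖ ^ 2 + e ^ 2 : ℝ) : ℂ) ≠ 0 := by
    rw [Ne, ofReal_eq_zero]; positivity
  have h1 := (hasWirt_id y).sub (hasWirt_const x y)
  have h2 := ((h1.mul h1.conjugate).add (hasWirt_const ((e : ℂ) ^ 2) y))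
  have h3 := h2.comp_holo (h := fun z => z⁻¹) (hasDerivAt_inv (by rw [← hn]; exact h0))
  have h4 := h1.conjugate.mul h3
  refine (h4.congr_fun (Filter.Eventually.of_forall fun z => ?_)).congr_coeff ?_ ?_
  · simp only [rker]
    rw [ofReal_inv, hn]
  · rw [hn] at h0
    rw [ofReal_inv, hn]
    simp
    field_simp
  · rw [hn] at h0
    rw [ofReal_inv, hn]
    simp at *
    field_simp
    ring

lemma contDiff_rker (x : ℂ) {e : ℝ} (he : e ≠ 0) : ContDiff ℝ 1 (rker x e) := by
  unfold rker
  refine ((conjCLE : ℂ →L[ℝ] ℂ).contDiff.comp (contDiff_id.sub contDiff_const)).mul ?_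
  refine ofRealCLM.contDiff.comp (ContDiff.inv ?_ fun y => by positivity)
  exact ((contDiff_id.sub contDiff_const).norm_sq ℝ).add contDiff_const

/-- The Cauchy–Pompeiu formula. -/
lemma cauchy_pompeiu {ψ : ℂ → ℂ} (hψ : ContDiff ℝ 1 ψ) (hc : HasCompactSupport ψ) (x : ℂ) :
    ∫ y, db ψ y / (y - x) = -Real.pi * ψ x := by
  have hdc : HasCompactSupport (db ψ) :=
    hc.of_isClosed_subset (isClosed_tsupport _) (tsupport_db_subset ψ)
  let ε : ℕ → ℝ := fun n => 1 / (n + 1 : ℝ)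
  have hε : ∀ n, 0 < ε n := fun n => by positivity
  have hε0 : Filter.Tendsto ε Filter.atTop (nhds 0) := tendsto_one_div_add_atTop_nhds_zero_nat
  have key : ∀ n, ∫ y, db ψ y * rker x (ε n) y
      = - ∫ u : ℂ, ψ (x + ε n • u) * (((1 + ‖u‖ ^ 2) ^ 2)⁻¹ : ℝ) := by
    intro n
    have h1 := ibp_db isOpen_univ (contDiff_rker x (hε n).ne').contDiffOn hψ hc (subset_univ _)
    have h2 : ∫ y, db ψ y * rker x (ε n) y = ∫ y, rker x (ε n) y * db ψ y := by
      simp_rw [mul_comm]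
    rw [h2, ← neg_eq_iff_eq_neg.2 h1]
    congr 1
    have h3 := Measure.integral_comp_smul (μ := (volume : Measure ℂ))
      (fun u : ℂ => (ε n : ℂ) ^ 2 * (ψ (x + u) * ((ε n ^ 2 / (‖u‖ ^ 2 + ε n ^ 2) ^ 2 : ℝ) / (ε n : ℂ)^2))) (ε n)
    have h4 : ∀ u : ℂ, ψ (x + ε n • u) * (((1 + ‖u‖ ^ 2) ^ 2)⁻¹ : ℝ) =
      (ε n : ℂ) ^ 2 * ((ε n : ℂ) ^ 2 * (ψ (x + ε n • u) * ((ε n ^ 2 / (‖ε n • u‖ ^ 2 + ε n ^ 2) ^ 2 : ℝ) / (ε n : ℂ)^2))) := by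
      intro u
      have hh : ((ε n : ℝ) : ℂ) ≠ 0 := by exact_mod_cast (hε n).ne'
      have h5 : ((ε n ^ 2 / (‖ε n • u‖ ^ 2 + ε n ^ 2) ^ 2 : ℝ)) = (ε n ^ 2)⁻¹ * ((1 + ‖u‖ ^ 2) ^ 2)⁻¹ := by
        rw [norm_smul, Real.norm_of_nonneg (hε n).le]
        have := (hε n).ne'
        have h6 : (ε n * ‖u‖) ^ 2 + ε n ^ 2 = ε n ^ 2 * (1 + ‖u‖ ^ 2) := by ring
        rw [h6]
        have : (1 + ‖u‖ ^ 2) ≠ 0 := by positivity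
        field_simp
      rw [h5]
      push_cast
      field_simp
    simp_rw [h4]
    rw [integral_const_mul, h3, finrank_real_complex]
    rw [abs_of_nonneg (by have := hε n; positivity)]
    have h7 : ∫ y, db (rker x (ε n)) y * ψ y = ∫ u, db (rker x (ε n)) (x + u) * ψ (x + u) :=
      (integral_add_left_eq_self (fun y => db (rker x (ε n)) y * ψ y) x).symm
    rw [h7, ← integral_smul, ← integral_const_mul]
    congr 1
    ext u
    rw [(hasWirt_rker x (hε n).ne' (x + u)).db_eq]
    have hh : ((ε n : ℝ) : ℂ) ≠ 0 := by exact_mod_cast (hε n).ne'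
    simp
    field_simp
  have L1 : Filter.Tendsto (fun n => ∫ y, db ψ y * rker x (ε n) y) Filter.atTop
      (nhds (∫ y, db ψ y / (y - x))) := by
    refine tendsto_integral_of_dominated_convergence (fun y => ‖db ψ y‖ * ‖y - x‖⁻¹) ?_ ?_ ?_ ?_
    · intro n
      exact ((continuous_db hψ).mul (contDiff_rker x (hε n).ne').continuous).aestronglyMeasurable
    · exact integrable_of_bound_inv (continuous_db hψ) hdc x
    · intro n
      refine Filter.Eventually.of_forall fun y => ?_
      rw [norm_mul]
      gcongr
      rw [rker, norm_mul, norm_real, RCLike.norm_conj, Real.norm_of_nonneg (by positivity)]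
      rcases eq_or_ne y x with h | h
      · simp [h]
      have h0 : 0 < ‖y - x‖ := norm_pos_iff.2 (sub_ne_zero.2 h)
      rw [← div_eq_mul_inv, div_le_iff₀ (by positivity)]
      field_simp
      nlinarith [sq_nonneg (ε n)]
    · have hx : ∀ᵐ y : ℂ, y ≠ x := by simp [ae_iff]
      filter_upwards [hx] with y hy
      rw [div_eq_mul_inv]
      refine Filter.Tendsto.const_mul _ ?_
      have h0 : (y - x) ≠ 0 := sub_ne_zero.2 hy
      have h1 : (y - x)⁻¹ = conj (y - x) * ((‖y - x‖ ^ 2 + 0 ^ 2 : ℝ)⁻¹ : ℝ) := by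
        rw [Complex.inv_def, normSq_eq_norm_sq]; simp
      rw [h1]
      refine Filter.Tendsto.const_mul _ ?_
      refine (continuous_ofReal.tendsto _).comp ?_
      refine Filter.Tendsto.inv₀ ((hε0.pow 2).const_add _) ?_
      have : 0 < ‖y - x‖ := norm_pos_iff.2 h0
      positivity
  have L2 : Filter.Tendsto (fun n => - ∫ u : ℂ, ψ (x + ε n • u) * (((1 + ‖u‖ ^ 2) ^ 2)⁻¹ : ℝ))
      Filter.atTop (nhds (-∫ u : ℂ, ψ x * (((1 + ‖u‖ ^ 2) ^ 2)⁻¹ : ℝ))) := by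
    obtain ⟨B, hB⟩ := hψ.continuous.bounded_above_of_compact_support hc
    refine Filter.Tendsto.neg ?_
    refine tendsto_integral_of_dominated_convergence (fun u => B * ((1 + ‖u‖ ^ 2) ^ 2)⁻¹) ?_ ?_ ?_ ?_
    · intro n
      refine Continuous.aestronglyMeasurable ?_
      refine (hψ.continuous.comp (by fun_prop)).mul (continuous_ofReal.comp ?_)
      exact Continuous.inv₀ (by fun_prop) fun y => by positivity
    · exact integrable_inv_one_add_sq_sq.const_mul B
    · intro n
      refine Filter.Eventually.of_forall fun u => ?_
      rw [norm_mul, norm_real, Real.norm_of_nonneg (by positivity)]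
      gcongr
      exact hB _
    · refine Filter.Eventually.of_forall fun u => ?_
      refine Filter.Tendsto.mul_const _ ?_
      refine (hψ.continuous.tendsto x).comp ?_
      have : Filter.Tendsto (fun n => x + ε n • u) Filter.atTop (nhds (x + (0 : ℝ) • u)) :=
        (hε0.smul_const u).const_add x
      simpa using this
  have := tendsto_nhds_unique (L1.congr key) L2
  rw [this, integral_const_mul, integral_complex_ofReal, integral_inv_one_add_sq_sq]
  ring

/-- A uniform bound for the cutoff profiles. -/
noncomputable def profK : ℝ := exists_profile_bound.choose

lemma one_le_profK : 1 ≤ profK := exists_profile_bound.choose_spec.1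
lemma profK_pos : 0 < profK := one_pos.trans_le one_le_profK
lemma abs_profB_le (t : ℝ) : |profB t| ≤ profK := exists_profile_bound.choose_spec.2.1 t
lemma abs_deriv_profB_le (t : ℝ) : |deriv profB t| ≤ profK :=
  exists_profile_bound.choose_spec.2.2.1 t
lemma abs_profZ_le {t : ℝ} (h : 0 ≤ t) : |profZ t| ≤ profK :=
  exists_profile_bound.choose_spec.2.2.2.2 t h

variable {x y : ℂ} {s : ℝ} {U : Set ℂ}

lemma deriv_profB_of_gt {t : ℝ} (ht : 1 < t) : deriv profB t = 0 := by
  have : profB =ᶠ[nhds t] fun _ => 0 := by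
    filter_upwards [eventually_gt_nhds ht] with u hu using profB_of_gt (by linarith)
  rw [this.deriv_eq]; simp

lemma norm_ker2_le (hs : 0 < s) : ‖ker2 x s y‖ ≤ profK / s ^ 3 := by
  rcases lt_or_ge s ‖y - x‖ with h | h
  · rw [ker2_eq_zero hs h, norm_zero]; have := profK_pos; positivity
  · have h0 := profK_pos
    rw [ker2, norm_div, norm_mul, norm_real, RCLike.norm_conj, norm_pow, norm_real,
      Real.norm_of_nonneg hs.le, Real.norm_eq_abs]
    calc |profB (rsq x s y)| * ‖y - x‖ / s ^ 4 ≤ profK * s / s ^ 4 := by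
          gcongr; exact abs_profB_le _
      _ = _ := by field_simp

lemma norm_db_ker2_le (hs : 0 < s) : ‖db (ker2 x s) y‖ ≤ 2 * profK / s ^ 4 := by
  have h0 := profK_pos
  rw [(hasWirt_ker2 hs.ne').db_eq, norm_div, norm_pow, norm_real, Real.norm_of_nonneg hs.le]
  gcongr
  rcases lt_or_ge s ‖y - x‖ with h | h
  · rw [deriv_profB_of_gt (one_lt_rsq hs h), profB_of_gt (one_lt_rsq hs h)]; simp; positivity
  · refine (norm_add_le _ _).trans ?_
    rw [norm_mul, norm_real, norm_real, norm_real]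
    simp only [Real.norm_eq_abs, abs_of_nonneg (rsq_nonneg x s y)]
    have h1 : rsq x s y ≤ 1 := by
      rw [rsq_eq]; exact pow_le_one₀ (by positivity) ((div_le_one hs).2 h)
    have h2 := abs_deriv_profB_le (rsq x s y)
    have h3 := abs_profB_le (rsq x s y)
    have := mul_le_mul h2 h1 (rsq_nonneg x s y) h0.le
    linarith

lemma norm_dz_ker2_le (hs : 0 < s) : ‖dz (ker2 x s) y‖ ≤ profK / s ^ 4 := by
  have h0 := profK_pos
  rw [(hasWirt_ker2 hs.ne').dz_eq, norm_div, norm_pow, norm_real, Real.norm_of_nonneg hs.le]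
  rcases lt_or_ge s ‖y - x‖ with h | h
  · rw [deriv_profB_of_gt (one_lt_rsq hs h)]; simp; positivity
  · rw [norm_mul, norm_real, norm_pow, RCLike.norm_conj, Real.norm_eq_abs]
    calc _ ≤ profK * s ^ 2 / s ^ 6 := by
          gcongr; exact abs_deriv_profB_le _
      _ = _ := by field_simp

lemma norm_pot_le : ‖pot x s y‖ ≤ profK := by
  rw [pot, norm_real]; exact abs_profZ_le (rsq_nonneg x s y)

lemma db_ker2_eq_zero (hs : 0 < s) (h : s < ‖y - x‖) : db (ker2 x s) y = 0 := by
  rw [(hasWirt_ker2 hs.ne').db_eq, deriv_profB_of_gt (one_lt_rsq hs h),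
    profB_of_gt (one_lt_rsq hs h)]; simp

lemma norm_db_cut_le (hs : 0 < s) : ‖db (cut x s) y‖ ≤ profK / s := by
  have h0 := profK_pos
  rw [(hasWirt_cut hs.ne').db_eq]
  rcases lt_or_ge s ‖y - x‖ with h | h
  · rw [ker2_eq_zero hs h]; simp; positivity
  · rw [norm_mul, norm_pow]
    calc _ ≤ s ^ 2 * (profK / s ^ 3) := by gcongr; exact norm_ker2_le hs
      _ = _ := by field_simp

lemma norm_dz_cut_le (hs : 0 < s) : ‖dz (cut x s) y‖ ≤ profK / s := by
  have h := norm_db_cut_le (x := x) (y := y) hs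
  rw [(hasWirt_cut hs.ne').db_eq] at h
  rw [(hasWirt_cut hs.ne').dz_eq, RCLike.norm_conj]; exact h

lemma norm_integral_le_of_ball {X : ℂ → ℂ} {B : ℝ} (h0 : ∀ y, s < ‖y - x‖ → X y = 0)
    (hb : ∀ y, ‖y - x‖ ≤ s → ‖X y‖ ≤ B) (hs : 0 ≤ s) : ‖∫ y, X y‖ ≤ B * (Real.pi * s ^ 2) := by
  rw [← setIntegral_eq_integral_of_forall_compl_eq_zero (s := Metric.closedBall x s)
    (fun y hy => h0 y (by simpa [dist_eq] using hy))]
  refine (norm_setIntegral_le_of_norm_le_const (C := B) ?_ ?_).trans_eq ?_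
  · exact (isCompact_closedBall x s).measure_lt_top
  · intro y hy; exact hb y (by simpa [dist_eq] using hy)
  · have : (volume : Measure ℂ).real (Metric.closedBall x s) = Real.pi * s ^ 2 := by
      rw [Measure.real, Complex.volume_closedBall]
      simp [hs]; ring
    rw [this]

lemma contDiffOn_of_holo {g : ℂ → ℂ} (hU : IsOpen U) (hg : DifferentiableOn ℂ g U) {n : ℕ∞} :
    ContDiffOn ℝ n g U :=
  (hg.contDiffOn hU).restrict_scalars ℝ

lemma contDiffOn_conj {u : ℂ → ℂ} {n : WithTop ℕ∞} (hu : ContDiffOn ℝ n u U) :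
    ContDiffOn ℝ n (fun y => conj (u y)) U :=
  (conjCLE : ℂ →L[ℝ] ℂ).contDiff.comp_contDiffOn hu

lemma tsupport_ker2_subset (hs : 0 < s) : tsupport (ker2 x s) ⊆ Metric.closedBall x s :=
  tsupport_subset_closedBall fun _ h => ker2_eq_zero hs h

lemma tsupport_pot_subset (hs : 0 < s) : tsupport (pot x s) ⊆ Metric.closedBall x s :=
  tsupport_subset_closedBall fun _ h => pot_eq_zero hs h.le

lemma tsupport_cut_subset (hs : 0 < s) : tsupport (cut x s) ⊆ Metric.closedBall x s :=
  tsupport_subset_closedBall fun _ h => cut_eq_zero hs h.le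

lemma integral_mul_ker2 {u : ℂ → ℂ} (hU : IsOpen U) (hu : ContDiffOn ℝ 1 u U) (hs : 0 < s)
    (hb : Metric.closedBall x s ⊆ U) :
    ∫ y, u y * ker2 x s y = - ((s : ℂ) ^ 2)⁻¹ * ∫ y, dz u y * pot x s y := by
  have hs' : (s : ℂ) ≠ 0 := by exact_mod_cast hs.ne'
  rw [ibp_dz hU hu contDiff_pot (hasCompactSupport_of_ball fun _ h => pot_eq_zero hs h.le)
    ((tsupport_pot_subset hs).trans hb)]
  simp_rw [(hasWirt_pot hs.ne').dz_eq]
  rw [neg_mul_neg, ← integral_const_mul]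
  congr 1; ext y; field_simp

lemma hasWirt_conj_holo {g : ℂ → ℂ} (hU : IsOpen U) (hg : DifferentiableOn ℂ g U) (hy : y ∈ U) :
    HasWirt (fun y => conj (g y)) 0 (conj (deriv g y)) y := by
  have := (hasWirt_of_deriv (hg.differentiableAt (hU.mem_nhds hy)).hasDerivAt).conjugate
  simpa using this

lemma integral_conj_mul_ker2 {g : ℂ → ℂ} (hU : IsOpen U) (hg : DifferentiableOn ℂ g U)
    (hs : 0 < s) (hb : Metric.closedBall x s ⊆ U) :
    ∫ y, conj (g y) * ker2 x s y = 0 := by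
  rw [integral_mul_ker2 hU (contDiffOn_conj (contDiffOn_of_holo hU hg)) hs hb]
  have : ∀ y, dz (fun y => conj (g y)) y * pot x s y = 0 := by
    intro y
    by_cases hy : y ∈ Metric.closedBall x s
    · rw [(hasWirt_conj_holo hU hg (hb hy)).dz_eq, zero_mul]
    · rw [pot_eq_zero hs, mul_zero]
      simp [dist_eq] at hy; exact hy.le
  simp [this]

lemma integral_mul_ker1 {g : ℂ → ℂ} (hU : IsOpen U) (hg : DifferentiableOn ℂ g U)
    (hs : 0 < s) (hb : Metric.closedBall x s ⊆ U) :
    ∫ y, g y * ((y - x) * ker2 x s y) = -Real.pi * g x := by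
  have hg1 := contDiffOn_of_holo (n := 1) hU hg
  have hX : ContDiff ℝ 1 (cut x s) := contDiff_cut (n := 1)
  have ht := (tsupport_cut_subset hs).trans hb
  have h := cauchy_pompeiu (contDiff_mul_of_tsupport hU hg1 hX ht)
    (hasCompactSupport_of_ball fun _ h => cut_eq_zero hs h.le).mul_left x
  rw [cut_eq_one hs (by simp; positivity), mul_one] at h
  rw [← h]
  refine integral_congr_ae ?_
  have hx : ∀ᵐ y : ℂ, y ≠ x := by simp [ae_iff]
  filter_upwards [hx] with y hy
  have h0 : (y - x) ≠ 0 := sub_ne_zero.2 hy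
  rw [db_mul_of_tsupport hU hg1 hX ht, (hasWirt_cut hs.ne').db_eq]
  have : db g y * cut x s y = 0 := by
    by_cases hy : y ∈ Metric.closedBall x s
    · rw [(hasWirt_of_deriv (hg.differentiableAt (hU.mem_nhds (hb hy))).hasDerivAt).db_eq, zero_mul]
    · rw [cut_eq_zero hs, mul_zero]
      simp [dist_eq] at hy; exact hy.le
  rw [this]
  field_simp
  ring

lemma integrable_mul_ker2 {u : ℂ → ℂ} (hU : IsOpen U) (hu : ContinuousOn u U) (hs : 0 < s)
    (hb : Metric.closedBall x s ⊆ U) : Integrable fun y => u y * ker2 x s y :=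
  (continuous_mul_of_tsupport hU hu contDiff_ker2.continuous
    ((tsupport_ker2_subset hs).trans hb)).integrable_of_hasCompactSupport
    (hasCompactSupport_of_ball fun _ h => ker2_eq_zero hs h).mul_left

lemma integral_holo_mul_ker2 {g : ℂ → ℂ} (hU : IsOpen U) (hg : DifferentiableOn ℂ g U)
    (hs : 0 < s) (hb : Metric.closedBall x s ⊆ U) :
    ∫ y, g y * ker2 x s y = -Real.pi * deriv g x := by
  have hx : x ∈ U := hb (Metric.mem_closedBall_self hs.le)
  have hd : DifferentiableOn ℂ (dslope g x) U :=
    (Complex.differentiableOn_dslope (hU.mem_nhds hx)).2 hg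
  have h := integral_mul_ker1 hU hd hs hb
  rw [dslope_same] at h
  rw [← h]
  have hc := integral_conj_mul_ker2 (g := fun _ => conj (g x)) hU (by fun_prop) hs hb
  simp only [conj_conj] at hc
  rw [← sub_zero (∫ y, g y * ker2 x s y), ← hc, ← integral_sub
    (integrable_mul_ker2 hU hg.continuousOn hs hb) (integrable_mul_ker2 hU continuousOn_const hs hb)]
  refine integral_congr_ae ?_
  have hx : ∀ᵐ y : ℂ, y ≠ x := by simp [ae_iff]
  filter_upwards [hx] with y hy
  have h0 : (y - x) ≠ 0 := sub_ne_zero.2 hy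
  rw [dslope_of_ne _ hy, slope_def_field]
  field_simp

/-- `-π g'(x)` as an average of `g - ḡ`. -/
lemma integral_sub_conj_mul_ker2 {g : ℂ → ℂ} (hU : IsOpen U) (hg : DifferentiableOn ℂ g U)
    (hs : 0 < s) (hb : Metric.closedBall x s ⊆ U) :
    ∫ y, (g y - conj (g y)) * ker2 x s y = -Real.pi * deriv g x := by
  have hg1 := contDiffOn_of_holo (n := 1) hU hg
  simp_rw [sub_mul]
  rw [integral_sub (integrable_mul_ker2 hU hg.continuousOn hs hb)
    (integrable_mul_ker2 hU (contDiffOn_conj hg1).continuousOn hs hb),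
    integral_holo_mul_ker2 hU hg hs hb, integral_conj_mul_ker2 hU hg hs hb, sub_zero]

lemma norm_deriv_le_of_equation {f W g : ℂ → ℂ} {M τ : ℝ} (hU : IsOpen U)
    (hf : ContDiffOn ℝ 1 f U) (hW : ContDiffOn ℝ 1 W U) (hg : DifferentiableOn ℂ g U)
    (heq : ∀ y ∈ U, db f y = W y + conj (g y) - g y) (hM : ∀ y ∈ U, ‖W y‖ ≤ M)
    (hs : 0 < s) (hb : Metric.closedBall x s ⊆ U) (hτ : ∀ y, ‖y - x‖ ≤ s → ‖f y‖ ≤ τ) :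
    ‖deriv g x‖ ≤ profK * (2 * τ / s ^ 2 + M / s) := by
  have h := integral_sub_conj_mul_ker2 hU hg hs hb
  have hmem : ∀ y, ‖y - x‖ ≤ s → y ∈ U := fun y hy => hb (by simpa [dist_eq] using hy)
  have h1 : ∫ y, (g y - conj (g y)) * ker2 x s y
      = (∫ y, W y * ker2 x s y) - ∫ y, db f y * ker2 x s y := by
    rw [← integral_sub (integrable_mul_ker2 hU hW.continuousOn hs hb)
      (integrable_mul_ker2 hU (continuousOn_db hU hf) hs hb)]
    congr 1; ext y
    by_cases hy : ‖y - x‖ ≤ s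
    · rw [heq y (hmem y hy)]; ring
    · rw [ker2_eq_zero hs (not_le.1 hy)]; ring
  rw [h1, ibp_db hU hf contDiff_ker2 (hasCompactSupport_of_ball fun _ h => ker2_eq_zero hs h)
    ((tsupport_ker2_subset hs).trans hb)] at h
  have b1 : ‖∫ y, W y * ker2 x s y‖ ≤ M * (profK / s ^ 3) * (Real.pi * s ^ 2) := by
    refine norm_integral_le_of_ball (fun y h => by rw [ker2_eq_zero hs h, mul_zero]) ?_ hs.le
    intro y hy
    rw [norm_mul]
    have h2 := hM y (hmem y hy)
    exact mul_le_mul h2 (norm_ker2_le hs) (norm_nonneg _) ((norm_nonneg _).trans h2)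
  have b2 : ‖∫ y, f y * db (ker2 x s) y‖ ≤ τ * (2 * profK / s ^ 4) * (Real.pi * s ^ 2) := by
    refine norm_integral_le_of_ball (fun y h => by rw [db_ker2_eq_zero hs h, mul_zero]) ?_ hs.le
    intro y hy
    rw [norm_mul]
    have h2 := hτ y hy
    exact mul_le_mul h2 (norm_db_ker2_le hs) (norm_nonneg _) ((norm_nonneg _).trans h2)
  have h3 : Real.pi * ‖deriv g x‖ ≤ M * (profK / s ^ 3) * (Real.pi * s ^ 2)
      + τ * (2 * profK / s ^ 4) * (Real.pi * s ^ 2) := by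
    calc Real.pi * ‖deriv g x‖ = ‖-(Real.pi : ℂ) * deriv g x‖ := by
          rw [norm_mul, norm_neg, norm_real, Real.norm_of_nonneg Real.pi_pos.le]
      _ ≤ _ := by
          rw [← h, sub_neg_eq_add]
          exact (norm_add_le _ _).trans (add_le_add b1 b2)
  have h4 : M * (profK / s ^ 3) * (Real.pi * s ^ 2) + τ * (2 * profK / s ^ 4) * (Real.pi * s ^ 2)
      = Real.pi * (profK * (2 * τ / s ^ 2 + M / s)) := by
    field_simp; ring
  rw [h4] at h3
  exact le_of_mul_le_mul_left h3 Real.pi_pos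

lemma abs_deriv_prof_le (t : ℝ) : |deriv prof t| ≤ profK :=
  exists_profile_bound.choose_spec.2.2.2.1 t

/-- Geometric data of a bounded plane domain `{ρ < 0}` with regular boundary: `V` is a vector
field with `∂ρ · V = 1` near the boundary. -/
structure Geo where
  ρ : ℂ → ℝ
  V : ℂ → ℂ
  L : ℝ
  d0 : ℝ
  r0 : ℝ
  D : ℝ
  one_le_L : 1 ≤ L
  d0_pos : 0 < d0
  r0_pos : 0 < r0
  d0_le : d0 ≤ 1
  norm_le : ∀ x, ρ x < 0 → ‖x‖ ≤ D
  contDiff_ρ : ContDiff ℝ 2 ρ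
  contDiff_V : ContDiff ℝ 1 V
  lip : ∀ x y, |ρ y - ρ x| ≤ L * ‖y - x‖
  taylor : ∀ x y, |ρ y - ρ x - fderiv ℝ ρ x (y - x)| ≤ L * ‖y - x‖ ^ 2
  norm_V : ∀ x, ‖V x‖ ≤ L
  lip_V : ∀ x y, ‖V y - V x‖ ≤ L * ‖y - x‖
  inv : ∀ x y, ρ x < 0 → -d0 < ρ x → ‖y - x‖ < r0 → dzr ρ y * V y = 1
  strip : ∀ t, 0 < t → volume {z : ℂ | -t < ρ z ∧ ρ z < 0} ≤ ENNReal.ofReal (L * t)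

namespace Geo

variable (Γ : Geo)

/-- The domain. -/
def dom : Set ℂ := {z | Γ.ρ z < 0}

/-- The boundary distance function. -/
def δ (z : ℂ) : ℝ := -Γ.ρ z

/-- Uniform convergence to zero at the boundary. -/
def Vanish (u : ℂ → ℂ) : Prop :=
  ∀ τ > (0 : ℝ), ∃ ε > (0 : ℝ), ∀ z ∈ Γ.dom, Γ.δ z < ε → ‖u z‖ ≤ τ

lemma L_pos : 0 < Γ.L := one_pos.trans_le Γ.one_le_L

lemma δ_pos {z : ℂ} (h : z ∈ Γ.dom) : 0 < Γ.δ z := by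
  have : Γ.ρ z < 0 := h
  simp only [δ]; linarith

lemma mem_dom {z : ℂ} : z ∈ Γ.dom ↔ 0 < Γ.δ z := by simp [dom, δ]

lemma continuous_ρ : Continuous Γ.ρ := Γ.contDiff_ρ.continuous
lemma continuous_δ : Continuous Γ.δ := Γ.continuous_ρ.neg

lemma isOpen_dom : IsOpen Γ.dom := isOpen_lt Γ.continuous_ρ continuous_const

lemma measurableSet_dom : MeasurableSet Γ.dom := Γ.isOpen_dom.measurableSet

lemma dom_subset : Γ.dom ⊆ Metric.closedBall 0 Γ.D := fun z hz => by
  simpa using Γ.norm_le z hz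

lemma volume_dom_lt_top : volume Γ.dom < ⊤ :=
  (measure_mono Γ.dom_subset).trans_lt (isCompact_closedBall _ _).measure_lt_top

lemma isCompact_depth {ε : ℝ} (hε : 0 < ε) : IsCompact {z | ε ≤ Γ.δ z} := by
  refine (isCompact_closedBall (0 : ℂ) Γ.D).of_isClosed_subset
    (isClosed_le continuous_const Γ.continuous_δ) fun z hz => Γ.dom_subset ?_
  rw [mem_dom]; exact hε.trans_le hz

lemma depth_subset {ε : ℝ} (hε : 0 < ε) : {z | ε ≤ Γ.δ z} ⊆ Γ.dom := fun _ hz =>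
  Γ.mem_dom.2 (hε.trans_le hz)

lemma differentiable_ρ : Differentiable ℝ Γ.ρ := Γ.contDiff_ρ.differentiable two_ne_zero

lemma norm_fderiv_ρ (x : ℂ) : ‖fderiv ℝ Γ.ρ x‖ ≤ Γ.L := by
  refine (norm_fderiv_le_of_lipschitz ℝ (C := Γ.L.toNNReal) (LipschitzWith.of_dist_le_mul ?_)).trans_eq
    (Real.coe_toNNReal _ Γ.L_pos.le)
  intro a b
  rw [Real.coe_toNNReal _ Γ.L_pos.le, dist_eq, Real.dist_eq]
  exact Γ.lip b a

lemma norm_fderiv_V (x : ℂ) : ‖fderiv ℝ Γ.V x‖ ≤ Γ.L := by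
  refine (norm_fderiv_le_of_lipschitz ℝ (C := Γ.L.toNNReal) (LipschitzWith.of_dist_le_mul ?_)).trans_eq
    (Real.coe_toNNReal _ Γ.L_pos.le)
  intro a b
  rw [Real.coe_toNNReal _ Γ.L_pos.le, dist_eq, dist_eq]
  exact Γ.lip_V b a

/-- The interior cutoff, equal to `1` at depth `≥ 2ε` and to `0` at depth `≤ ε`. -/
noncomputable def icut (ε : ℝ) (y : ℂ) : ℂ := prof (3 / 2 + Γ.ρ y / (2 * ε))

lemma contDiff_icut (ε : ℝ) : ContDiff ℝ 1 (Γ.icut ε) :=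
  ofRealCLM.contDiff.comp ((contDiff_prof (n := 1)).comp
    (contDiff_const.add ((Γ.contDiff_ρ.of_le (by norm_num)).div_const _)))

lemma icut_eq_zero {ε : ℝ} (hε : 0 < ε) {y : ℂ} (h : Γ.δ y ≤ ε) : Γ.icut ε y = 0 := by
  rw [icut, prof_zero]; · simp
  have : -(1 / 2) ≤ Γ.ρ y / (2 * ε) := by
    rw [le_div_iff₀ (by positivity)]; simp only [δ] at h; linarith
  linarith

lemma icut_eq_one {ε : ℝ} (hε : 0 < ε) {y : ℂ} (h : 2 * ε ≤ Γ.δ y) : Γ.icut ε y = 1 := by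
  rw [icut, prof_one]; · simp
  have : Γ.ρ y / (2 * ε) ≤ -1 := by
    rw [div_le_iff₀ (by positivity)]; simp only [δ] at h; linarith
  linarith

lemma norm_icut_le (ε : ℝ) (y : ℂ) : ‖Γ.icut ε y‖ ≤ 1 := by
  rw [icut, norm_real, Real.norm_of_nonneg (prof_nonneg _)]; exact prof_le_one _

lemma hasWirt_icut (ε : ℝ) (y : ℂ) : HasWirt (Γ.icut ε)
    ((deriv prof (3 / 2 + Γ.ρ y / (2 * ε)) : ℝ) * (dzr Γ.ρ y / (2 * ε)))
    ((deriv prof (3 / 2 + Γ.ρ y / (2 * ε)) : ℝ) * (conj (dzr Γ.ρ y) / (2 * ε))) y := by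
  have h1 := ((hasWirt_ofReal (Γ.differentiable_ρ y)).mul
    (hasWirt_const ((2 * ε : ℂ)⁻¹) y))
  have h2 := (hasWirt_const (3 / 2 : ℂ) y).add h1
  have h3 : HasWirt (fun y => ((3 / 2 + Γ.ρ y / (2 * ε) : ℝ) : ℂ)) (dzr Γ.ρ y / (2 * ε))
      (conj (dzr Γ.ρ y) / (2 * ε)) y := by
    refine (h2.congr_fun (Filter.Eventually.of_forall fun z => ?_)).congr_coeff ?_ ?_
    · push_cast; ring
    · ring
    · ring
  exact h3.comp_real (hasDerivAt_prof _)

lemma tsupport_icut_subset {ε : ℝ} (hε : 0 < ε) : tsupport (Γ.icut ε) ⊆ {z | ε ≤ Γ.δ z} := by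
  refine closure_minimal (fun y hy => ?_) (isClosed_le continuous_const Γ.continuous_δ)
  by_contra hn
  exact hy (Γ.icut_eq_zero hε (le_of_lt (not_le.1 hn)))

lemma hasCompactSupport_icut {ε : ℝ} (hε : 0 < ε) : HasCompactSupport (Γ.icut ε) :=
  (Γ.isCompact_depth hε).of_isClosed_subset (isClosed_tsupport _) (Γ.tsupport_icut_subset hε)

lemma norm_dzr_ρ (y : ℂ) : ‖dzr Γ.ρ y‖ ≤ Γ.L := (norm_dzr_le _ _).trans (Γ.norm_fderiv_ρ y)

lemma norm_db_icut {ε : ℝ} (hε : 0 < ε) (y : ℂ) : ‖db (Γ.icut ε) y‖ ≤ profK * Γ.L / ε := by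
  rw [(Γ.hasWirt_icut ε y).db_eq, norm_mul, norm_div, norm_mul, norm_real, norm_real,
    RCLike.norm_conj, Real.norm_of_nonneg hε.le, Real.norm_eq_abs]
  have h1 := abs_deriv_prof_le (3 / 2 + Γ.ρ y / (2 * ε))
  have h0 := profK_pos
  have := Γ.L_pos
  calc _ ≤ profK * (Γ.L / (1 * ε)) := by
        gcongr
        · exact Γ.norm_dzr_ρ y
        · simp
    _ = _ := by ring

lemma norm_dz_icut {ε : ℝ} (hε : 0 < ε) (y : ℂ) : ‖dz (Γ.icut ε) y‖ ≤ profK * Γ.L / ε := by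
  have h := Γ.norm_db_icut hε y
  rw [(Γ.hasWirt_icut ε y).db_eq] at h
  rw [(Γ.hasWirt_icut ε y).dz_eq]
  simpa using h

lemma deriv_icut_zero {ε : ℝ} (hε : 0 < ε) {y : ℂ} (h : Γ.δ y < ε ∨ 2 * ε < Γ.δ y) :
    db (Γ.icut ε) y = 0 ∧ dz (Γ.icut ε) y = 0 := by
  rw [(Γ.hasWirt_icut ε y).db_eq, (Γ.hasWirt_icut ε y).dz_eq]
  have : deriv prof (3 / 2 + Γ.ρ y / (2 * ε)) = 0 := by
    rcases h with h | h
    · apply deriv_prof_of_gt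
      have : -(1 / 2) < Γ.ρ y / (2 * ε) := by
        rw [lt_div_iff₀ (by positivity)]; simp only [δ] at h; linarith
      linarith
    · apply deriv_prof_of_lt
      have : Γ.ρ y / (2 * ε) < -1 := by
        rw [div_lt_iff₀ (by positivity)]; simp only [δ] at h; linarith
      linarith
  simp [this]

/-- The divergence theorem for fields vanishing at the boundary. -/
lemma divergence {u1 u2 : ℂ → ℂ} (h1 : ContDiffOn ℝ 1 u1 Γ.dom) (h2 : ContDiffOn ℝ 1 u2 Γ.dom)
    (v1 : Γ.Vanish u1) (v2 : Γ.Vanish u2)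
    (hi : IntegrableOn (fun y => db u1 y + dz u2 y) Γ.dom) :
    ∫ y in Γ.dom, (db u1 y + dz u2 y) = 0 := by
  have hK := profK_pos
  have hL := Γ.L_pos
  set H : ℂ → ℂ := fun y => db u1 y + dz u2 y with hH
  let ε : ℕ → ℝ := fun n => 1 / (n + 1 : ℝ)
  have hε : ∀ n, 0 < ε n := fun n => by positivity
  have hε0 : Filter.Tendsto ε Filter.atTop (nhds 0) := tendsto_one_div_add_atTop_nhds_zero_nat
  have key : ∀ n, ∫ y in Γ.dom, H y * Γ.icut (ε n) y
      = -∫ y, (u1 y * db (Γ.icut (ε n)) y + u2 y * dz (Γ.icut (ε n)) y) := by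
    intro n
    have hs := (Γ.tsupport_icut_subset (hε n)).trans (Γ.depth_subset (hε n))
    have e1 := ibp_db Γ.isOpen_dom h1 (Γ.contDiff_icut (ε n)) (Γ.hasCompactSupport_icut (hε n)) hs
    have e2 := ibp_dz Γ.isOpen_dom h2 (Γ.contDiff_icut (ε n)) (Γ.hasCompactSupport_icut (hε n)) hs
    have hc := Γ.hasCompactSupport_icut (hε n)
    rw [setIntegral_eq_integral_of_forall_compl_eq_zero]
    · simp_rw [hH, add_mul]
      rw [integral_add, e1, e2, integral_add]
      · ring
      · exact (continuous_mul_of_tsupport Γ.isOpen_dom h1.continuousOn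
          (continuous_db (Γ.contDiff_icut _)) ((tsupport_db_subset _).trans
            hs)).integrable_of_hasCompactSupport (HasCompactSupport.mul_left
            (hc.of_isClosed_subset (isClosed_tsupport _) (tsupport_db_subset _)))
      · exact (continuous_mul_of_tsupport Γ.isOpen_dom h2.continuousOn
          (continuous_dz (Γ.contDiff_icut _)) ((tsupport_dz_subset _).trans
            hs)).integrable_of_hasCompactSupport (HasCompactSupport.mul_left
            (hc.of_isClosed_subset (isClosed_tsupport _) (tsupport_dz_subset _)))
      · exact (continuous_mul_of_tsupport Γ.isOpen_dom (continuousOn_db Γ.isOpen_dom h1)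
          (Γ.contDiff_icut _).continuous hs).integrable_of_hasCompactSupport hc.mul_left
      · exact (continuous_mul_of_tsupport Γ.isOpen_dom (continuousOn_dz Γ.isOpen_dom h2)
          (Γ.contDiff_icut _).continuous hs).integrable_of_hasCompactSupport hc.mul_left
    · intro y hy
      rw [Γ.icut_eq_zero (hε n), mul_zero]
      rw [mem_dom] at hy
      have := hε n
      linarith
  have L1 : Filter.Tendsto (fun n => ∫ y in Γ.dom, H y * Γ.icut (ε n) y) Filter.atTop
      (nhds (∫ y in Γ.dom, H y)) := by
    refine tendsto_integral_of_dominated_convergence (fun y => ‖H y‖) ?_ hi.norm ?_ ?_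
    · intro n
      exact hi.aestronglyMeasurable.mul (Γ.contDiff_icut _).continuous.aestronglyMeasurable
    · intro n
      refine Filter.Eventually.of_forall fun y => ?_
      rw [norm_mul]
      exact mul_le_of_le_one_right (norm_nonneg _) (Γ.norm_icut_le _ _)
    · filter_upwards [ae_restrict_mem Γ.measurableSet_dom] with y hy
      refine tendsto_const_nhds.congr' ?_
      have := Γ.δ_pos hy
      filter_upwards [hε0.eventually (eventually_lt_nhds (half_pos this))] with n hn
      rw [Γ.icut_eq_one (hε n) (by linarith), mul_one]
  have L2 : Filter.Tendsto (fun n => -∫ y, (u1 y * db (Γ.icut (ε n)) y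
      + u2 y * dz (Γ.icut (ε n)) y)) Filter.atTop (nhds 0) := by
    rw [← neg_zero]
    refine Filter.Tendsto.neg ?_
    rw [Metric.tendsto_atTop]
    intro τ hτ
    have hc : 0 < 8 * profK * Γ.L ^ 2 := by positivity
    obtain ⟨e1, he1, hb1⟩ := v1 (τ / (8 * profK * Γ.L ^ 2)) (by positivity)
    obtain ⟨e2, he2, hb2⟩ := v2 (τ / (8 * profK * Γ.L ^ 2)) (by positivity)
    have hev := hε0.eventually (eventually_lt_nhds (show 0 < min e1 e2 / 3 by positivity))
    obtain ⟨N, hN⟩ := Filter.eventually_atTop.1 hev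
    refine ⟨N, fun n hn => ?_⟩
    have hεn := hε n
    have hlt := hN n hn
    have hm1 : 3 * ε n < e1 := by have := min_le_left e1 e2; linarith
    have hm2 : 3 * ε n < e2 := by have := min_le_right e1 e2; linarith
    set S : Set ℂ := {z : ℂ | -(3 * ε n) < Γ.ρ z ∧ Γ.ρ z < 0} with hS
    have hvol : volume S ≤ ENNReal.ofReal (Γ.L * (3 * ε n)) := Γ.strip _ (by positivity)
    rw [dist_zero_right, ← setIntegral_eq_integral_of_forall_compl_eq_zero (s := S)]
    · have hbd : ∀ y ∈ S, ‖u1 y * db (Γ.icut (ε n)) y + u2 y * dz (Γ.icut (ε n)) y‖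
          ≤ 2 * (τ / (8 * profK * Γ.L ^ 2)) * (profK * Γ.L / ε n) := by
        intro y hy
        have hd : Γ.δ y < 3 * ε n := by simp only [δ]; linarith [hy.1]
        have := hb1 y hy.2 (by linarith)
        have := hb2 y hy.2 (by linarith)
        refine (norm_add_le _ _).trans ?_
        rw [norm_mul, norm_mul]
        calc _ ≤ (τ / (8 * profK * Γ.L ^ 2)) * (profK * Γ.L / ε n)
              + (τ / (8 * profK * Γ.L ^ 2)) * (profK * Γ.L / ε n) := by
                gcongr
                · exact Γ.norm_db_icut hεn y
                · exact Γ.norm_dz_icut hεn y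
          _ = _ := by ring
      refine (norm_setIntegral_le_of_norm_le_const (hvol.trans_lt ENNReal.ofReal_lt_top)
        hbd).trans_lt ?_
      have hr : (volume : Measure ℂ).real S ≤ Γ.L * (3 * ε n) := by
        rw [Measure.real]
        exact ENNReal.toReal_le_of_le_ofReal (by positivity) hvol
      calc _ ≤ 2 * (τ / (8 * profK * Γ.L ^ 2)) * (profK * Γ.L / ε n) * (Γ.L * (3 * ε n)) := by
            gcongr
        _ = τ * (3 / 4) := by field_simp; ring
        _ < τ := by linarith
    · intro y hy
      have : Γ.δ y < ε n ∨ 2 * ε n < Γ.δ y := by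
        by_contra hcon
        push Not at hcon
        apply hy
        simp only [δ] at hcon
        constructor <;> linarith [hcon.1, hcon.2]
      obtain ⟨z1, z2⟩ := Γ.deriv_icut_zero hεn this
      rw [z1, z2]; simp
  exact tendsto_nhds_unique (L1.congr key) L2

end Geo

namespace Geo

variable (Γ : Geo)

/-- The scale below which the boundary looks flat. -/
noncomputable def κ : ℝ := min Γ.d0 Γ.r0 / (32 * Γ.L ^ 5)

/-- Reflection across the boundary. -/
noncomputable def R (y : ℂ) : ℂ := y - Γ.ρ y * Γ.V y

/-- The factor multiplying `g` in the corrected velocity. -/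
noncomputable def σ (y : ℂ) : ℂ := Γ.ρ y * conj (Γ.V y)

lemma κ_pos : 0 < Γ.κ := by
  have := Γ.L_pos
  exact div_pos (lt_min Γ.d0_pos Γ.r0_pos) (by positivity)

lemma κ_le : 32 * Γ.L ^ 5 * Γ.κ ≤ min Γ.d0 Γ.r0 := by
  have := Γ.L_pos
  rw [κ]; apply le_of_eq; field_simp

lemma κ_mul_le : 32 * Γ.L ^ 5 * Γ.κ ≤ 1 := Γ.κ_le.trans ((min_le_left _ _).trans Γ.d0_le)

lemma pow_mul_κ_le {n : ℕ} (hn : n ≤ 5) : 32 * (Γ.L ^ n * Γ.κ) ≤ 1 := by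
  have h1 := Γ.κ_mul_le
  have h2 : Γ.L ^ n ≤ Γ.L ^ 5 := pow_le_pow_right₀ Γ.one_le_L hn
  have := Γ.κ_pos
  nlinarith

lemma κ_le' : 32 * Γ.κ ≤ 1 := by simpa using Γ.pow_mul_κ_le (n := 0) (by norm_num)

lemma κ_le_min : 32 * Γ.κ ≤ min Γ.d0 Γ.r0 := by
  have h2 : 1 ≤ Γ.L ^ 5 := one_le_pow₀ Γ.one_le_L
  have h1 := Γ.κ_le
  have := Γ.κ_pos
  nlinarith

lemma κ_lt_d0 : Γ.κ < Γ.d0 := by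
  have := Γ.κ_le_min.trans (min_le_left _ _); have := Γ.κ_pos; linarith

lemma κ_lt_r0 : Γ.κ < Γ.r0 := by
  have := Γ.κ_le_min.trans (min_le_right _ _); have := Γ.κ_pos; linarith

lemma δ_lip (x y : ℂ) : |Γ.δ y - Γ.δ x| ≤ Γ.L * ‖y - x‖ := by
  have := Γ.lip x y
  rwa [abs_sub_comm, show Γ.δ x - Γ.δ y = Γ.ρ y - Γ.ρ x by simp [δ]; ring]

lemma δ_le (x y : ℂ) : Γ.δ y ≤ Γ.δ x + Γ.L * ‖y - x‖ := by
  have := (abs_le.1 (Γ.δ_lip x y)).2; linarith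

lemma le_δ (x y : ℂ) : Γ.δ x - Γ.L * ‖y - x‖ ≤ Γ.δ y := by
  have := (abs_le.1 (Γ.δ_lip x y)).1; linarith

/-- Admissible interior radius. -/
noncomputable def rad (x : ℂ) : ℝ := Γ.δ x / (4 * Γ.L)

lemma rad_pos {x : ℂ} (hx : x ∈ Γ.dom) : 0 < Γ.rad x :=
  div_pos (Γ.δ_pos hx) (by have := Γ.L_pos; positivity)

lemma half_le_δ {x y : ℂ} (hx : x ∈ Γ.dom) (h : ‖y - x‖ ≤ Γ.rad x) : Γ.δ x / 2 ≤ Γ.δ y := by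
  have h1 := Γ.le_δ x y
  have hL := Γ.L_pos
  have h2 : Γ.L * ‖y - x‖ ≤ Γ.L * Γ.rad x := by gcongr
  have h3 : Γ.L * Γ.rad x = Γ.δ x / 4 := by rw [rad]; field_simp
  have := Γ.δ_pos hx
  linarith

lemma mem_of_le_rad {x y : ℂ} (hx : x ∈ Γ.dom) (h : ‖y - x‖ ≤ Γ.rad x) : y ∈ Γ.dom := by
  rw [mem_dom]
  have := Γ.half_le_δ hx h
  have := Γ.δ_pos hx
  linarith

lemma closedBall_rad {x : ℂ} (hx : x ∈ Γ.dom) : Metric.closedBall x (Γ.rad x) ⊆ Γ.dom :=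
  fun y hy => Γ.mem_of_le_rad hx (by simpa [dist_eq] using hy)

lemma rad_le {x : ℂ} (hx : x ∈ Γ.dom) : 4 * Γ.rad x ≤ Γ.δ x := by
  have := Γ.one_le_L
  have := Γ.δ_pos hx
  rw [rad, mul_div_assoc', div_le_iff₀ (by positivity)]; nlinarith

lemma δ_eq_rad (x : ℂ) : Γ.δ x = 4 * Γ.L * Γ.rad x := by
  have := Γ.L_pos
  rw [rad]; field_simp

variable {Γ}
variable {x : ℂ}

lemma inv_near (hx : x ∈ Γ.dom) (hk : Γ.δ x < Γ.κ) {y : ℂ} (hy : ‖y - x‖ < Γ.r0) :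
    dzr Γ.ρ y * Γ.V y = 1 := by
  refine Γ.inv x y hx ?_ hy
  have := Γ.κ_lt_d0
  simp only [δ] at hk; linarith

lemma inv_self (hx : x ∈ Γ.dom) (hk : Γ.δ x < Γ.κ) : dzr Γ.ρ x * Γ.V x = 1 :=
  inv_near hx hk (by simpa using Γ.r0_pos)

lemma fderiv_V_eq {y : ℂ} (h : dzr Γ.ρ y * Γ.V y = 1) (t : ℝ) :
    fderiv ℝ Γ.ρ y (t * Γ.V y) = 2 * t := by
  have := fderiv_eq_dzr Γ.ρ y (t * Γ.V y)
  rw [← map_mul, show dzr Γ.ρ y * (t * Γ.V y) = t * (dzr Γ.ρ y * Γ.V y) by ring, h] at this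
  have h2 : ((fderiv ℝ Γ.ρ y (t * Γ.V y) : ℝ) : ℂ) = ((2 * t : ℝ) : ℂ) := by
    rw [this]; simp; ring
  exact_mod_cast h2

lemma taylor_V {y : ℂ} (h : dzr Γ.ρ y * Γ.V y = 1) (t : ℝ) :
    |Γ.ρ (y + t * Γ.V y) - Γ.ρ y - 2 * t| ≤ Γ.L ^ 3 * t ^ 2 := by
  have h1 := Γ.taylor y (y + t * Γ.V y)
  rw [add_sub_cancel_left, fderiv_V_eq h] at h1
  refine h1.trans ?_
  have hL := Γ.L_pos
  rw [norm_mul, norm_real, mul_pow, Real.norm_eq_abs, sq_abs]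
  have : ‖Γ.V y‖ ^ 2 ≤ Γ.L ^ 2 := by gcongr; exact Γ.norm_V y
  calc _ ≤ Γ.L * (t ^ 2 * Γ.L ^ 2) := by gcongr
    _ = _ := by ring

lemma path_depth {y : ℂ} (h : dzr Γ.ρ y * Γ.V y = 1) {t : ℝ} (h0 : 0 ≤ t)
    (ht : Γ.L ^ 3 * t ≤ 1) : Γ.δ y + t ≤ Γ.δ (y - t * Γ.V y) := by
  have h1 := (abs_le.1 (taylor_V h (-t))).2
  have e : y + ((-t : ℝ) : ℂ) * Γ.V y = y - t * Γ.V y := by push_cast; ring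
  rw [e] at h1
  simp only [δ]
  nlinarith

lemma R_outside (hx : x ∈ Γ.dom) (hk : Γ.δ x < Γ.κ) : Γ.δ x / 2 ≤ Γ.ρ (Γ.R x) := by
  have h1 := (abs_le.1 (taylor_V (inv_self hx hk) (Γ.δ x))).1
  have e : x + ((Γ.δ x : ℝ) : ℂ) * Γ.V x = Γ.R x := by simp [δ, R]; ring
  rw [e] at h1
  have h0 := Γ.δ_pos hx
  have h2 := Γ.pow_mul_κ_le (n := 3) (by norm_num)
  have h3 : Γ.ρ x = -Γ.δ x := by simp [δ]
  have : Γ.L ^ 3 * Γ.δ x ≤ Γ.L ^ 3 * Γ.κ := by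
    have := Γ.L_pos
    gcongr
  nlinarith

lemma dist_R (hx : x ∈ Γ.dom) (hk : Γ.δ x < Γ.κ) {y : ℂ} (hy : y ∈ Γ.dom) :
    ‖y - x‖ + Γ.δ x ≤ 5 * Γ.L ^ 2 * ‖y - Γ.R x‖ := by
  have h1 := R_outside hx hk
  have h2 := (abs_le.1 (Γ.lip (Γ.R x) y)).1
  have hy' : Γ.ρ y < 0 := hy
  have h3 : Γ.δ x ≤ 2 * Γ.L * ‖y - Γ.R x‖ := by linarith
  have h4 : ‖y - x‖ ≤ ‖y - Γ.R x‖ + Γ.L * Γ.δ x := by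
    have e : y - x = (y - Γ.R x) + Γ.δ x * Γ.V x := by simp [R, δ]; ring
    calc ‖y - x‖ ≤ ‖y - Γ.R x‖ + ‖(Γ.δ x : ℂ) * Γ.V x‖ := by
          rw [e]; exact norm_add_le _ _
      _ ≤ _ := by
          rw [norm_mul, norm_real, Real.norm_of_nonneg (Γ.δ_pos hx).le, mul_comm]
          have := Γ.δ_pos hx
          gcongr
          exact Γ.norm_V x
  have hL := Γ.one_le_L
  have := norm_nonneg (y - Γ.R x)
  have h5 : Γ.L * Γ.δ x ≤ Γ.L * (2 * Γ.L * ‖y - Γ.R x‖) := by gcongr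
  nlinarith [mul_nonneg (sub_nonneg.2 hL) this, mul_nonneg (mul_nonneg (sub_nonneg.2 hL) this) Γ.L_pos.le]

lemma sub_R_ne (hx : x ∈ Γ.dom) (hk : Γ.δ x < Γ.κ) {y : ℂ} (hy : y ∈ Γ.dom) :
    y - Γ.R x ≠ 0 := by
  intro h
  have := dist_R hx hk hy
  rw [h, norm_zero, mul_zero] at this
  have := Γ.δ_pos hx
  have := norm_nonneg (y - x)
  linarith

/-- The unimodular factor describing the reflection to first order. -/
noncomputable def refl (Γ : Geo) (x : ℂ) : ℂ := -(conj (dzr Γ.ρ x) * Γ.V x)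

lemma norm_refl (hx : x ∈ Γ.dom) (hk : Γ.δ x < Γ.κ) : ‖Γ.refl x‖ = 1 := by
  rw [refl, norm_neg, norm_mul, RCLike.norm_conj, ← norm_mul, inv_self hx hk, norm_one]

lemma R_sub (hx : x ∈ Γ.dom) (hk : Γ.δ x < Γ.κ) (y : ℂ) :
    ‖Γ.R y - Γ.R x - Γ.refl x * conj (y - x)‖ ≤ 2 * Γ.L ^ 2 * ((‖y - x‖ + Γ.δ x) * ‖y - x‖) := by
  have hL := Γ.one_le_L
  have h0 := Γ.δ_pos hx
  set T : ℝ := Γ.ρ y - Γ.ρ x - fderiv ℝ Γ.ρ x (y - x) with hT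
  have h1 : |T| ≤ Γ.L * ‖y - x‖ ^ 2 := Γ.taylor x y
  have e : Γ.R y - Γ.R x - Γ.refl x * conj (y - x)
      = -((T : ℂ) * Γ.V x) - Γ.ρ y * (Γ.V y - Γ.V x) := by
    have h2 := fderiv_eq_dzr Γ.ρ x (y - x)
    rw [hT]
    push_cast
    rw [h2, R, R, refl]
    linear_combination (-(y - x)) * inv_self hx hk
  rw [e]
  have h3 : |Γ.ρ y| ≤ Γ.δ x + Γ.L * ‖y - x‖ := by
    have := (abs_le.1 (Γ.lip x y))
    simp only [δ] at *
    rw [abs_le]; constructor <;> linarith [this.1, this.2]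
  calc _ ≤ ‖(T : ℂ) * Γ.V x‖ + ‖(Γ.ρ y : ℂ) * (Γ.V y - Γ.V x)‖ := by
        rw [← norm_neg ((T : ℂ) * Γ.V x)]; exact norm_sub_le _ _
    _ ≤ (Γ.L * ‖y - x‖ ^ 2) * Γ.L + (Γ.δ x + Γ.L * ‖y - x‖) * (Γ.L * ‖y - x‖) := by
        rw [norm_mul, norm_mul, norm_real, norm_real, Real.norm_eq_abs, Real.norm_eq_abs]
        gcongr
        · exact Γ.norm_V x
        · exact Γ.lip_V x y
    _ ≤ _ := by
        have := norm_nonneg (y - x)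
        have h5 : Γ.L ≤ Γ.L ^ 2 := by nlinarith
        have : 0 ≤ Γ.δ x * ‖y - x‖ := by positivity
        nlinarith [mul_le_mul_of_nonneg_right h5 this, sq_nonneg Γ.L]

lemma dist_R_R (hx : x ∈ Γ.dom) (hk : Γ.δ x < Γ.κ) {y : ℂ} (hy : ‖y - x‖ ≤ Γ.κ) :
    ‖y - x‖ / 2 ≤ ‖Γ.R y - Γ.R x‖ := by
  have h1 := R_sub hx hk y
  have h2 : ‖y - x‖ = ‖Γ.refl x * conj (y - x)‖ := by
    rw [norm_mul, norm_refl hx hk, one_mul, RCLike.norm_conj]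
  have h3 := norm_sub_norm_le (Γ.refl x * conj (y - x)) (Γ.refl x * conj (y - x) - (Γ.R y - Γ.R x))
  rw [sub_sub_cancel, ← h2, norm_sub_rev (Γ.refl x * _)] at h3
  have h4 := Γ.pow_mul_κ_le (n := 2) (by norm_num)
  have h5 : 2 * Γ.L ^ 2 * (‖y - x‖ + Γ.δ x) ≤ 1 / 2 := by
    have := sq_nonneg Γ.L
    nlinarith
  have := norm_nonneg (y - x)
  nlinarith

lemma dist_self_R (y : ℂ) : ‖y - Γ.R y‖ ≤ Γ.L * |Γ.δ y| := by
  have e : y - Γ.R y = Γ.ρ y * Γ.V y := by simp [R]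
  rw [e, norm_mul, norm_real, mul_comm, Real.norm_eq_abs, δ, abs_neg]
  gcongr
  exact Γ.norm_V y

lemma hasWirt_V (y : ℂ) : HasWirt Γ.V (dz Γ.V y) (db Γ.V y) y :=
  hasWirt_of_diff (Γ.contDiff_V.differentiable one_ne_zero y)

lemma hasWirt_ρ (y : ℂ) : HasWirt (fun y => (Γ.ρ y : ℂ)) (dzr Γ.ρ y) (conj (dzr Γ.ρ y)) y :=
  hasWirt_ofReal (Γ.differentiable_ρ y)

lemma hasWirt_R {y : ℂ} (h : dzr Γ.ρ y * Γ.V y = 1) :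
    HasWirt Γ.R (-(Γ.ρ y * dz Γ.V y)) (db Γ.R y) y := by
  have := ((hasWirt_id y).sub ((hasWirt_ρ (Γ := Γ) y).mul (hasWirt_V (Γ := Γ) y)))
  refine (this.congr_fun (v := Γ.R) (Filter.Eventually.of_forall fun z => rfl)).congr_coeff ?_ ?_
  · linear_combination -h
  · exact (this.congr_fun (v := Γ.R) (Filter.Eventually.of_forall fun z => rfl)).db_eq.symm

lemma hasWirt_σ {y : ℂ} (h : dzr Γ.ρ y * Γ.V y = 1) :
    HasWirt Γ.σ (dz Γ.σ y) (1 + Γ.ρ y * conj (dz Γ.V y)) y := by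
  have := (hasWirt_ρ (Γ := Γ) y).mul (hasWirt_V (Γ := Γ) y).conjugate
  have h2 := this.congr_fun (v := Γ.σ) (Filter.Eventually.of_forall fun z => rfl)
  refine h2.congr_coeff h2.dz_eq.symm ?_
  have h' := congrArg conj h
  simp only [map_mul, map_one] at h'
  linear_combination h'

lemma norm_dz_V (y : ℂ) : ‖dz Γ.V y‖ ≤ Γ.L := (norm_dz_le _ _).trans (Γ.norm_fderiv_V y)

lemma norm_σ_le {y : ℂ} (hy : y ∈ Γ.dom) : ‖Γ.σ y‖ ≤ Γ.L * Γ.δ y := by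
  rw [σ, norm_mul, RCLike.norm_conj, norm_real, Real.norm_eq_abs, mul_comm, ← abs_neg]
  rw [show |-Γ.ρ y| = Γ.δ y from abs_of_pos (Γ.δ_pos hy)]
  have := Γ.δ_pos hy
  gcongr
  exact Γ.norm_V y

lemma contDiff_R : ContDiff ℝ 1 Γ.R :=
  contDiff_id.sub ((ofRealCLM.contDiff.comp (Γ.contDiff_ρ.of_le (by norm_num))).mul Γ.contDiff_V)

lemma contDiff_σ : ContDiff ℝ 1 Γ.σ :=
  (ofRealCLM.contDiff.comp (Γ.contDiff_ρ.of_le (by norm_num))).mul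
    (conjCLE.toContinuousLinearMap.contDiff.comp Γ.contDiff_V)

end Geo

/-- The Cauchy kernel with its singularity removed. -/
noncomputable def ck (x : ℂ) (s : ℝ) (y : ℂ) : ℂ := (1 - cut x s y) * (y - x)⁻¹

section ck

variable {x y : ℂ} {s : ℝ}

lemma ck_eq_zero (hs : 0 < s) (h : ‖y - x‖ ≤ s / 2) : ck x s y = 0 := by
  simp [ck, cut_eq_one hs h]

lemma ck_eventually (hs : 0 < s) (x : ℂ) : ck x s =ᶠ[nhds x] fun _ => 0 := by
  filter_upwards [Metric.closedBall_mem_nhds x (half_pos hs)] with y hy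
  exact ck_eq_zero hs (by simpa [dist_eq] using hy)

lemma hasWirt_inv_sub (h : y ≠ x) : HasWirt (fun y => (y - x)⁻¹) (-((y - x) ^ 2)⁻¹) 0 y := by
  have h2 := ((hasDerivAt_id y).sub_const x).inv (sub_ne_zero.2 h)
  refine (hasWirt_of_deriv h2).congr_coeff ?_ rfl
  simp [neg_div]

lemma hasWirt_ck (hs : 0 < s) (x y : ℂ) : HasWirt (ck x s)
    (-(dz (cut x s) y * (y - x)⁻¹) - (1 - cut x s y) * ((y - x) ^ 2)⁻¹)
    (-((y - x) * ker2 x s y)) y := by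
  rcases eq_or_ne y x with rfl | h
  · refine ((hasWirt_const 0 y).congr_fun (ck_eventually hs y)).congr_coeff ?_ ?_ <;> simp
  · have := ((hasWirt_const 1 y).sub (hasWirt_cut (x := x) (y := y) hs.ne')).mul (hasWirt_inv_sub h)
    refine (this.congr_fun (v := ck x s) (Filter.Eventually.of_forall fun z => rfl)).congr_coeff ?_ ?_
    · rw [(hasWirt_cut (x := x) (y := y) hs.ne').dz_eq]; ring
    · have := sub_ne_zero.2 h
      field_simp
      ring

lemma contDiff_ck (hs : 0 < s) (x : ℂ) : ContDiff ℝ 1 (ck x s) := by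
  rw [contDiff_iff_contDiffAt]
  intro y
  rcases eq_or_ne y x with rfl | h
  · exact contDiffAt_const.congr_of_eventuallyEq (ck_eventually hs y)
  · refine ContDiffAt.mul (contDiff_const.sub (contDiff_cut (n := 1))).contDiffAt ?_
    exact (contDiffAt_id.sub contDiffAt_const).inv (sub_ne_zero.2 h)

lemma norm_ck_le (hs : 0 < s) : ‖ck x s y‖ ≤ 2 / s := by
  by_cases h : ‖y - x‖ ≤ s / 2
  · rw [ck_eq_zero hs h, norm_zero]; positivity
  · push Not at h
    rw [ck, norm_mul, norm_inv]
    have h1 : ‖y - x‖⁻¹ ≤ (s / 2)⁻¹ := inv_anti₀ (by positivity) h.le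
    calc _ ≤ 1 * (s / 2)⁻¹ := by gcongr; exact norm_one_sub_cut_le
      _ = _ := by rw [one_mul, inv_div]

end ck

namespace Geo

variable {Γ : Geo} {x : ℂ}

lemma contDiffOn_holo {g : ℂ → ℂ} (hg : DifferentiableOn ℂ g Γ.dom) : ContDiffOn ℝ 1 g Γ.dom :=
  contDiffOn_of_holo (n := 1) Γ.isOpen_dom hg

lemma hasWirt_holo {g : ℂ → ℂ} (hg : DifferentiableOn ℂ g Γ.dom) {y : ℂ} (hy : y ∈ Γ.dom) :
    HasWirt g (deriv g y) 0 y :=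
  hasWirt_of_deriv (hg.differentiableAt (Γ.isOpen_dom.mem_nhds hy)).hasDerivAt

lemma hasWirt_C1 {f : ℂ → ℂ} (hf : ContDiffOn ℝ 1 f Γ.dom) {y : ℂ} (hy : y ∈ Γ.dom) :
    HasWirt f (dz f y) (db f y) y :=
  hasWirt_of_diff ((hf.differentiableOn one_ne_zero).differentiableAt (Γ.isOpen_dom.mem_nhds hy))

lemma vanish_zero : Γ.Vanish fun _ => 0 := fun τ hτ => ⟨1, one_pos, fun z _ _ => by simpa using hτ.le⟩

lemma Vanish.mul_bdd {u v : ℂ → ℂ} {B : ℝ} (hu : Γ.Vanish u) (hv : ∀ y ∈ Γ.dom, ‖v y‖ ≤ B) :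
    Γ.Vanish fun y => u y * v y := by
  intro τ hτ
  have hB : 0 < |B| + 1 := by positivity
  obtain ⟨ε, hε, h⟩ := hu (τ / (|B| + 1)) (by positivity)
  refine ⟨ε, hε, fun z hz hd => ?_⟩
  rw [norm_mul]
  calc _ ≤ τ / (|B| + 1) * (|B| + 1) := by
        gcongr
        · exact h z hz hd
        · exact (hv z hz).trans ((le_abs_self B).trans (by linarith))
    _ = τ := by field_simp

lemma representation (hx : x ∈ Γ.dom) {f m : ℂ → ℂ} {B : ℝ} (hf : ContDiffOn ℝ 1 f Γ.dom)
    (hv : Γ.Vanish f) (hm : DifferentiableOn ℂ m Γ.dom) (hB : ∀ y ∈ Γ.dom, ‖m y‖ ≤ B)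
    (hm1 : m x = 1) (hi : IntegrableOn (db f) Γ.dom) :
    IntegrableOn (fun y => db f y * (m y * (y - x)⁻¹)) Γ.dom ∧
    ∫ y in Γ.dom, db f y * (m y * (y - x)⁻¹) = -(Real.pi : ℂ) * f x := by
  set s := Γ.rad x with hs'
  have hs : 0 < s := Γ.rad_pos hx
  have hb := Γ.closedBall_rad hx
  have hm' := contDiffOn_holo hm
  have hfm : ContDiffOn ℝ 1 (fun y => f y * m y) Γ.dom := hf.mul hm'
  have hts : tsupport (cut x s) ⊆ Γ.dom := (tsupport_cut_subset hs).trans hb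
  have hcc : HasCompactSupport (cut x s) := hasCompactSupport_of_ball fun _ h => cut_eq_zero hs h.le
  have hck : HasCompactSupport (ker2 x s) := hasCompactSupport_of_ball fun _ h => ker2_eq_zero hs h
  set ψ : ℂ → ℂ := fun y => f y * m y * cut x s y with hψ
  have hψc : ContDiff ℝ 1 ψ := contDiff_mul_of_tsupport Γ.isOpen_dom hfm (contDiff_cut (n := 1)) hts
  have hψs : HasCompactSupport ψ := hcc.mul_left
  have hcp := cauchy_pompeiu hψc hψs x
  set u1 : ℂ → ℂ := fun y => f y * (m y * ck x s y) with hu1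
  have hu1c : ContDiffOn ℝ 1 u1 Γ.dom := hf.mul (hm'.mul (contDiff_ck hs x).contDiffOn)
  have hu1d : ∀ y ∈ Γ.dom, db u1 y = db f y * (m y * ck x s y)
      - f y * m y * ((y - x) * ker2 x s y) := by
    intro y hy
    rw [((hasWirt_C1 hf hy).mul ((hasWirt_holo hm hy).mul (hasWirt_ck hs x y))).db_eq]
    ring
  have hψd : ∀ y ∈ Γ.dom, db ψ y / (y - x) = db f y * (m y * (cut x s y * (y - x)⁻¹))
      + f y * m y * ((y - x) * ker2 x s y) := by
    intro y hy
    rw [(((hasWirt_C1 hf hy).mul (hasWirt_holo hm hy)).mul (hasWirt_cut (x := x) hs.ne')).db_eq]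
    rcases eq_or_ne y x with rfl | h
    · simp
    · have := sub_ne_zero.2 h
      field_simp
      ring
  have hi1 : IntegrableOn (fun y => db u1 y) Γ.dom := by
    refine IntegrableOn.congr_fun (f := fun y => db f y * (m y * ck x s y)
      - f y * m y * ((y - x) * ker2 x s y)) ?_ (fun y hy => (hu1d y hy).symm) Γ.measurableSet_dom
    refine Integrable.sub ?_ ?_
    · refine Integrable.mul_bdd (c := B * (2 / s)) hi ?_ ?_
      · exact (hm'.continuousOn.mul (contDiff_ck hs x).continuous.continuousOn).aestronglyMeasurable
          Γ.measurableSet_dom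
      · filter_upwards [ae_restrict_mem Γ.measurableSet_dom] with y hy
        rw [norm_mul]
        have := hB y hy
        have := (norm_nonneg _).trans this
        gcongr
        exact norm_ck_le hs
    · refine Integrable.integrableOn ?_
      have hX : Continuous fun y => (y - x) * ker2 x s y :=
        (by fun_prop : Continuous fun y => y - x).mul contDiff_ker2.continuous
      have hXs : HasCompactSupport fun y => (y - x) * ker2 x s y := hck.mul_left
      exact (continuous_mul_of_tsupport Γ.isOpen_dom hfm.continuousOn hX
        ((tsupport_subset_closedBall fun y h => by simp [ker2_eq_zero hs h]).trans
          hb)).integrable_of_hasCompactSupport hXs.mul_left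
  have hi2 : Integrable fun y => db ψ y / (y - x) := by
    have := integrable_of_bound_inv (continuous_db hψc)
      (hψs.of_isClosed_subset (isClosed_tsupport _) (tsupport_db_subset _)) x
    refine this.mono' ?_ (Filter.Eventually.of_forall fun y => ?_)
    · exact ((continuous_db hψc).measurable.div (by fun_prop)).aestronglyMeasurable
    · rw [norm_div, div_eq_mul_inv]
  have hdiv := Γ.divergence hu1c (contDiffOn_const (c := (0 : ℂ))) (hv.mul_bdd (B := B * (2 / s)) fun y hy => by
      rw [norm_mul]
      have := hB y hy
      have := (norm_nonneg _).trans this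
      gcongr
      exact norm_ck_le hs) vanish_zero (by
      refine hi1.congr_fun (fun y _ => ?_) Γ.measurableSet_dom
      simp [(hasWirt_const 0 y).dz_eq])
  have hsum : ∀ y ∈ Γ.dom, db u1 y + db ψ y / (y - x) = db f y * (m y * (y - x)⁻¹) := by
    intro y hy
    rw [hu1d y hy, hψd y hy, ck]; ring
  have h0 : ∀ y, y ∉ Γ.dom → db ψ y / (y - x) = 0 := by
    intro y hy
    rw [image_eq_zero_of_notMem_tsupport (f := db ψ), zero_div]
    intro h
    exact hy (hts ((tsupport_mul_subset_right) (tsupport_db_subset _ h)))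
  refine ⟨IntegrableOn.congr_fun (hi1.add hi2.integrableOn) (fun y hy => hsum y hy)
    Γ.measurableSet_dom, ?_⟩
  rw [← setIntegral_congr_fun Γ.measurableSet_dom hsum, integral_add hi1 hi2.integrableOn,
    setIntegral_eq_integral_of_forall_compl_eq_zero h0, hcp]
  have : ∫ y in Γ.dom, db u1 y = 0 := by
    rw [← hdiv]
    refine setIntegral_congr_fun Γ.measurableSet_dom fun y _ => ?_
    simp [(hasWirt_const 0 y).dz_eq]
  rw [this, hψ]
  simp only
  rw [hm1, cut_eq_one hs (by simp; positivity)]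
  ring

lemma norm_le_of_repr {f : ℂ → ℂ} {k : ℂ → ℂ} {w : ℂ → ℝ}
    (he : ∫ y in Γ.dom, db f y * k y = -(Real.pi : ℂ) * f x)
    (hw : ∀ y ∈ Γ.dom, ‖k y‖ ≤ w y) (hi : IntegrableOn (fun y => ‖db f y‖ * w y) Γ.dom) :
    ‖f x‖ ≤ ∫ y in Γ.dom, ‖db f y‖ * w y := by
  have h1 : ‖∫ y in Γ.dom, db f y * k y‖ ≤ ∫ y in Γ.dom, ‖db f y‖ * w y := by
    refine norm_integral_le_of_norm_le hi ?_
    filter_upwards [ae_restrict_mem Γ.measurableSet_dom] with y hy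
    rw [norm_mul]
    gcongr
    exact hw y hy
  rw [he, norm_mul, norm_neg, norm_real, Real.norm_of_nonneg Real.pi_pos.le] at h1
  have := Real.pi_gt_three
  have := norm_nonneg (f x)
  nlinarith

lemma integrableOn_far (hx : x ∈ Γ.dom) {f : ℂ → ℂ} (hf : ContDiffOn ℝ 1 f Γ.dom)
    (hv : Γ.Vanish f) (hi : IntegrableOn (db f) Γ.dom) :
    IntegrableOn (fun y => ‖db f y‖ * ‖y - x‖⁻¹) Γ.dom := by
  have h := (representation hx hf hv (m := fun _ => 1) (B := 1) (differentiableOn_const _)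
    (fun _ _ => by simp) rfl hi).1.norm
  simpa [IntegrableOn] using h

lemma rep_far (hx : x ∈ Γ.dom) {f : ℂ → ℂ} (hf : ContDiffOn ℝ 1 f Γ.dom)
    (hv : Γ.Vanish f) (hi : IntegrableOn (db f) Γ.dom) :
    ‖f x‖ ≤ ∫ y in Γ.dom, ‖db f y‖ * ‖y - x‖⁻¹ := by
  have h := representation hx hf hv (m := fun _ => 1) (B := 1) (differentiableOn_const _)
    (fun _ _ => by simp) rfl hi
  exact norm_le_of_repr h.2 (fun y _ => by simp) (integrableOn_far hx hf hv hi)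

lemma rep_near (hx : x ∈ Γ.dom) (hk : Γ.δ x < Γ.κ) {f : ℂ → ℂ} (hf : ContDiffOn ℝ 1 f Γ.dom)
    (hv : Γ.Vanish f) (hi : IntegrableOn (db f) Γ.dom) :
    IntegrableOn (fun y => ‖db f y‖ *
      (25 * Γ.L ^ 6 * (Γ.δ x ^ 2 * ((‖y - x‖ + Γ.δ x) ^ 2 * ‖y - x‖)⁻¹))) Γ.dom ∧
    ‖f x‖ ≤ ∫ y in Γ.dom, ‖db f y‖ *
      (25 * Γ.L ^ 6 * (Γ.δ x ^ 2 * ((‖y - x‖ + Γ.δ x) ^ 2 * ‖y - x‖)⁻¹)) := by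
  have hL := Γ.L_pos
  have hδ := Γ.δ_pos hx
  set m : ℂ → ℂ := fun y => ((x - Γ.R x) * (y - Γ.R x)⁻¹) ^ 2 with hm
  have hmd : DifferentiableOn ℂ m Γ.dom := by
    intro y hy
    have hne := sub_R_ne hx hk hy
    have h1 : DifferentiableAt ℂ (fun y => y - Γ.R x) y := differentiableAt_id.sub_const _
    have h2 : DifferentiableAt ℂ (fun y => (y - Γ.R x)⁻¹) y := h1.fun_inv hne
    have h3 : DifferentiableAt ℂ (fun y => (x - Γ.R x) * (y - Γ.R x)⁻¹) y := h2.const_mul _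
    exact (h3.fun_pow 2).differentiableWithinAt
  have hmb : ∀ y ∈ Γ.dom, ‖m y‖ ≤ 25 * Γ.L ^ 6 * (Γ.δ x ^ 2 * ((‖y - x‖ + Γ.δ x) ^ 2)⁻¹) := by
    intro y hy
    have h1 := dist_R hx hk hy
    have h2 := Γ.dist_self_R x
    rw [abs_of_pos hδ] at h2
    have h3 : 0 < ‖y - Γ.R x‖ := norm_pos_iff.2 (sub_R_ne hx hk hy)
    have h4 : 0 < ‖y - x‖ + Γ.δ x := by positivity
    rw [hm]
    simp only
    rw [norm_pow, norm_mul, norm_inv]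
    have h5 : ‖y - Γ.R x‖⁻¹ ≤ 5 * Γ.L ^ 2 * (‖y - x‖ + Γ.δ x)⁻¹ := by
      rw [inv_eq_one_div, div_le_iff₀ h3]
      rw [show 5 * Γ.L ^ 2 * (‖y - x‖ + Γ.δ x)⁻¹ * ‖y - Γ.R x‖
        = (5 * Γ.L ^ 2 * ‖y - Γ.R x‖) / (‖y - x‖ + Γ.δ x) by ring, le_div_iff₀ h4]
      linarith
    calc _ ≤ ((Γ.L * Γ.δ x) * (5 * Γ.L ^ 2 * (‖y - x‖ + Γ.δ x)⁻¹)) ^ 2 := by gcongr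
      _ = _ := by rw [← inv_pow]; ring
  have hmB : ∀ y ∈ Γ.dom, ‖m y‖ ≤ 25 * Γ.L ^ 6 := by
    intro y hy
    refine (hmb y hy).trans (mul_le_of_le_one_right (by positivity) ?_)
    rw [← div_eq_mul_inv, div_le_one (by positivity)]
    gcongr
    linarith [norm_nonneg (y - x)]
  have h := representation hx hf hv hmd hmB (by
    have := sub_R_ne hx hk hx
    simp [hm, this]) hi
  have h_int : IntegrableOn (fun y => ‖db f y‖ *
      (25 * Γ.L ^ 6 * (Γ.δ x ^ 2 * ((‖y - x‖ + Γ.δ x) ^ 2 * ‖y - x‖)⁻¹))) Γ.dom := by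
    refine ((integrableOn_far hx hf hv hi).const_mul (25 * Γ.L ^ 6)).mono' ?_ ?_
    · refine AEStronglyMeasurable.mul hi.aestronglyMeasurable.norm ?_
      exact Measurable.aestronglyMeasurable (by fun_prop)
    · refine Filter.Eventually.of_forall fun y => ?_
      rw [Real.norm_of_nonneg (by positivity), mul_left_comm]
      gcongr
      rw [mul_inv, ← mul_assoc]
      refine mul_le_of_le_one_left (by positivity) ?_
      rw [← div_eq_mul_inv, div_le_one (by positivity)]
      gcongr
      linarith [norm_nonneg (y - x)]
  refine ⟨h_int, norm_le_of_repr h.2 (fun y hy => ?_) h_int⟩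
  rw [norm_mul, norm_inv, mul_inv, ← mul_assoc, ← mul_assoc, mul_assoc (25 * Γ.L ^ 6)]
  gcongr
  exact hmb y hy

end Geo

namespace Geo

variable {Γ : Geo} {x : ℂ}

/-- The depth up to which inward paths are followed. -/
noncomputable def t0 (Γ : Geo) : ℝ := 1 / (4 * Γ.L ^ 3)

lemma t0_pos : 0 < Γ.t0 := by have := Γ.L_pos; unfold t0; positivity

lemma L_t0 : Γ.L ^ 3 * Γ.t0 = 1 / 4 := by have := Γ.L_pos; unfold t0; field_simp

lemma t0_le : 4 * Γ.t0 ≤ 1 := by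
  have h := Γ.L_t0
  have h1 : 1 ≤ Γ.L ^ 3 := one_le_pow₀ Γ.one_le_L
  have := Γ.t0_pos
  nlinarith

lemma t0_mul_L_le : 4 * (Γ.t0 * Γ.L) ≤ 1 := by
  have h := Γ.L_t0
  have h1 := Γ.one_le_L
  have h2 : Γ.L ≤ Γ.L ^ 3 := le_self_pow₀ h1 (by norm_num)
  have := Γ.t0_pos
  nlinarith

lemma κ_mul_L_le : 4 * (Γ.L * Γ.κ) ≤ Γ.t0 := by
  have h1 := Γ.pow_mul_κ_le (n := 4) (by norm_num)
  have hL := Γ.L_pos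
  rw [t0, le_div_iff₀ (by positivity)]
  nlinarith

lemma δ_le_one (hk : Γ.δ x < Γ.κ) {y : ℂ} (hy : ‖y - x‖ ≤ Γ.κ) : Γ.δ y ≤ 1 := by
  have h1 := Γ.δ_le x y
  have h2 := Γ.pow_mul_κ_le (n := 1) (by norm_num)
  rw [pow_one] at h2
  have h3 := Γ.κ_le'
  have : Γ.L * ‖y - x‖ ≤ Γ.L * Γ.κ := by have := Γ.L_pos; gcongr
  linarith

lemma path_bound {g : ℂ → ℂ} (hg : DifferentiableOn ℂ g Γ.dom) {β B : ℝ → ℝ}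
    (hβ : AntitoneOn β (Ioi 0)) (hB : ∀ t, 0 < t → HasDerivAt B (β t) t)
    (hd : ∀ z ∈ Γ.dom, ‖deriv g z‖ ≤ β (Γ.δ z)) {y : ℂ} (hy : y ∈ Γ.dom)
    (hV : dzr Γ.ρ y * Γ.V y = 1) :
    ‖g (y - Γ.t0 * Γ.V y) - g y‖ ≤ Γ.L * (B (Γ.δ y + Γ.t0) - B (Γ.δ y)) := by
  have hL := Γ.L_pos
  have hδ := Γ.δ_pos hy
  have ht := Γ.t0_pos
  have hdep : ∀ t ∈ Icc 0 Γ.t0, Γ.δ y + t ≤ Γ.δ (y - t * Γ.V y) := by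
    intro t ht
    refine path_depth hV ht.1 ?_
    have := Γ.L_t0
    have : Γ.L ^ 3 * t ≤ Γ.L ^ 3 * Γ.t0 := by gcongr; exact ht.2
    linarith
  have hmem : ∀ t ∈ Icc 0 Γ.t0, y - t * Γ.V y ∈ Γ.dom := by
    intro t ht
    rw [mem_dom]
    linarith [hdep t ht, ht.1]
  have hder : ∀ t ∈ Icc 0 Γ.t0, HasDerivAt (fun t : ℝ => g (y - t * Γ.V y) - g y)
      (deriv g (y - t * Γ.V y) * (-Γ.V y)) t := by
    intro t ht
    have h1 := (hg.differentiableAt (Γ.isOpen_dom.mem_nhds (hmem t ht))).hasDerivAt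
    have h2 : HasDerivAt (fun t : ℝ => y - (t : ℂ) * Γ.V y) (-Γ.V y) t := by
      have := (((hasDerivAt_id t).ofReal_comp).mul_const (Γ.V y)).const_sub y
      simpa using this
    exact (h1.scomp t h2).sub_const _ |>.congr_deriv (by simp [mul_comm])
  have hBd : ∀ t ∈ Icc 0 Γ.t0, HasDerivAt (fun t => Γ.L * (B (Γ.δ y + t) - B (Γ.δ y)))
      (Γ.L * β (Γ.δ y + t)) t := by
    intro t ht
    have h1 := (hB (Γ.δ y + t) (by linarith [ht.1])).comp_const_add (Γ.δ y) t
    exact (h1.sub_const _).const_mul _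
  have := image_norm_le_of_norm_deriv_right_le_deriv_boundary'
    (f := fun t : ℝ => g (y - t * Γ.V y) - g y) (a := 0) (b := Γ.t0)
    (f' := fun t : ℝ => deriv g (y - t * Γ.V y) * (-Γ.V y))
    (B := fun t => Γ.L * (B (Γ.δ y + t) - B (Γ.δ y))) (B' := fun t => Γ.L * β (Γ.δ y + t))
    (fun t ht => (hder t ht).continuousAt.continuousWithinAt)
    (fun t ht => (hder t (Ico_subset_Icc_self ht)).hasDerivWithinAt) (by simp)
    (fun t ht => (hBd t ht).continuousAt.continuousWithinAt)
    (fun t ht => (hBd t (Ico_subset_Icc_self ht)).hasDerivWithinAt) (by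
      intro t ht
      have ht' := Ico_subset_Icc_self ht
      have h1 := hd _ (hmem t ht')
      have h2 := hβ (show Γ.δ y + t ∈ Ioi 0 by simp; linarith [ht.1]) (Γ.mem_dom.1 (hmem t ht'))
        (hdep t ht')
      rw [norm_mul, norm_neg, mul_comm]
      exact mul_le_mul (Γ.norm_V y) (h1.trans h2) (norm_nonneg _) hL.le) (right_mem_Icc.2 ht.le)
  exact this

lemma endpoint_depth {y : ℂ} (hV : dzr Γ.ρ y * Γ.V y = 1) :
    Γ.δ y + Γ.t0 ≤ Γ.δ (y - Γ.t0 * Γ.V y) :=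
  path_depth hV Γ.t0_pos.le (by rw [Γ.L_t0]; norm_num)

lemma path_bound_rpow {g : ℂ → ℂ} (hg : DifferentiableOn ℂ g Γ.dom) {s P : ℝ} (hs : 0 < s)
    (hP : 0 ≤ P) (hd : ∀ z ∈ Γ.dom, ‖deriv g z‖ ≤ P * Γ.δ z ^ (-1 - s)) {y : ℂ} (hy : y ∈ Γ.dom)
    (hV : dzr Γ.ρ y * Γ.V y = 1) :
    ‖g (y - Γ.t0 * Γ.V y) - g y‖ ≤ Γ.L * (P / s) * Γ.δ y ^ (-s) := by
  have hδ := Γ.δ_pos hy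
  have ht := Γ.t0_pos
  refine (path_bound hg (β := fun t => P * t ^ (-1 - s)) (B := fun t => -(P / s) * t ^ (-s))
    ?_ ?_ hd hy hV).trans ?_
  · intro a ha b hb hab
    have := Real.rpow_le_rpow_of_nonpos ha hab (show -1 - s ≤ 0 by linarith)
    simp only; gcongr
  · intro t ht
    have := (Real.hasDerivAt_rpow_const (p := -s) (Or.inl ht.ne')).const_mul (-(P / s))
    refine this.congr_deriv ?_
    rw [show -s - 1 = -1 - s by ring]; field_simp
  · have h1 : 0 ≤ (Γ.δ y + Γ.t0) ^ (-s) := by positivity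
    have h2 := Γ.L_pos
    have : 0 ≤ P / s * (Γ.δ y + Γ.t0) ^ (-s) := by positivity
    rw [mul_assoc]
    gcongr
    linarith

/-- Near a boundary point a holomorphic function with controlled derivative is controlled up to a
real constant. -/
lemma normalise (Γ : Geo) : ∃ C > 0, ∀ g : ℂ → ℂ, DifferentiableOn ℂ g Γ.dom → ∀ s P : ℝ, 0 < s →
    s ≤ 1 → 0 ≤ P → (∀ z ∈ Γ.dom, ‖deriv g z‖ ≤ P * Γ.δ z ^ (-1 - s)) →
    (∀ z, Γ.t0 ≤ Γ.δ z → |(g z).im| ≤ P) → ∀ x ∈ Γ.dom, Γ.δ x < Γ.κ →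
    ∃ c : ℝ, ∀ y ∈ Γ.dom, ‖y - x‖ ≤ Γ.κ → ‖g y - c‖ ≤ C / s * P * Γ.δ y ^ (-s) := by
  have hL := Γ.L_pos
  have ht := Γ.t0_pos
  have htl := Γ.t0_le
  refine ⟨Γ.L + (Γ.t0 / 2) ^ (-2 : ℝ) + 1, by positivity, ?_⟩
  intro g hg s P hs hs1 hP hd him x hx hk
  set xt := x - Γ.t0 * Γ.V x with hxt
  have hxd : Γ.t0 ≤ Γ.δ xt := by
    have := endpoint_depth (inv_self hx hk); have := Γ.δ_pos hx; linarith
  refine ⟨(g xt).re, fun y hy hyx => ?_⟩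
  have hδ := Γ.δ_pos hy
  have hV := inv_near hx hk (hyx.trans_lt Γ.κ_lt_r0)
  have h1 := path_bound_rpow hg hs hP hd hy hV
  set yt := y - Γ.t0 * Γ.V y with hyt
  have hdist : ‖yt - xt‖ ≤ 2 * Γ.κ := by
    have e : yt - xt = (y - x) - Γ.t0 * (Γ.V y - Γ.V x) := by rw [hyt, hxt]; ring
    rw [e]
    have h3 := Γ.lip_V x y
    have h4 := Γ.t0_mul_L_le
    calc _ ≤ ‖y - x‖ + Γ.t0 * (Γ.L * ‖y - x‖) := by
          refine (norm_sub_le _ _).trans ?_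
          rw [norm_mul, norm_real, Real.norm_of_nonneg ht.le]
          gcongr
      _ ≤ _ := by nlinarith [norm_nonneg (y - x)]
  have hκ := Γ.κ_pos
  have hseg : ∀ w ∈ segment ℝ xt yt, Γ.t0 / 2 ≤ Γ.δ w := by
    intro w hw
    have h3 : ‖w - xt‖ ≤ ‖yt - xt‖ := norm_sub_le_of_mem_segment hw
    have h4 := Γ.le_δ xt w
    have h5 := Γ.κ_mul_L_le
    have : Γ.L * ‖w - xt‖ ≤ Γ.L * (2 * Γ.κ) := by gcongr; exact h3.trans hdist
    linarith
  have h2 : ‖g yt - g xt‖ ≤ P * (Γ.t0 / 2) ^ (-2 : ℝ) * ‖yt - xt‖ := by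
    refine (convex_segment xt yt).norm_image_sub_le_of_norm_deriv_le (𝕜 := ℂ) ?_ ?_
      (left_mem_segment ℝ _ _) (right_mem_segment ℝ _ _)
    · intro w hw
      refine hg.differentiableAt (Γ.isOpen_dom.mem_nhds (Γ.mem_dom.2 ?_))
      linarith [hseg w hw]
    · intro w hw
      have h3 := hseg w hw
      refine (hd w (Γ.mem_dom.2 (by linarith))).trans ?_
      gcongr
      calc _ ≤ (Γ.t0 / 2) ^ (-1 - s) :=
            Real.rpow_le_rpow_of_nonpos (by positivity) h3 (by linarith)
        _ ≤ _ := Real.rpow_le_rpow_of_exponent_ge (by positivity) (by linarith) (by linarith)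
  have h3 : ‖g xt - ((g xt).re : ℂ)‖ ≤ P := by
    have e : g xt - ((g xt).re : ℂ) = (g xt).im * I := by
      apply Complex.ext <;> simp
    rw [e, norm_mul, norm_I, mul_one, norm_real]
    exact him xt hxd
  have h4 : 1 ≤ Γ.δ y ^ (-s) :=
    Real.one_le_rpow_of_pos_of_le_one_of_nonpos hδ (δ_le_one hk hyx) (by linarith)
  have h5 : ‖yt - xt‖ ≤ 1 := by have := Γ.κ_le'; linarith
  set E := (Γ.t0 / 2) ^ (-2 : ℝ) with hE
  have hE0 : 0 ≤ E := by positivity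
  have h6 : (1 : ℝ) ≤ 1 / s := by rw [le_div_iff₀ hs]; linarith
  calc ‖g y - (g xt).re‖ ≤ ‖g yt - g y‖ + ‖g yt - g xt‖ + ‖g xt - ((g xt).re : ℂ)‖ := by
        have e : g y - ((g xt).re : ℂ) = -(g yt - g y) + (g yt - g xt) + (g xt - ((g xt).re : ℂ)) := by
          ring
        rw [e, ← norm_neg (g yt - g y)]
        exact norm_add₃_le
    _ ≤ Γ.L * (P / s) * Γ.δ y ^ (-s) + P * E * 1 + P := by gcongr; exact h2.trans (by gcongr)
    _ ≤ Γ.L * (P / s) * Γ.δ y ^ (-s) + P * E * (1 / s * Γ.δ y ^ (-s)) + P * (1 / s * Γ.δ y ^ (-s)) := by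
        have h7 : 1 ≤ 1 / s * Γ.δ y ^ (-s) := one_le_mul_of_one_le_of_one_le h6 h4
        gcongr
        exact le_mul_of_one_le_right hP h7
    _ = _ := by ring

lemma exists_bound_depth {u : ℂ → ℂ} (hu : ContinuousOn u Γ.dom) {ε : ℝ} (hε : 0 < ε) :
    ∃ K, 0 ≤ K ∧ ∀ z, ε ≤ Γ.δ z → ‖u z‖ ≤ K := by
  obtain ⟨K, hK⟩ := (Γ.isCompact_depth hε).exists_bound_of_continuousOn
    (hu.mono (Γ.depth_subset hε))
  exact ⟨|K|, abs_nonneg _, fun z hz => (hK z hz).trans (le_abs_self K)⟩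

lemma Vanish.exists_bound {u : ℂ → ℂ} (hv : Γ.Vanish u) (hu : ContinuousOn u Γ.dom) :
    ∃ K, 0 ≤ K ∧ ∀ z ∈ Γ.dom, ‖u z‖ ≤ K := by
  obtain ⟨ε, hε, h⟩ := hv 1 one_pos
  obtain ⟨K, hK, h2⟩ := exists_bound_depth hu hε
  refine ⟨K + 1, by positivity, fun z hz => ?_⟩
  rcases lt_or_ge (Γ.δ z) ε with h3 | h3
  · linarith [h z hz h3]
  · linarith [h2 z h3]

lemma Vanish.add {u v : ℂ → ℂ} (hu : Γ.Vanish u) (hv : Γ.Vanish v) :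
    Γ.Vanish fun y => u y + v y := by
  intro τ hτ
  obtain ⟨e1, he1, h1⟩ := hu (τ / 2) (by positivity)
  obtain ⟨e2, he2, h2⟩ := hv (τ / 2) (by positivity)
  refine ⟨min e1 e2, lt_min he1 he2, fun z hz hd => ?_⟩
  have := h1 z hz (hd.trans_le (min_le_left _ _))
  have := h2 z hz (hd.trans_le (min_le_right _ _))
  linarith [norm_add_le (u z) (v z)]

lemma Vanish.mono {u v : ℂ → ℂ} (hu : Γ.Vanish u) (h : ∀ y ∈ Γ.dom, ‖v y‖ ≤ ‖u y‖) :
    Γ.Vanish v := by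
  intro τ hτ
  obtain ⟨e1, he1, h1⟩ := hu τ hτ
  exact ⟨e1, he1, fun z hz hd => (h z hz).trans (h1 z hz hd)⟩

lemma vanish_δ_mul_bdd {u : ℂ → ℂ} {B : ℝ} (hu : ∀ y ∈ Γ.dom, ‖u y‖ ≤ B) :
    Γ.Vanish fun y => (Γ.δ y : ℂ) * u y := by
  refine Vanish.mul_bdd (fun τ hτ => ⟨τ, hτ, fun z hz hd => ?_⟩) hu
  rw [norm_real, Real.norm_of_nonneg (Γ.δ_pos hz).le]; exact hd.le

/-- The reduced Stokes system in complex form. -/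
structure IsSol (Γ : Geo) (q M N : ℝ) (f W g : ℂ → ℂ) : Prop where
  two_lt : 2 < q
  one_le : 1 ≤ M
  nonneg : 0 ≤ N
  contDiff_f : ContDiffOn ℝ 2 f Γ.dom
  contDiff_W : ContDiffOn ℝ 1 W Γ.dom
  holo : DifferentiableOn ℂ g Γ.dom
  eqn : ∀ z ∈ Γ.dom, db f z = W z + conj (g z) - g z
  re_W : ∀ z ∈ Γ.dom, (W z).re = 0
  norm_W : ∀ z ∈ Γ.dom, ‖W z‖ ≤ M
  grad_W : eLpNorm (fun z => fderiv ℝ W z) (ENNReal.ofReal q) (volume.restrict Γ.dom)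
    ≤ ENNReal.ofReal N
  vanish : Γ.Vanish f

namespace IsSol

variable {q M N : ℝ} {f W g : ℂ → ℂ}

lemma contDiff_one (h : IsSol Γ q M N f W g) : ContDiffOn ℝ 1 f Γ.dom :=
  h.contDiff_f.of_le (by norm_num)

lemma deriv_rad (h : IsSol Γ q M N f W g) {τ : ℝ} (hx : x ∈ Γ.dom)
    (hτ : ∀ y, ‖y - x‖ ≤ Γ.rad x → ‖f y‖ ≤ τ) :
    ‖deriv g x‖ ≤ profK * (2 * τ / Γ.rad x ^ 2 + M / Γ.rad x) :=
  norm_deriv_le_of_equation Γ.isOpen_dom h.contDiff_one h.contDiff_W h.holo h.eqn h.norm_W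
    (Γ.rad_pos hx) (Γ.closedBall_rad hx) hτ

/-- The pressure variable is `o(1/δ)` at the boundary. -/
lemma vanish_δ_mul (h : IsSol Γ q M N f W g) : Γ.Vanish fun y => (Γ.δ y : ℂ) * g y := by
  have hL := Γ.L_pos
  have hK := profK_pos
  have ht := Γ.t0_pos
  have hM : 0 < M := one_pos.trans_le h.one_le
  intro τ hτ
  set A : ℝ := 48 * Γ.L ^ 3 * profK with hA
  have hA0 : 0 < A := by positivity
  set τ' : ℝ := τ / (3 * A) with hτ'
  have hτ'0 : 0 < τ' := by positivity
  obtain ⟨ε, hε, hf⟩ := h.vanish τ' hτ'0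
  set ε' := min (ε / 2) (τ' / M) with hε'
  have hε'0 : 0 < ε' := by positivity
  have hcont : ContinuousOn (deriv g) Γ.dom :=
    (h.holo.deriv Γ.isOpen_dom).continuousOn
  obtain ⟨K, hK0, hKb⟩ := exists_bound_depth hcont hε'0
  obtain ⟨K2, hK20, hK2b⟩ := exists_bound_depth h.holo.continuousOn ht
  have hd : ∀ z ∈ Γ.dom, ‖deriv g z‖ ≤ A / Γ.L * τ' * (Γ.δ z ^ 2)⁻¹ + K := by
    intro z hz
    have hδ := Γ.δ_pos hz
    rcases lt_or_ge (Γ.δ z) ε' with h3 | h3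
    · have h4 := h.deriv_rad (τ := τ') hz (fun y hy => hf y (Γ.mem_of_le_rad hz hy) (by
        have h5 := Γ.δ_le z y
        have h6 : Γ.L * ‖y - z‖ ≤ Γ.L * Γ.rad z := by gcongr
        have h7 := Γ.δ_eq_rad z
        have := min_le_left (ε / 2) (τ' / M)
        linarith))
      refine h4.trans ?_
      have h5 : M ≤ τ' / Γ.δ z := by
        rw [le_div_iff₀ hδ]
        have : Γ.δ z ≤ τ' / M := h3.le.trans (min_le_right _ _)
        rw [le_div_iff₀ hM] at this
        linarith
      have h6 : M / Γ.rad z ≤ τ' / Γ.δ z / Γ.rad z := by have := Γ.rad_pos hz; gcongr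
      calc _ ≤ profK * (2 * τ' / Γ.rad z ^ 2 + τ' / Γ.δ z / Γ.rad z) := by gcongr
        _ = profK * τ' * (Γ.δ z ^ 2)⁻¹ * (32 * Γ.L ^ 2 + 4 * Γ.L) := by
            rw [rad]; field_simp; ring
        _ ≤ profK * τ' * (Γ.δ z ^ 2)⁻¹ * (48 * Γ.L ^ 2) := by
            have := Γ.one_le_L
            gcongr
            nlinarith
        _ = A / Γ.L * τ' * (Γ.δ z ^ 2)⁻¹ := by rw [hA]; field_simp
        _ ≤ _ := by linarith
    · have := hKb z h3
      have : 0 ≤ A / Γ.L * τ' * (Γ.δ z ^ 2)⁻¹ := by positivity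
      linarith
  refine ⟨min Γ.κ (τ / (3 * (K2 + Γ.L * K * Γ.t0 + 1))), lt_min Γ.κ_pos (by positivity), ?_⟩
  intro z hz hδz
  have hδ := Γ.δ_pos hz
  have hV := inv_self hz (hδz.trans_le (min_le_left _ _))
  have h1 := path_bound h.holo (β := fun t => A / Γ.L * τ' * (t ^ 2)⁻¹ + K)
    (B := fun t => -(A / Γ.L * τ' * t⁻¹) + K * t) (by
      intro a ha b hb hab
      have ha : 0 < a := ha
      simp only; gcongr) (by
      intro t ht
      have := (((hasDerivAt_inv ht.ne').const_mul (A / Γ.L * τ')).neg).add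
        ((hasDerivAt_id t).const_mul K)
      refine this.congr_deriv ?_
      ring) hd hz hV
  have h2 : ‖g z‖ ≤ K2 + (A * τ' / Γ.δ z + Γ.L * K * Γ.t0) := by
    have h3 := hK2b (z - Γ.t0 * Γ.V z) (by have := endpoint_depth hV; linarith)
    have h4 := norm_sub_norm_le (g z) (g (z - Γ.t0 * Γ.V z))
    rw [norm_sub_rev] at h4
    have h5 : Γ.L * ((-(A / Γ.L * τ' * (Γ.δ z + Γ.t0)⁻¹) + K * (Γ.δ z + Γ.t0))
        - (-(A / Γ.L * τ' * (Γ.δ z)⁻¹) + K * Γ.δ z)) ≤ A * τ' / Γ.δ z + Γ.L * K * Γ.t0 := by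
      have : 0 ≤ A * τ' * (Γ.δ z + Γ.t0)⁻¹ := by positivity
      calc _ = A * τ' / Γ.δ z + Γ.L * K * Γ.t0 - A * τ' * (Γ.δ z + Γ.t0)⁻¹ := by
            field_simp; ring
        _ ≤ _ := by linarith
    linarith
  rw [norm_mul, norm_real, Real.norm_of_nonneg hδ.le]
  have h6 : Γ.δ z * (3 * (K2 + Γ.L * K * Γ.t0 + 1)) ≤ τ := by
    have := hδz.le.trans (min_le_right _ _)
    rwa [le_div_iff₀ (by positivity)] at this
  have h7 : A * τ' = τ / 3 := by rw [hτ']; field_simp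
  calc _ ≤ Γ.δ z * (K2 + (A * τ' / Γ.δ z + Γ.L * K * Γ.t0)) := by gcongr
    _ = Γ.δ z * (K2 + Γ.L * K * Γ.t0) + A * τ' := by field_simp; ring
    _ ≤ τ := by rw [h7]; nlinarith

end IsSol

end Geo

namespace Geo

variable {Γ : Geo} {x : ℂ}

lemma κ_le_one : Γ.κ ≤ 1 := by have := Γ.κ_le'; have := Γ.κ_pos; linarith

lemma rad_lt (hx : x ∈ Γ.dom) (hk : Γ.δ x < Γ.κ) : Γ.rad x < Γ.κ / 4 := by
  have := Γ.rad_le hx; linarith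

section kernels

variable {y : ℂ}

lemma norm_inv_sub_R_le (hx : x ∈ Γ.dom) (hk : Γ.δ x < Γ.κ) (hy : y ∈ Γ.dom) :
    ‖(y - Γ.R x)⁻¹‖ ≤ 18 * Γ.L ^ 2 * (‖y - x‖ + Γ.δ x)⁻¹ := by
  have hδ := Γ.δ_pos hx
  have h1 := dist_R hx hk hy
  have h3 : 0 < ‖y - Γ.R x‖ := norm_pos_iff.2 (sub_R_ne hx hk hy)
  rw [norm_inv, inv_eq_one_div, div_le_iff₀ h3, mul_assoc, inv_mul_eq_div, mul_div_assoc',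
    le_div_iff₀ (by positivity)]
  nlinarith [Γ.L_pos]

lemma norm_inv_R_sub_R_le (hx : x ∈ Γ.dom) (hk : Γ.δ x < Γ.κ) (h1 : Γ.rad x / 2 ≤ ‖y - x‖)
    (h2 : ‖y - x‖ ≤ Γ.κ) :
    ‖(Γ.R y - Γ.R x)⁻¹‖ ≤ 18 * Γ.L ^ 2 * (‖y - x‖ + Γ.δ x)⁻¹ := by
  have hδ := Γ.δ_pos hx
  have hr := Γ.rad_pos hx
  have hL := Γ.one_le_L
  have h3 := dist_R_R hx hk h2
  have h4 : 0 < ‖Γ.R y - Γ.R x‖ := by linarith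
  have h5 := Γ.δ_eq_rad x
  rw [norm_inv, inv_eq_one_div, div_le_iff₀ h4, mul_assoc, inv_mul_eq_div, mul_div_assoc',
    le_div_iff₀ (by positivity), one_mul]
  have h6 : ‖y - x‖ + Γ.δ x ≤ 9 * Γ.L * ‖y - x‖ := by
    rw [h5]; nlinarith [norm_nonneg (y - x)]
  have h7 : 9 * Γ.L * ‖y - x‖ ≤ 9 * Γ.L * (2 * ‖Γ.R y - Γ.R x‖) := by gcongr; linarith
  have h8 : Γ.L * ‖Γ.R y - Γ.R x‖ ≤ Γ.L ^ 2 * ‖Γ.R y - Γ.R x‖ := by gcongr; nlinarith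
  linarith

lemma norm_sq_sub_sq_le {a b : ℂ} {B e : ℝ} (ha : ‖a‖ ≤ B) (hb : ‖b‖ ≤ B)
    (he : ‖a - b‖ ≤ e) : ‖a ^ 2 - b ^ 2‖ ≤ 2 * B * e := by
  have hB := (norm_nonneg a).trans ha
  have h0 := (norm_nonneg _).trans he
  rw [sq_sub_sq, norm_mul]
  have := norm_add_le a b
  calc _ ≤ (B + B) * e := by gcongr; linarith
    _ = _ := by ring

/-- The reflected kernel agrees with the Cauchy-type kernel up to the boundary distance. -/
lemma norm_kernel_sub_le (hx : x ∈ Γ.dom) (hk : Γ.δ x < Γ.κ) (hy : y ∈ Γ.dom)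
    (h1 : Γ.rad x / 2 ≤ ‖y - x‖) (h2 : ‖y - x‖ ≤ Γ.κ) :
    ‖((y - Γ.R x)⁻¹) ^ 2 - ((Γ.R y - Γ.R x)⁻¹) ^ 2‖
      ≤ 2 * Γ.L * (18 * Γ.L ^ 2) ^ 3 * (Γ.δ y * ((‖y - x‖ + Γ.δ x)⁻¹) ^ 3) := by
  have hδ := Γ.δ_pos hx
  have hδy := Γ.δ_pos hy
  have hL := Γ.L_pos
  have ha := norm_inv_sub_R_le hx hk hy
  have hb := norm_inv_R_sub_R_le hx hk h1 h2
  have hr := Γ.rad_pos hx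
  have hb0 : Γ.R y - Γ.R x ≠ 0 := norm_pos_iff.1 (by have := dist_R_R hx hk h2; linarith)
  have ha0 := sub_R_ne hx hk hy
  have h5 : ‖(y - Γ.R x)⁻¹ - (Γ.R y - Γ.R x)⁻¹‖
      ≤ (18 * Γ.L ^ 2 * (‖y - x‖ + Γ.δ x)⁻¹) ^ 2 * (Γ.L * Γ.δ y) := by
    have e : (y - Γ.R x)⁻¹ - (Γ.R y - Γ.R x)⁻¹
        = -((y - Γ.R x)⁻¹ * (Γ.R y - Γ.R x)⁻¹ * (y - Γ.R y)) := by field_simp; ring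
    have h6 := Γ.dist_self_R y
    rw [abs_of_pos hδy] at h6
    rw [e, norm_neg, norm_mul, norm_mul, sq]
    gcongr
  refine (norm_sq_sub_sq_le ha hb h5).trans (le_of_eq ?_)
  ring

lemma norm_kernel_sub_conj_le (hx : x ∈ Γ.dom) (hk : Γ.δ x < Γ.κ)
    (h1 : Γ.rad x / 2 ≤ ‖y - x‖) (h2 : ‖y - x‖ ≤ Γ.κ) :
    ‖((Γ.R y - Γ.R x)⁻¹) ^ 2 - ((Γ.refl x * conj (y - x))⁻¹) ^ 2‖
      ≤ 4 * Γ.L ^ 2 * (18 * Γ.L ^ 2) ^ 3 * (‖y - x‖ * ((‖y - x‖ + Γ.δ x)⁻¹) ^ 2) := by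
  have hδ := Γ.δ_pos hx
  have hL := Γ.one_le_L
  have hb := norm_inv_R_sub_R_le hx hk h1 h2
  have hr := Γ.rad_pos hx
  have hb0 : Γ.R y - Γ.R x ≠ 0 := norm_pos_iff.1 (by have := dist_R_R hx hk h2; linarith)
  have hyx : 0 < ‖y - x‖ := by linarith
  have hc0 : Γ.refl x * conj (y - x) ≠ 0 := norm_pos_iff.1 (by
    rw [norm_mul, norm_refl hx hk, one_mul, RCLike.norm_conj]; exact hyx)
  have hc : ‖(Γ.refl x * conj (y - x))⁻¹‖ ≤ 18 * Γ.L ^ 2 * (‖y - x‖ + Γ.δ x)⁻¹ := by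
    rw [norm_inv, norm_mul, norm_refl hx hk, one_mul, RCLike.norm_conj, inv_eq_one_div,
      div_le_iff₀ hyx, mul_assoc, inv_mul_eq_div, mul_div_assoc', le_div_iff₀ (by positivity),
      Γ.δ_eq_rad x]
    have h6 : Γ.L * (Γ.rad x / 2) ≤ Γ.L * ‖y - x‖ := by gcongr
    have h8 : Γ.L * ‖y - x‖ ≤ Γ.L ^ 2 * ‖y - x‖ := by gcongr; nlinarith
    nlinarith
  have hne : ‖y - x‖ + Γ.δ x ≠ 0 := by positivity
  have h5 : ‖(Γ.R y - Γ.R x)⁻¹ - (Γ.refl x * conj (y - x))⁻¹‖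
      ≤ (18 * Γ.L ^ 2 * (‖y - x‖ + Γ.δ x)⁻¹) ^ 2
        * (2 * Γ.L ^ 2 * ((‖y - x‖ + Γ.δ x) * ‖y - x‖)) := by
    have e : (Γ.R y - Γ.R x)⁻¹ - (Γ.refl x * conj (y - x))⁻¹
        = -((Γ.R y - Γ.R x)⁻¹ * (Γ.refl x * conj (y - x))⁻¹
          * (Γ.R y - Γ.R x - Γ.refl x * conj (y - x))) := by
      generalize Γ.R y - Γ.R x = a at hb0 ⊢
      generalize Γ.refl x * conj (y - x) = b at hc0 ⊢
      field_simp; ring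
    rw [e, norm_neg, norm_mul, norm_mul, sq]
    gcongr
    exact R_sub hx hk y
  refine (norm_sq_sub_sq_le hb hc h5).trans (le_of_eq ?_)
  field_simp
  ring

end kernels

/-- The truncated reflected kernel. -/
noncomputable def rker (Γ : Geo) (x y : ℂ) : ℂ :=
  (1 - cut x (Γ.rad x) y) * ((Γ.R y - Γ.R x)⁻¹) ^ 2

lemma rker_eventually (hx : x ∈ Γ.dom) : Γ.rker x =ᶠ[nhds x] fun _ => 0 := by
  have hr := Γ.rad_pos hx
  filter_upwards [Metric.ball_mem_nhds x (half_pos hr)] with y hy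
  rw [rker, cut_eq_one hr (by simpa [dist_eq] using (Metric.mem_ball.1 hy).le)]
  simp

lemma R_sub_R_ne (hx : x ∈ Γ.dom) (hk : Γ.δ x < Γ.κ) {y : ℂ} (hyx : y ≠ x)
    (h2 : ‖y - x‖ < Γ.κ) : Γ.R y - Γ.R x ≠ 0 :=
  norm_pos_iff.1 (by
    have := dist_R_R hx hk h2.le
    have := norm_pos_iff.2 (sub_ne_zero.2 hyx)
    linarith)

lemma contDiffAt_rker (hx : x ∈ Γ.dom) (hk : Γ.δ x < Γ.κ) {y : ℂ} (h2 : ‖y - x‖ < Γ.κ) :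
    ContDiffAt ℝ 1 (Γ.rker x) y := by
  rcases eq_or_ne y x with rfl | h
  · exact contDiffAt_const.congr_of_eventuallyEq (rker_eventually hx)
  · refine ContDiffAt.mul (contDiff_const.sub (contDiff_cut (n := 1))).contDiffAt ?_
    refine ContDiffAt.pow ?_ 2
    exact (contDiff_R.contDiffAt.sub contDiffAt_const).inv (R_sub_R_ne hx hk h h2)

lemma hasWirt_inv_pow {p q y : ℂ} {u : ℂ → ℂ} (hu : HasWirt u p q y) (h : u y ≠ 0) :
    HasWirt (fun y => ((u y)⁻¹) ^ 2) (-2 * ((u y)⁻¹) ^ 3 * p) (-2 * ((u y)⁻¹) ^ 3 * q) y := by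
  have h1 : HasDerivAt (fun z : ℂ => (z⁻¹) ^ 2) (-2 * ((u y)⁻¹) ^ 3) (u y) := by
    refine ((hasDerivAt_inv h).fun_pow 2).congr_deriv ?_
    rw [← inv_pow]; push_cast; ring
  exact HasWirt.comp_holo h1 hu

lemma dz_rker (hx : x ∈ Γ.dom) (hk : Γ.δ x < Γ.κ) {y : ℂ} (h2 : ‖y - x‖ < Γ.κ) :
    dz (Γ.rker x) y = -dz (cut x (Γ.rad x)) y * ((Γ.R y - Γ.R x)⁻¹) ^ 2
      + (1 - cut x (Γ.rad x) y) * (2 * ((Γ.R y - Γ.R x)⁻¹) ^ 3 * (Γ.ρ y * dz Γ.V y)) := by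
  have hr := Γ.rad_pos hx
  have hc := (hasWirt_cut (x := x) (y := y) hr.ne')
  rcases eq_or_ne y x with rfl | h
  · rw [((hasWirt_const 0 y).congr_fun (rker_eventually hx)).dz_eq, hc.dz_eq,
      cut_eq_one hr (by simp; positivity)]
    simp
  · have hV := inv_near hx hk (h2.trans Γ.κ_lt_r0)
    have h3 := hasWirt_inv_pow ((hasWirt_R hV).sub (hasWirt_const (Γ.R x) y))
      (R_sub_R_ne hx hk h h2)
    have h4 := ((hasWirt_const 1 y).sub (hasWirt_of_diff hc.differentiableAt)).mul h3
    rw [(h4.congr_fun (v := Γ.rker x) (Filter.Eventually.of_forall fun z => rfl)).dz_eq]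
    ring

end Geo

namespace Geo

variable {Γ : Geo} {x : ℂ}

/-- The data for the reflected integral identity at a point near the boundary. -/
structure ReflHyp (Γ : Geo) (x : ℂ) (P s : ℝ) (f G Q S : ℂ → ℂ) : Prop where
  mem : x ∈ Γ.dom
  near : Γ.δ x < Γ.κ
  s_pos : 0 < s
  s_le : s ≤ 1
  nonneg : 0 ≤ P
  holo : DifferentiableOn ℂ G Γ.dom
  contDiff_Q : ContDiffOn ℝ 1 Q Γ.dom
  contDiff_f : ContDiffOn ℝ 1 f Γ.dom
  bound_G : ∀ y ∈ Γ.dom, ‖y - x‖ ≤ Γ.κ → ‖G y‖ ≤ P * Γ.δ y ^ (-s)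
  bound_Q : ∀ y ∈ Γ.dom, ‖y - x‖ ≤ Γ.κ → ‖Q y‖ ≤ P * Γ.δ y ^ (-s)
  vanish_G : Γ.Vanish fun y => (Γ.δ y : ℂ) * G y
  vanish_Q : Γ.Vanish fun y => (Γ.δ y : ℂ) * Q y
  vanish_f : Γ.Vanish f
  eqn : ∀ y ∈ Γ.dom, db f y = Q y + S y - G y
  int_f : IntegrableOn f Γ.dom
  int_S : IntegrableOn S Γ.dom
  int_Q : IntegrableOn (dz Q) Γ.dom

namespace ReflHyp

variable {P s : ℝ} {f G Q S : ℂ → ℂ}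

/-- The first component of the reflected field. -/
noncomputable def u1 (Γ : Geo) (x : ℂ) (f G : ℂ → ℂ) (y : ℂ) : ℂ :=
  (f y + Γ.σ y * G y) * (cut x (Γ.κ / 2) y * ((y - Γ.R x)⁻¹) ^ 3)

/-- The second component of the reflected field. -/
noncomputable def u2 (Γ : Geo) (x : ℂ) (Q : ℂ → ℂ) (y : ℂ) : ℂ :=
  Q y * cut x (Γ.κ / 2) y * (((y - Γ.R x)⁻¹) ^ 2 - Γ.rker x y) * (1 / 2)

lemma eventually_zero {y : ℂ} (h : Γ.κ / 2 < ‖y - x‖) :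
    cut x (Γ.κ / 2) =ᶠ[nhds y] fun _ => 0 := by
  have hk := Γ.κ_pos
  filter_upwards [(isOpen_lt continuous_const (by fun_prop : Continuous fun y => ‖y - x‖)).mem_nhds h]
    with z hz
  exact cut_eq_zero (by positivity) (le_of_lt hz)

lemma u1_eventually {y : ℂ} (h : Γ.κ / 2 < ‖y - x‖) : u1 Γ x f G =ᶠ[nhds y] fun _ => 0 := by
  filter_upwards [eventually_zero h] with z hz
  simp [u1, hz]

lemma u2_eventually {y : ℂ} (h : Γ.κ / 2 < ‖y - x‖) : u2 Γ x Q =ᶠ[nhds y] fun _ => 0 := by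
  filter_upwards [eventually_zero h] with z hz
  simp [u2, hz]

lemma contDiff_u1 (H : ReflHyp Γ x P s f G Q S) : ContDiffOn ℝ 1 (u1 Γ x f G) Γ.dom := by
  refine ContDiffOn.mul (H.contDiff_f.add (contDiff_σ.contDiffOn.mul (contDiffOn_holo H.holo))) ?_
  refine (contDiff_cut (n := 1)).contDiffOn.mul (ContDiffOn.pow ?_ 3)
  exact (contDiff_id.sub contDiff_const).contDiffOn.inv fun y hy => sub_R_ne H.mem H.near hy

lemma contDiff_u2 (H : ReflHyp Γ x P s f G Q S) : ContDiffOn ℝ 1 (u2 Γ x Q) Γ.dom := by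
  intro y hy
  have hk := Γ.κ_pos
  rcases lt_or_ge ‖y - x‖ Γ.κ with h | h
  · refine ContDiffAt.contDiffWithinAt ?_
    refine ContDiffAt.mul (ContDiffAt.mul (ContDiffAt.mul
      (H.contDiff_Q.contDiffAt (Γ.isOpen_dom.mem_nhds hy)) (contDiff_cut (n := 1)).contDiffAt)
      (ContDiffAt.sub (ContDiffAt.pow ?_ 2) (contDiffAt_rker H.mem H.near h))) contDiffAt_const
    exact (contDiffAt_id.sub contDiffAt_const).inv (sub_R_ne H.mem H.near hy)
  · exact (contDiffAt_const.congr_of_eventuallyEq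
      (u2_eventually (by linarith))).contDiffWithinAt

lemma db_u1 (H : ReflHyp Γ x P s f G Q S) {y : ℂ} (hy : y ∈ Γ.dom) (h : ‖y - x‖ < Γ.κ) :
    db (u1 Γ x f G) y =
    (Q y + S y + Γ.ρ y * conj (dz Γ.V y) * G y) * (cut x (Γ.κ / 2) y * ((y - Γ.R x)⁻¹) ^ 3)
      + (f y + Γ.σ y * G y) * (db (cut x (Γ.κ / 2)) y * ((y - Γ.R x)⁻¹) ^ 3) := by
  have hV := inv_near H.mem H.near (h.trans Γ.κ_lt_r0)
  have hk := half_pos Γ.κ_pos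
  have hne := sub_R_ne H.mem H.near hy
  have h1 : HasDerivAt (fun y => ((y - Γ.R x)⁻¹) ^ 3) _ y :=
    (((hasDerivAt_id y).sub_const (Γ.R x)).fun_inv hne).fun_pow 3
  have h2 := ((hasWirt_C1 H.contDiff_f hy).add ((hasWirt_σ hV).mul (hasWirt_holo H.holo hy))).mul
    ((hasWirt_of_diff (hasWirt_cut (x := x) (y := y) hk.ne').differentiableAt).mul
      (hasWirt_of_deriv h1))
  rw [(h2.congr_fun (v := u1 Γ x f G) (Filter.Eventually.of_forall fun z => rfl)).db_eq,
    H.eqn y hy]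
  ring

lemma dz_u2 (H : ReflHyp Γ x P s f G Q S) {y : ℂ} (hy : y ∈ Γ.dom) (h : ‖y - x‖ < Γ.κ) :
    dz (u2 Γ x Q) y =
    ((dz Q y * cut x (Γ.κ / 2) y + Q y * dz (cut x (Γ.κ / 2)) y)
      * (((y - Γ.R x)⁻¹) ^ 2 - Γ.rker x y)
      - Q y * cut x (Γ.κ / 2) y * (2 * ((y - Γ.R x)⁻¹) ^ 3 + dz (Γ.rker x) y)) * (1 / 2) := by
  have hk := half_pos Γ.κ_pos
  have hne := sub_R_ne H.mem H.near hy
  have h1 := hasWirt_inv_pow ((hasWirt_id y).sub (hasWirt_const (Γ.R x) y)) hne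
  have h2 := (((hasWirt_C1 H.contDiff_Q hy).mul
    (hasWirt_of_diff (hasWirt_cut (x := x) (y := y) hk.ne').differentiableAt)).mul
    (h1.sub (hasWirt_of_diff ((contDiffAt_rker H.mem H.near h).differentiableAt one_ne_zero)))).mul
    (hasWirt_const (1 / 2) y)
  rw [(h2.congr_fun (v := u2 Γ x Q) (Filter.Eventually.of_forall fun z => rfl)).dz_eq]
  ring

lemma main_eq (hx : x ∈ Γ.dom) (y : ℂ) :
    conj (ker2 x (Γ.rad x) y) * ((Γ.refl x)⁻¹) ^ 2
      = dz (cut x (Γ.rad x)) y * ((Γ.refl x * conj (y - x))⁻¹) ^ 2 := by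
  have hr := Γ.rad_pos hx
  rw [(hasWirt_cut hr.ne').dz_eq]
  rcases eq_or_ne y x with rfl | h
  · rw [ker2_eq_zero_of_le hr (by simp; positivity)]; simp
  · have : conj (y - x) ≠ 0 := (map_ne_zero _).2 (sub_ne_zero.2 h)
    rw [map_mul, map_pow, mul_inv]
    generalize conj (y - x) = c at this ⊢
    field_simp

lemma cut_mul_dz_cut (hx : x ∈ Γ.dom) (hk : Γ.δ x < Γ.κ) (y : ℂ) :
    cut x (Γ.κ / 2) y * dz (cut x (Γ.rad x)) y = dz (cut x (Γ.rad x)) y := by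
  have hr := Γ.rad_pos hx
  have h1 := rad_lt hx hk
  have hκ := half_pos Γ.κ_pos
  rcases lt_or_ge (Γ.rad x) ‖y - x‖ with h | h
  · rw [(hasWirt_cut hr.ne').dz_eq, ker2_eq_zero hr h]; simp
  · rw [cut_eq_one hκ (by linarith), one_mul]

lemma sum_eq (H : ReflHyp Γ x P s f G Q S) {y : ℂ} (hy : y ∈ Γ.dom) (h : ‖y - x‖ < Γ.κ) :
    db (u1 Γ x f G) y + dz (u2 Γ x Q) y
      - 1 / 2 * ((Γ.refl x)⁻¹) ^ 2 * (Q y * conj (ker2 x (Γ.rad x) y)) =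
    S y * (cut x (Γ.κ / 2) y * ((y - Γ.R x)⁻¹) ^ 3)
    + G y * (Γ.ρ y * conj (dz Γ.V y)) * (cut x (Γ.κ / 2) y * ((y - Γ.R x)⁻¹) ^ 3)
    + f y * (db (cut x (Γ.κ / 2)) y * ((y - Γ.R x)⁻¹) ^ 3)
    + G y * Γ.σ y * (db (cut x (Γ.κ / 2)) y * ((y - Γ.R x)⁻¹) ^ 3)
    + 1 / 2 * (dz Q y * (cut x (Γ.κ / 2) y * (((y - Γ.R x)⁻¹) ^ 2 - Γ.rker x y)))
    + 1 / 2 * (Q y * (dz (cut x (Γ.κ / 2)) y * (((y - Γ.R x)⁻¹) ^ 2 - Γ.rker x y)))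
    + 1 / 2 * (Q y * (dz (cut x (Γ.rad x)) y
      * (((Γ.R y - Γ.R x)⁻¹) ^ 2 - ((Γ.refl x * conj (y - x))⁻¹) ^ 2)))
    - Q y * (Γ.ρ y * dz Γ.V y) * (cut x (Γ.κ / 2) y
      * ((1 - cut x (Γ.rad x) y) * ((Γ.R y - Γ.R x)⁻¹) ^ 3)) := by
  rw [db_u1 H hy h, dz_u2 H hy h, dz_rker H.mem H.near h]
  linear_combination (-Q y / 2) * main_eq H.mem y
    + (Q y / 2 * ((Γ.R y - Γ.R x)⁻¹) ^ 2) * cut_mul_dz_cut H.mem H.near y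

end ReflHyp
end Geo

namespace Geo

variable {Γ : Geo} {x y : ℂ}

lemma δ_le_L_mul (hx : x ∈ Γ.dom) (y : ℂ) : Γ.δ y ≤ Γ.L * (‖y - x‖ + Γ.δ x) := by
  have := Γ.δ_le x y
  have := Γ.one_le_L
  have := Γ.δ_pos hx
  nlinarith

lemma δ_mul_rpow_le (hx : x ∈ Γ.dom) (hy : y ∈ Γ.dom) {s : ℝ} (hs : 0 < s) (h1 : s ≤ 1) :
    Γ.δ y * Γ.δ y ^ (-s) * ((‖y - x‖ + Γ.δ x)⁻¹) ^ 3
      ≤ Γ.L * ((‖y - x‖ + Γ.δ x) ^ (-s) * ((‖y - x‖ + Γ.δ x)⁻¹) ^ 2) := by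
  have hδ := Γ.δ_pos hx
  have hδy := Γ.δ_pos hy
  have hL := Γ.one_le_L
  have h := δ_le_L_mul hx y
  have hE : 0 < ‖y - x‖ + Γ.δ x := by positivity
  set E := ‖y - x‖ + Γ.δ x with hEd
  have e1 : Γ.δ y * Γ.δ y ^ (-s) = Γ.δ y ^ (1 - s) := by
    rw [sub_eq_add_neg, Real.rpow_add hδy, Real.rpow_one]
  have e2 : E * E ^ (-s) = E ^ (1 - s) := by
    rw [sub_eq_add_neg, Real.rpow_add hE, Real.rpow_one]
  have h2 : Γ.δ y ^ (1 - s) ≤ Γ.L * E ^ (1 - s) := by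
    calc _ ≤ (Γ.L * E) ^ (1 - s) := Real.rpow_le_rpow hδy.le h (by linarith)
      _ = Γ.L ^ (1 - s) * E ^ (1 - s) := Real.mul_rpow (by positivity) hE.le
      _ ≤ Γ.L * E ^ (1 - s) := by
        gcongr
        calc Γ.L ^ (1 - s) ≤ Γ.L ^ (1 : ℝ) := Real.rpow_le_rpow_of_exponent_le hL (by linarith)
          _ = Γ.L := Real.rpow_one _
  rw [e1]
  calc _ ≤ Γ.L * E ^ (1 - s) * (E⁻¹) ^ 3 := by gcongr
    _ = _ := by rw [← e2]; field_simp

lemma rpow_rad_le (hx : x ∈ Γ.dom) (h : ‖y - x‖ ≤ Γ.rad x) {s : ℝ} (hs : 0 < s) (h1 : s ≤ 1) :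
    Γ.δ y ^ (-s) ≤ 5 / 2 * (‖y - x‖ + Γ.δ x) ^ (-s) := by
  have hδ := Γ.δ_pos hx
  have h2 := Γ.half_le_δ hx h
  have h3 := Γ.rad_le hx
  have hE : 0 < ‖y - x‖ + Γ.δ x := by positivity
  calc Γ.δ y ^ (-s) ≤ (2 / 5 * (‖y - x‖ + Γ.δ x)) ^ (-s) :=
        Real.rpow_le_rpow_of_nonpos (by positivity) (by linarith) (by linarith)
    _ = (5 / 2) ^ s * (‖y - x‖ + Γ.δ x) ^ (-s) := by
        rw [Real.mul_rpow (by norm_num) hE.le, Real.rpow_neg (by norm_num),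
          ← Real.inv_rpow (by norm_num)]
        norm_num
    _ ≤ _ := by
        gcongr
        calc ((5 / 2 : ℝ)) ^ s ≤ (5 / 2) ^ (1 : ℝ) :=
              Real.rpow_le_rpow_of_exponent_le (by norm_num) h1
          _ = 5 / 2 := Real.rpow_one _

lemma norm_rker_le (hx : x ∈ Γ.dom) (hk : Γ.δ x < Γ.κ) (h : ‖y - x‖ ≤ Γ.κ) :
    ‖Γ.rker x y‖ ≤ (18 * Γ.L ^ 2 * (‖y - x‖ + Γ.δ x)⁻¹) ^ 2 := by
  have hr := Γ.rad_pos hx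
  have hL := Γ.L_pos
  have hδ := Γ.δ_pos hx
  rcases lt_or_ge ‖y - x‖ (Γ.rad x / 2) with h1 | h1
  · rw [rker, cut_eq_one hr h1.le]; simp; positivity
  · rw [rker, norm_mul, norm_pow]
    calc _ ≤ 1 * (18 * Γ.L ^ 2 * (‖y - x‖ + Γ.δ x)⁻¹) ^ 2 := by
          gcongr
          exacts [norm_one_sub_cut_le, norm_inv_R_sub_R_le hx hk h1 h]
      _ = _ := one_mul _

lemma norm_cut_rker_diff_le (hx : x ∈ Γ.dom) (hk : Γ.δ x < Γ.κ) (hy : y ∈ Γ.dom)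
    (h : ‖y - x‖ ≤ Γ.κ) :
    ‖cut x (Γ.κ / 2) y * (((y - Γ.R x)⁻¹) ^ 2 - Γ.rker x y)‖
      ≤ 2 * (18 * Γ.L ^ 2 * (‖y - x‖ + Γ.δ x)⁻¹) ^ 2 := by
  have hL := Γ.L_pos
  have hδ := Γ.δ_pos hx
  have h1 := norm_rker_le hx hk h
  have h2 : ‖((y - Γ.R x)⁻¹) ^ 2‖ ≤ (18 * Γ.L ^ 2 * (‖y - x‖ + Γ.δ x)⁻¹) ^ 2 := by
    rw [norm_pow]; gcongr; exact norm_inv_sub_R_le hx hk hy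
  have h3 := norm_sub_le (((y - Γ.R x)⁻¹) ^ 2) (Γ.rker x y)
  rw [norm_mul]
  calc _ ≤ 1 * (2 * (18 * Γ.L ^ 2 * (‖y - x‖ + Γ.δ x)⁻¹) ^ 2) := by
        gcongr
        exacts [norm_cut_le, by linarith]
    _ = _ := one_mul _

lemma rker_far (hx : x ∈ Γ.dom) (h : Γ.rad x ≤ ‖y - x‖) :
    Γ.rker x y = ((Γ.R y - Γ.R x)⁻¹) ^ 2 := by
  rw [rker, cut_eq_zero (Γ.rad_pos hx) h, sub_zero, one_mul]

lemma dz_cut_eq_zero {s : ℝ} (hs : 0 < s) (h : ‖y - x‖ ≤ s / 2 ∨ s < ‖y - x‖) :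
    dz (cut x s) y = 0 ∧ db (cut x s) y = 0 := by
  have h2 : ker2 x s y = 0 := h.elim (ker2_eq_zero_of_le hs) (ker2_eq_zero hs)
  rw [(hasWirt_cut hs.ne').dz_eq, (hasWirt_cut hs.ne').db_eq, h2]
  simp

lemma norm_dz_cut_rker_diff_le (hx : x ∈ Γ.dom) (hk : Γ.δ x < Γ.κ) (hy : y ∈ Γ.dom)
    (h : ‖y - x‖ ≤ Γ.κ) :
    ‖dz (cut x (Γ.κ / 2)) y * (((y - Γ.R x)⁻¹) ^ 2 - Γ.rker x y)‖
      ≤ 4 * (profK / Γ.κ) * Γ.L * (18 * Γ.L ^ 2) ^ 3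
        * (Γ.δ y * ((‖y - x‖ + Γ.δ x)⁻¹) ^ 3) := by
  have hL := Γ.L_pos
  have hδ := Γ.δ_pos hx
  have hδy := Γ.δ_pos hy
  have hκ := Γ.κ_pos
  have hK := profK_pos
  rcases le_or_gt ‖y - x‖ (Γ.κ / 2 / 2) with h1 | h1
  · rw [(dz_cut_eq_zero (half_pos hκ) (Or.inl h1)).1]; simp; positivity
  · have h2 := rad_lt hx hk
    have hr := Γ.rad_pos hx
    rw [rker_far hx (by linarith), norm_mul]
    calc _ ≤ profK / (Γ.κ / 2) * (2 * Γ.L * (18 * Γ.L ^ 2) ^ 3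
          * (Γ.δ y * ((‖y - x‖ + Γ.δ x)⁻¹) ^ 3)) := by
          gcongr
          exacts [norm_dz_cut_le (half_pos hκ), norm_kernel_sub_le hx hk hy (by linarith) h]
      _ = _ := by field_simp; ring

lemma norm_cut_mul_cube_le (hx : x ∈ Γ.dom) (hk : Γ.δ x < Γ.κ) (hy : y ∈ Γ.dom) :
    ‖cut x (Γ.κ / 2) y * ((y - Γ.R x)⁻¹) ^ 3‖
      ≤ (18 * Γ.L ^ 2) ^ 3 * ((‖y - x‖ + Γ.δ x)⁻¹) ^ 3 := by
  have hL := Γ.L_pos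
  have hδ := Γ.δ_pos hx
  rw [norm_mul, norm_pow, ← mul_pow]
  calc _ ≤ 1 * (18 * Γ.L ^ 2 * (‖y - x‖ + Γ.δ x)⁻¹) ^ 3 := by
        gcongr
        exacts [norm_cut_le, norm_inv_sub_R_le hx hk hy]
    _ = _ := one_mul _

lemma norm_db_cut_mul_cube_le (hx : x ∈ Γ.dom) (hk : Γ.δ x < Γ.κ) (hy : y ∈ Γ.dom) :
    ‖db (cut x (Γ.κ / 2)) y * ((y - Γ.R x)⁻¹) ^ 3‖
      ≤ 2 * (profK / Γ.κ) * (18 * Γ.L ^ 2) ^ 3 * ((‖y - x‖ + Γ.δ x)⁻¹) ^ 3 := by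
  have hL := Γ.L_pos
  have hδ := Γ.δ_pos hx
  have hκ := Γ.κ_pos
  have hK := profK_pos
  rw [norm_mul, norm_pow]
  calc _ ≤ profK / (Γ.κ / 2) * (18 * Γ.L ^ 2 * (‖y - x‖ + Γ.δ x)⁻¹) ^ 3 := by
        gcongr
        exacts [norm_db_cut_le (half_pos hκ), norm_inv_sub_R_le hx hk hy]
    _ = _ := by field_simp

lemma norm_db_cut_mul_cube_le_const (hx : x ∈ Γ.dom) (hk : Γ.δ x < Γ.κ) (hy : y ∈ Γ.dom) :
    ‖db (cut x (Γ.κ / 2)) y * ((y - Γ.R x)⁻¹) ^ 3‖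
      ≤ 128 * (profK / Γ.κ ^ 4) * (18 * Γ.L ^ 2) ^ 3 := by
  have hL := Γ.L_pos
  have hδ := Γ.δ_pos hx
  have hκ := Γ.κ_pos
  have hK := profK_pos
  rcases le_or_gt ‖y - x‖ (Γ.κ / 2 / 2) with h1 | h1
  · rw [(dz_cut_eq_zero (half_pos hκ) (Or.inl h1)).2]; simp; positivity
  · have h2 : (‖y - x‖ + Γ.δ x)⁻¹ ≤ (Γ.κ / 4)⁻¹ := inv_anti₀ (by positivity) (by linarith)
    calc _ ≤ 2 * (profK / Γ.κ) * (18 * Γ.L ^ 2) ^ 3 * ((Γ.κ / 4)⁻¹) ^ 3 := by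
          refine (norm_db_cut_mul_cube_le hx hk hy).trans ?_
          gcongr
      _ = _ := by field_simp; norm_num

lemma norm_dz_cut_kernel_le (hx : x ∈ Γ.dom) (hk : Γ.δ x < Γ.κ) (h : ‖y - x‖ ≤ Γ.rad x) :
    ‖dz (cut x (Γ.rad x)) y
      * (((Γ.R y - Γ.R x)⁻¹) ^ 2 - ((Γ.refl x * conj (y - x))⁻¹) ^ 2)‖
      ≤ 4 * profK * Γ.L ^ 2 * (18 * Γ.L ^ 2) ^ 3 * ((‖y - x‖ + Γ.δ x)⁻¹) ^ 2 := by
  have hL := Γ.L_pos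
  have hδ := Γ.δ_pos hx
  have hK := profK_pos
  have hr := Γ.rad_pos hx
  have hκ := Γ.κ_pos
  rcases le_or_gt ‖y - x‖ (Γ.rad x / 2) with h1 | h1
  · rw [(dz_cut_eq_zero hr (Or.inl h1)).1]; simp; positivity
  · rw [norm_mul]
    have h3 := rad_lt hx hk
    calc _ ≤ profK / Γ.rad x * (4 * Γ.L ^ 2 * (18 * Γ.L ^ 2) ^ 3
          * (Γ.rad x * ((‖y - x‖ + Γ.δ x)⁻¹) ^ 2)) := by
          gcongr
          · exact norm_dz_cut_le hr
          · refine (norm_kernel_sub_conj_le hx hk h1.le (by linarith)).trans ?_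
            gcongr
      _ = _ := by field_simp

lemma norm_cut_rker_cube_le (hx : x ∈ Γ.dom) (hk : Γ.δ x < Γ.κ) (h : ‖y - x‖ ≤ Γ.κ) :
    ‖cut x (Γ.κ / 2) y * ((1 - cut x (Γ.rad x) y) * ((Γ.R y - Γ.R x)⁻¹) ^ 3)‖
      ≤ (18 * Γ.L ^ 2) ^ 3 * ((‖y - x‖ + Γ.δ x)⁻¹) ^ 3 := by
  have hL := Γ.L_pos
  have hδ := Γ.δ_pos hx
  have hr := Γ.rad_pos hx
  rcases le_or_gt ‖y - x‖ (Γ.rad x / 2) with h1 | h1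
  · rw [cut_eq_one hr h1]; simp; positivity
  · rw [norm_mul, norm_mul, norm_pow, ← mul_pow]
    calc _ ≤ 1 * (1 * (18 * Γ.L ^ 2 * (‖y - x‖ + Γ.δ x)⁻¹) ^ 3) := by
          gcongr
          exacts [norm_cut_le, norm_one_sub_cut_le, norm_inv_R_sub_R_le hx hk h1.le h]
      _ = _ := by ring

lemma norm_ρ_mul_le (hy : y ∈ Γ.dom) {c : ℂ} (h : ‖c‖ ≤ Γ.L) :
    ‖(Γ.ρ y : ℂ) * c‖ ≤ Γ.L * Γ.δ y := by
  rw [norm_mul, norm_real, Real.norm_eq_abs, mul_comm, ← abs_neg]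
  rw [show |-Γ.ρ y| = Γ.δ y from abs_of_pos (Γ.δ_pos hy)]
  have := Γ.δ_pos hy
  gcongr

end Geo

namespace Geo

variable {Γ : Geo} {x : ℂ}

/-- The constant of the reflected estimate. -/
noncomputable def reflC (Γ : Geo) : ℝ := 128 * (profK / Γ.κ ^ 4) * Γ.L ^ 2 * (18 * Γ.L ^ 2) ^ 3

lemma reflC_pos : 0 < Γ.reflC := by
  have := Γ.L_pos; have := Γ.κ_pos; have := profK_pos
  unfold reflC; positivity

namespace ReflHyp

variable {P s : ℝ} {f G Q S : ℂ → ℂ}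

lemma norm_terms_le (H : ReflHyp Γ x P s f G Q S) {y : ℂ} (hy : y ∈ Γ.dom)
    (h : ‖y - x‖ < Γ.κ) :
    ‖db (u1 Γ x f G) y + dz (u2 Γ x Q) y
      - 1 / 2 * ((Γ.refl x)⁻¹) ^ 2 * (Q y * conj (ker2 x (Γ.rad x) y))‖ ≤
    (18 * Γ.L ^ 2) ^ 3 * (‖S y‖ * ((‖y - x‖ + Γ.δ x)⁻¹) ^ 3)
    + (18 * Γ.L ^ 2) ^ 3 * Γ.L ^ 2 * (2 + 4 * (profK / Γ.κ) + 5 * profK)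
      * (P * ((‖y - x‖ + Γ.δ x) ^ (-s) * ((‖y - x‖ + Γ.δ x)⁻¹) ^ 2))
    + 128 * (profK / Γ.κ ^ 4) * (18 * Γ.L ^ 2) ^ 3 * ‖f y‖
    + (18 * Γ.L ^ 2) ^ 2 * (‖dz Q y‖ * ((‖y - x‖ + Γ.δ x)⁻¹) ^ 2) := by
  have hx := H.mem
  have hk := H.near
  have hL := Γ.L_pos
  have hδ := Γ.δ_pos hx
  have hδy := Γ.δ_pos hy
  have hκ := Γ.κ_pos
  have hK := profK_pos
  have hP := H.nonneg
  have hD := mul_le_mul_of_nonneg_left (δ_mul_rpow_le hx hy H.s_pos H.s_le) hP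
  have hG := H.bound_G y hy h.le
  have hQ := H.bound_Q y hy h.le
  have hE : 0 < ‖y - x‖ + Γ.δ x := by positivity
  have c1 := norm_cut_mul_cube_le hx hk hy
  have c2 := norm_db_cut_mul_cube_le hx hk hy
  have c3 := norm_db_cut_mul_cube_le_const hx hk hy
  have c4 := norm_cut_rker_diff_le hx hk hy h.le
  have c5 := norm_dz_cut_rker_diff_le hx hk hy h.le
  have c6 := norm_cut_rker_cube_le hx hk h.le
  have c7 := Γ.norm_σ_le hy
  have c8 : ‖(Γ.ρ y : ℂ) * conj (dz Γ.V y)‖ ≤ Γ.L * Γ.δ y :=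
    norm_ρ_mul_le hy (by rw [RCLike.norm_conj]; exact Γ.norm_dz_V y)
  have c9 : ‖(Γ.ρ y : ℂ) * dz Γ.V y‖ ≤ Γ.L * Γ.δ y := norm_ρ_mul_le hy (Γ.norm_dz_V y)
  rw [sum_eq H hy h]
  set E := ‖y - x‖ + Γ.δ x with hEd
  have d2 : ‖G y * (Γ.ρ y * conj (dz Γ.V y)) * (cut x (Γ.κ / 2) y * ((y - Γ.R x)⁻¹) ^ 3)‖
      ≤ (18 * Γ.L ^ 2) ^ 3 * Γ.L ^ 2 * (P * (E ^ (-s) * (E⁻¹) ^ 2)) := by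
    rw [norm_mul, norm_mul]
    calc _ ≤ (P * Γ.δ y ^ (-s)) * (Γ.L * Γ.δ y) * ((18 * Γ.L ^ 2) ^ 3 * (E⁻¹) ^ 3) := by gcongr
      _ = (18 * Γ.L ^ 2) ^ 3 * Γ.L * (P * (Γ.δ y * Γ.δ y ^ (-s) * (E⁻¹) ^ 3)) := by ring
      _ ≤ (18 * Γ.L ^ 2) ^ 3 * Γ.L * (P * (Γ.L * (E ^ (-s) * (E⁻¹) ^ 2))) := by gcongr
      _ = _ := by ring
  have d4 : ‖G y * Γ.σ y * (db (cut x (Γ.κ / 2)) y * ((y - Γ.R x)⁻¹) ^ 3)‖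
      ≤ 2 * (profK / Γ.κ) * (18 * Γ.L ^ 2) ^ 3 * Γ.L ^ 2 * (P * (E ^ (-s) * (E⁻¹) ^ 2)) := by
    rw [norm_mul, norm_mul]
    calc _ ≤ (P * Γ.δ y ^ (-s)) * (Γ.L * Γ.δ y)
          * (2 * (profK / Γ.κ) * (18 * Γ.L ^ 2) ^ 3 * (E⁻¹) ^ 3) := by gcongr
      _ = 2 * (profK / Γ.κ) * (18 * Γ.L ^ 2) ^ 3 * Γ.L
          * (P * (Γ.δ y * Γ.δ y ^ (-s) * (E⁻¹) ^ 3)) := by ring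
      _ ≤ 2 * (profK / Γ.κ) * (18 * Γ.L ^ 2) ^ 3 * Γ.L
          * (P * (Γ.L * (E ^ (-s) * (E⁻¹) ^ 2))) := by gcongr
      _ = _ := by ring
  have d6 : ‖Q y * (dz (cut x (Γ.κ / 2)) y * (((y - Γ.R x)⁻¹) ^ 2 - Γ.rker x y))‖
      ≤ 4 * (profK / Γ.κ) * (18 * Γ.L ^ 2) ^ 3 * Γ.L ^ 2 * (P * (E ^ (-s) * (E⁻¹) ^ 2)) := by
    rw [norm_mul]
    calc _ ≤ (P * Γ.δ y ^ (-s)) * (4 * (profK / Γ.κ) * Γ.L * (18 * Γ.L ^ 2) ^ 3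
          * (Γ.δ y * (E⁻¹) ^ 3)) := by gcongr
      _ = 4 * (profK / Γ.κ) * (18 * Γ.L ^ 2) ^ 3 * Γ.L
          * (P * (Γ.δ y * Γ.δ y ^ (-s) * (E⁻¹) ^ 3)) := by ring
      _ ≤ 4 * (profK / Γ.κ) * (18 * Γ.L ^ 2) ^ 3 * Γ.L
          * (P * (Γ.L * (E ^ (-s) * (E⁻¹) ^ 2))) := by gcongr
      _ = _ := by ring
  have d8 : ‖Q y * (Γ.ρ y * dz Γ.V y) * (cut x (Γ.κ / 2) y
      * ((1 - cut x (Γ.rad x) y) * ((Γ.R y - Γ.R x)⁻¹) ^ 3))‖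
      ≤ (18 * Γ.L ^ 2) ^ 3 * Γ.L ^ 2 * (P * (E ^ (-s) * (E⁻¹) ^ 2)) := by
    rw [norm_mul, norm_mul]
    calc _ ≤ (P * Γ.δ y ^ (-s)) * (Γ.L * Γ.δ y) * ((18 * Γ.L ^ 2) ^ 3 * (E⁻¹) ^ 3) := by gcongr
      _ = (18 * Γ.L ^ 2) ^ 3 * Γ.L * (P * (Γ.δ y * Γ.δ y ^ (-s) * (E⁻¹) ^ 3)) := by ring
      _ ≤ (18 * Γ.L ^ 2) ^ 3 * Γ.L * (P * (Γ.L * (E ^ (-s) * (E⁻¹) ^ 2))) := by gcongr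
      _ = _ := by ring
  have d7 : ‖Q y * (dz (cut x (Γ.rad x)) y
      * (((Γ.R y - Γ.R x)⁻¹) ^ 2 - ((Γ.refl x * conj (y - x))⁻¹) ^ 2))‖
      ≤ 10 * profK * (18 * Γ.L ^ 2) ^ 3 * Γ.L ^ 2 * (P * (E ^ (-s) * (E⁻¹) ^ 2)) := by
    rcases lt_or_ge (Γ.rad x) ‖y - x‖ with h1 | h1
    · rw [(dz_cut_eq_zero (Γ.rad_pos hx) (Or.inr h1)).1]; simp; positivity
    · rw [norm_mul]
      have h2 := rpow_rad_le hx h1 H.s_pos H.s_le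
      calc _ ≤ (P * (5 / 2 * E ^ (-s))) * (4 * profK * Γ.L ^ 2 * (18 * Γ.L ^ 2) ^ 3
            * (E⁻¹) ^ 2) := by
            gcongr
            · exact hQ.trans (by gcongr)
            · exact norm_dz_cut_kernel_le hx hk h1
        _ = _ := by ring
  have d1 : ‖S y * (cut x (Γ.κ / 2) y * ((y - Γ.R x)⁻¹) ^ 3)‖
      ≤ (18 * Γ.L ^ 2) ^ 3 * (‖S y‖ * (E⁻¹) ^ 3) := by
    rw [norm_mul]
    calc _ ≤ ‖S y‖ * ((18 * Γ.L ^ 2) ^ 3 * (E⁻¹) ^ 3) := by gcongr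
      _ = _ := by ring
  have d3 : ‖f y * (db (cut x (Γ.κ / 2)) y * ((y - Γ.R x)⁻¹) ^ 3)‖
      ≤ 128 * (profK / Γ.κ ^ 4) * (18 * Γ.L ^ 2) ^ 3 * ‖f y‖ := by
    rw [norm_mul, mul_comm]; gcongr
  have d5 : ‖dz Q y * (cut x (Γ.κ / 2) y * (((y - Γ.R x)⁻¹) ^ 2 - Γ.rker x y))‖
      ≤ 2 * (18 * Γ.L ^ 2) ^ 2 * (‖dz Q y‖ * (E⁻¹) ^ 2) := by
    rw [norm_mul]
    calc _ ≤ ‖dz Q y‖ * (2 * (18 * Γ.L ^ 2 * E⁻¹) ^ 2) := by gcongr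
      _ = _ := by ring
  refine (norm_sub_le _ _).trans ?_
  refine (add_le_add_left ((norm_add_le _ _).trans (add_le_add_left ((norm_add_le _ _).trans
    (add_le_add_left ((norm_add_le _ _).trans (add_le_add_left ((norm_add_le _ _).trans
    (add_le_add_left ((norm_add_le _ _).trans (add_le_add_left (norm_add_le _ _) _)) _)) _)) _))
      _)) _).trans ?_
  have n1 : ∀ z : ℂ, ‖1 / 2 * z‖ = ‖z‖ / 2 := fun z => by rw [norm_mul]; norm_num; ring
  rw [n1, n1, n1]
  linarith

lemma norm_sub_main_le (H : ReflHyp Γ x P s f G Q S) {y : ℂ} (hy : y ∈ Γ.dom) :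
    ‖db (u1 Γ x f G) y + dz (u2 Γ x Q) y
      - 1 / 2 * ((Γ.refl x)⁻¹) ^ 2 * (Q y * conj (ker2 x (Γ.rad x) y))‖ ≤
    Γ.reflC * (P * (‖y - x‖ + Γ.δ x) ^ (-(2 + s)) + ‖f y‖
      + ‖S y‖ * ((‖y - x‖ + Γ.δ x)⁻¹) ^ 3 + ‖dz Q y‖ * ((‖y - x‖ + Γ.δ x)⁻¹) ^ 2) := by
  have hx := H.mem
  have hδ := Γ.δ_pos hx
  have hL := Γ.one_le_L
  have hκ := Γ.κ_pos
  have hκ1 := Γ.κ_le_one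
  have hK := one_le_profK
  have hP := H.nonneg
  have hC := Γ.reflC_pos
  have hE : 0 < ‖y - x‖ + Γ.δ x := by positivity
  rcases lt_or_ge ‖y - x‖ Γ.κ with h | h
  · refine (norm_terms_le H hy h).trans ?_
    have e1 : (‖y - x‖ + Γ.δ x) ^ (-(2 + s))
        = (‖y - x‖ + Γ.δ x) ^ (-s) * ((‖y - x‖ + Γ.δ x)⁻¹) ^ 2 := by
      rw [show -(2 + s) = -s - (2 : ℕ) by push_cast; ring, Real.rpow_sub_natCast hE.ne', inv_pow,
        div_eq_mul_inv]
    rw [e1]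
    have hm : 1 ≤ 18 * Γ.L ^ 2 := by nlinarith
    have hL2 : 1 ≤ Γ.L ^ 2 := by nlinarith
    have hκ4 : Γ.κ ^ 4 ≤ Γ.κ := by
      calc Γ.κ ^ 4 ≤ Γ.κ ^ 1 := pow_le_pow_of_le_one hκ.le hκ1 (by norm_num)
        _ = Γ.κ := pow_one _
    have hq1 : profK / Γ.κ ≤ profK / Γ.κ ^ 4 := by gcongr
    have hq2 : profK ≤ profK / Γ.κ := by rw [le_div_iff₀ hκ]; nlinarith
    have hm23 : (18 * Γ.L ^ 2) ^ 2 ≤ (18 * Γ.L ^ 2) ^ 3 := pow_le_pow_right₀ hm (by norm_num)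
    set m3 := (18 * Γ.L ^ 2) ^ 3 with hm3
    have hm30 : 0 < m3 := by positivity
    set q := profK / Γ.κ ^ 4 with hq
    have hq0 : 1 ≤ q := by linarith
    have b1 : m3 ≤ Γ.reflC := by
      have : m3 ≤ m3 * (128 * q * Γ.L ^ 2) := le_mul_of_one_le_right hm30.le (by nlinarith)
      rw [reflC]; linarith
    have b2 : m3 * Γ.L ^ 2 * (2 + 4 * (profK / Γ.κ) + 5 * profK) ≤ Γ.reflC := by
      have : 2 + 4 * (profK / Γ.κ) + 5 * profK ≤ 128 * q := by linarith
      have h2 : m3 * Γ.L ^ 2 * (2 + 4 * (profK / Γ.κ) + 5 * profK) ≤ m3 * Γ.L ^ 2 * (128 * q) := by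
        gcongr
      rw [reflC]; linarith
    have b3 : 128 * q * m3 ≤ Γ.reflC := by
      have : 128 * q * m3 ≤ 128 * q * m3 * Γ.L ^ 2 := le_mul_of_one_le_right (by positivity) hL2
      rw [reflC]; linarith
    have b4 : (18 * Γ.L ^ 2) ^ 2 ≤ Γ.reflC := hm23.trans b1
    calc _ ≤ Γ.reflC * (‖S y‖ * ((‖y - x‖ + Γ.δ x)⁻¹) ^ 3)
        + Γ.reflC * (P * ((‖y - x‖ + Γ.δ x) ^ (-s) * ((‖y - x‖ + Γ.δ x)⁻¹) ^ 2))
        + Γ.reflC * ‖f y‖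
        + Γ.reflC * (‖dz Q y‖ * ((‖y - x‖ + Γ.δ x)⁻¹) ^ 2) := by gcongr
      _ = _ := by ring
  · have h2 : Γ.κ / 2 < ‖y - x‖ := by linarith
    rw [((hasWirt_const 0 y).congr_fun (u1_eventually h2)).db_eq,
      ((hasWirt_const 0 y).congr_fun (u2_eventually h2)).dz_eq,
      ker2_eq_zero (Γ.rad_pos hx) (by have := rad_lt hx H.near; linarith)]
    simp
    positivity

lemma vanish_u1 (H : ReflHyp Γ x P s f G Q S) : Γ.Vanish (u1 Γ x f G) := by
  have hx := H.mem
  have hδ := Γ.δ_pos hx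
  have hL := Γ.L_pos
  have h1 : Γ.Vanish fun y => (Γ.δ y : ℂ) * G y * Γ.L :=
    H.vanish_G.mul_bdd (B := Γ.L) fun y _ => by simp [abs_of_pos hL]
  have h2 : Γ.Vanish fun y => Γ.σ y * G y := h1.mono fun y hy => by
    rw [norm_mul, norm_mul, norm_mul, norm_real, norm_real, Real.norm_of_nonneg (Γ.δ_pos hy).le,
      Real.norm_of_nonneg hL.le]
    have := Γ.norm_σ_le hy
    nlinarith [norm_nonneg (G y)]
  refine (H.vanish_f.add h2).mul_bdd (B := (18 * Γ.L ^ 2) ^ 3 * ((Γ.δ x)⁻¹) ^ 3) fun y hy => ?_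
  refine (norm_cut_mul_cube_le hx H.near hy).trans ?_
  gcongr
  linarith [norm_nonneg (y - x)]

lemma vanish_u2 (H : ReflHyp Γ x P s f G Q S) : Γ.Vanish (u2 Γ x Q) := by
  have hx := H.mem
  have hδ := Γ.δ_pos hx
  have hL := Γ.L_pos
  have hκ := Γ.κ_pos
  set B := 2 * Γ.L * (18 * Γ.L ^ 2) ^ 3 * ((Γ.δ x)⁻¹) ^ 3 with hB
  have hB0 : 0 < B := by positivity
  have h1 : Γ.Vanish fun y => (Γ.δ y : ℂ) * Q y * B :=
    H.vanish_Q.mul_bdd (B := B) fun y _ => by simp [abs_of_pos hB0]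
  intro τ hτ
  obtain ⟨ε, hε, h⟩ := h1 τ hτ
  refine ⟨min ε (Γ.δ x / 2), by positivity, fun y hy hd => ?_⟩
  have hδy := Γ.δ_pos hy
  refine le_trans ?_ (h y hy (hd.trans_le (min_le_left _ _)))
  have hr : Γ.rad x < ‖y - x‖ := by
    by_contra hn
    have := Γ.half_le_δ hx (not_lt.1 hn)
    have := hd.trans_le (min_le_right _ _)
    linarith
  rcases lt_or_ge ‖y - x‖ Γ.κ with h3 | h3
  · rw [u2, rker_far hx hr.le]
    have hr0 := Γ.rad_pos hx
    have h4 := norm_kernel_sub_le hx H.near hy (by linarith) h3.le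
    have h5 : ((‖y - x‖ + Γ.δ x)⁻¹) ^ 3 ≤ ((Γ.δ x)⁻¹) ^ 3 := by
      gcongr; linarith [norm_nonneg (y - x)]
    rw [norm_mul, norm_mul, norm_mul, norm_mul, norm_mul, norm_real, norm_real,
      Real.norm_of_nonneg hδy.le, Real.norm_of_nonneg hB0.le]
    calc _ ≤ ‖Q y‖ * 1 * (2 * Γ.L * (18 * Γ.L ^ 2) ^ 3 * (Γ.δ y * ((Γ.δ x)⁻¹) ^ 3)) * 1 := by
          gcongr
          · exact norm_cut_le
          · exact h4.trans (by gcongr)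
          · norm_num
      _ = _ := by rw [hB]; ring
  · rw [u2, cut_eq_zero (half_pos hκ) (by linarith)]
    simp only [mul_zero, zero_mul, norm_zero]
    positivity

/-- The reflected integral estimate. -/
lemma estimate (H : ReflHyp Γ x P s f G Q S) :
    ‖∫ y, Q y * conj (ker2 x (Γ.rad x) y)‖ ≤ 2 * Γ.reflC *
      (P * ((∫ y : ℂ, (1 + ‖y‖) ^ (-(2 + s))) * Γ.δ x ^ (-s)) + (∫ y in Γ.dom, ‖f y‖)
      + (∫ y in Γ.dom, ‖S y‖ * ((‖y - x‖ + Γ.δ x)⁻¹) ^ 3)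
      + ∫ y in Γ.dom, ‖dz Q y‖ * ((‖y - x‖ + Γ.δ x)⁻¹) ^ 2) := by
  have hx := H.mem
  have hδ := Γ.δ_pos hx
  have hr := Γ.rad_pos hx
  have hC := Γ.reflC_pos
  have hs := H.s_pos
  have hP := H.nonneg
  set Mn : ℂ → ℂ := fun y => 1 / 2 * ((Γ.refl x)⁻¹) ^ 2 * (Q y * conj (ker2 x (Γ.rad x) y))
    with hMn
  set T : ℂ → ℂ := fun y => db (u1 Γ x f G) y + dz (u2 Γ x Q) y with hT
  have hts : tsupport (fun y => conj (ker2 x (Γ.rad x) y)) ⊆ Metric.closedBall x (Γ.rad x) :=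
    tsupport_subset_closedBall fun y h => by simp [ker2_eq_zero hr h]
  have hQk : Integrable fun y => Q y * conj (ker2 x (Γ.rad x) y) := by
    refine (continuous_mul_of_tsupport Γ.isOpen_dom H.contDiff_Q.continuousOn
      (continuous_conj.comp contDiff_ker2.continuous)
      (hts.trans (Γ.closedBall_rad hx))).integrable_of_hasCompactSupport ?_
    exact (hasCompactSupport_of_ball (x := x) (s := Γ.rad x) fun y h => by simp [ker2_eq_zero hr h] :
      HasCompactSupport fun y => conj (ker2 x (Γ.rad x) y)).mul_left
  have hMi : Integrable Mn := hQk.const_mul _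
  have i1 : IntegrableOn (fun y => P * (‖y - x‖ + Γ.δ x) ^ (-(2 + s))) Γ.dom :=
    ((integrable_add_rpow (by linarith) x hδ).const_mul P).integrableOn
  have w : ∀ n : ℕ, ∀ u : ℂ → ℂ, IntegrableOn u Γ.dom →
      IntegrableOn (fun y => ‖u y‖ * ((‖y - x‖ + Γ.δ x)⁻¹) ^ n) Γ.dom := by
    intro n u hu
    refine (hu.norm.mul_const (((Γ.δ x)⁻¹) ^ n)).mono' ?_ (Filter.Eventually.of_forall fun y => ?_)
    · exact hu.aestronglyMeasurable.norm.mul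
        (Measurable.aestronglyMeasurable (by fun_prop))
    · rw [Real.norm_of_nonneg (by positivity)]
      gcongr
      linarith [norm_nonneg (y - x)]
  have i3 := w 3 S H.int_S
  have i4 := w 2 (dz Q) H.int_Q
  have i12 := i1.add H.int_f.norm
  have i123 := i12.add i3
  have ib := (i123.add i4).const_mul Γ.reflC
  have hTm : AEStronglyMeasurable T (volume.restrict Γ.dom) :=
    ((continuousOn_db Γ.isOpen_dom H.contDiff_u1).add
      (continuousOn_dz Γ.isOpen_dom H.contDiff_u2)).aestronglyMeasurable Γ.measurableSet_dom
  have hsub : IntegrableOn (fun y => T y - Mn y) Γ.dom := by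
    refine Integrable.mono' ib (hTm.sub hMi.aestronglyMeasurable.restrict) ?_
    filter_upwards [ae_restrict_mem Γ.measurableSet_dom] with y hy
    exact norm_sub_main_le H hy
  have hTi : IntegrableOn T Γ.dom := by
    refine (hsub.add hMi.integrableOn).congr_fun (fun y _ => ?_) Γ.measurableSet_dom
    simp
  have h0 := Γ.divergence H.contDiff_u1 H.contDiff_u2 (vanish_u1 H) (vanish_u2 H) hTi
  have h1 : ∫ y in Γ.dom, (T y - Mn y) = -(1 / 2 * ((Γ.refl x)⁻¹) ^ 2
      * ∫ y, Q y * conj (ker2 x (Γ.rad x) y)) := by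
    rw [integral_sub hTi hMi.integrableOn, h0, zero_sub,
      setIntegral_eq_integral_of_forall_compl_eq_zero, integral_const_mul]
    intro y hy
    rw [hMn]
    simp only
    rw [ker2_eq_zero hr]
    · simp
    · by_contra hn
      exact hy (Γ.mem_of_le_rad hx (not_lt.1 hn))
  have h2 : ‖∫ y in Γ.dom, (T y - Mn y)‖ ≤ ∫ y in Γ.dom, Γ.reflC *
      (P * (‖y - x‖ + Γ.δ x) ^ (-(2 + s)) + ‖f y‖
      + ‖S y‖ * ((‖y - x‖ + Γ.δ x)⁻¹) ^ 3 + ‖dz Q y‖ * ((‖y - x‖ + Γ.δ x)⁻¹) ^ 2) := by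
    refine norm_integral_le_of_norm_le ib ?_
    filter_upwards [ae_restrict_mem Γ.measurableSet_dom] with y hy
    exact norm_sub_main_le H hy
  rw [h1, norm_neg, norm_mul, norm_mul, norm_pow, norm_inv, norm_refl hx H.near,
    integral_const_mul] at h2
  have e1 := integral_add i123 i4
  have e2 := integral_add i12 i3
  have e3 := integral_add i1 H.int_f.norm
  simp only [Pi.add_apply] at e1 e2 e3
  rw [e1, e2, e3, integral_const_mul] at h2
  have h5 : ∫ y in Γ.dom, (‖y - x‖ + Γ.δ x) ^ (-(2 + s))
      ≤ (∫ y : ℂ, (1 + ‖y‖) ^ (-(2 + s))) * Γ.δ x ^ (-s) := by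
    have h6 := integral_add_rpow (a := 2 + s) x hδ
    rw [show 2 - (2 + s) = -s by ring] at h6
    rw [← h6]
    exact setIntegral_le_integral (integrable_add_rpow (by linarith) x hδ)
      (Filter.Eventually.of_forall fun y => by simp only [Pi.zero_apply]; positivity)
  have h7 : P * ∫ y in Γ.dom, (‖y - x‖ + Γ.δ x) ^ (-(2 + s))
      ≤ P * ((∫ y : ℂ, (1 + ‖y‖) ^ (-(2 + s))) * Γ.δ x ^ (-s)) := by gcongr
  have h8 : ‖(1 / 2 : ℂ)‖ = 1 / 2 := by norm_num
  rw [h8, inv_one, one_pow, mul_one] at h2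
  have h9 := mul_le_mul_of_nonneg_left h7 hC.le
  simp only [mul_add] at h2 ⊢
  linarith

end ReflHyp
end Geo

namespace Geo

variable {Γ : Geo} {x : ℂ}

lemma integrableOn_of_bdd {E : Type*} [NormedAddCommGroup E] {u : ℂ → E} {B : ℝ}
    (hu : ContinuousOn u Γ.dom) (hB : ∀ y ∈ Γ.dom, ‖u y‖ ≤ B) : IntegrableOn u Γ.dom := by
  refine ⟨hu.aestronglyMeasurable Γ.measurableSet_dom,
    HasFiniteIntegral.restrict_of_bounded (C := B) Γ.volume_dom_lt_top ?_⟩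
  filter_upwards [ae_restrict_mem Γ.measurableSet_dom] with y hy using hB y hy

lemma Vanish.integrableOn {u : ℂ → ℂ} (hv : Γ.Vanish u) (hu : ContinuousOn u Γ.dom) :
    IntegrableOn u Γ.dom := by
  obtain ⟨K, -, hK⟩ := hv.exists_bound hu
  exact integrableOn_of_bdd hu hK

namespace IsSol

variable {q M N : ℝ} {f W g : ℂ → ℂ}

lemma integrableOn_f (h : IsSol Γ q M N f W g) : IntegrableOn f Γ.dom :=
  h.vanish.integrableOn h.contDiff_f.continuousOn

lemma integrableOn_W (h : IsSol Γ q M N f W g) : IntegrableOn W Γ.dom :=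
  integrableOn_of_bdd h.contDiff_W.continuousOn h.norm_W

lemma M_pos (h : IsSol Γ q M N f W g) : 0 < M := one_pos.trans_le h.one_le

lemma q_pos (h : IsSol Γ q M N f W g) : 0 < q := two_pos.trans h.two_lt

lemma continuousOn_fderiv_W (h : IsSol Γ q M N f W g) :
    ContinuousOn (fun z => fderiv ℝ W z) Γ.dom :=
  h.contDiff_W.continuousOn_fderiv_of_isOpen Γ.isOpen_dom le_rfl

lemma memLp (h : IsSol Γ q M N f W g) :
    MemLp (fun z => fderiv ℝ W z) (ENNReal.ofReal q) (volume.restrict Γ.dom) :=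
  ⟨h.continuousOn_fderiv_W.aestronglyMeasurable Γ.measurableSet_dom,
    h.grad_W.trans_lt ENNReal.ofReal_lt_top⟩

/-- Hölder's inequality against the gradient of `W`. -/
lemma holder (h : IsSol Γ q M N f W g) {φ : ℂ → ℝ} (hm : Measurable φ) (h0 : ∀ y, 0 ≤ φ y)
    (hi : IntegrableOn (fun y => φ y ^ (q / (q - 1))) Γ.dom) :
    IntegrableOn (fun y => ‖fderiv ℝ W y‖ * φ y) Γ.dom ∧
    ∫ y in Γ.dom, ‖fderiv ℝ W y‖ * φ y
      ≤ N * (∫ y in Γ.dom, φ y ^ (q / (q - 1))) ^ (1 - 1 / q) := by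
  have hq := h.two_lt
  have hc : q.HolderConjugate (q / (q - 1)) := Real.HolderConjugate.conjExponent (by linarith)
  have h1 : (q / (q - 1))⁻¹ = 1 - 1 / q := by
    have : q - 1 ≠ 0 := by linarith
    have : q ≠ 0 := by linarith
    field_simp
  have hp0 : 0 < q / (q - 1) := div_pos (by linarith) (by linarith)
  have hφ : MemLp φ (ENNReal.ofReal (q / (q - 1))) (volume.restrict Γ.dom) := by
    rw [← integrable_norm_rpow_iff hm.aestronglyMeasurable
      (by simpa using hp0) ENNReal.ofReal_ne_top, ENNReal.toReal_ofReal hp0.le]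
    simp only [Real.norm_of_nonneg (h0 _)]
    exact hi
  have hW := h.memLp.norm
  have hN : (∫ y in Γ.dom, ‖fderiv ℝ W y‖ ^ q) ^ (1 / q) ≤ N := by
    have h2 := h.memLp.eLpNorm_eq_integral_rpow_norm (by simpa using h.q_pos) ENNReal.ofReal_ne_top
    rw [ENNReal.toReal_ofReal h.q_pos.le] at h2
    have h3 := h.grad_W
    rw [h2] at h3
    rw [one_div]
    exact (ENNReal.ofReal_le_ofReal_iff h.nonneg).1 h3
  constructor
  · have : ENNReal.HolderConjugate (ENNReal.ofReal q) (ENNReal.ofReal (q / (q - 1))) :=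
      hc.ennrealOfReal
    exact hW.integrable_mul hφ
  · have := integral_mul_le_Lp_mul_Lq_of_nonneg (μ := volume.restrict Γ.dom) hc
      (Filter.Eventually.of_forall fun y => norm_nonneg (fderiv ℝ W y))
      (Filter.Eventually.of_forall h0) hW hφ
    refine this.trans ?_
    rw [← one_div] at h1
    rw [h1]
    gcongr
    exact Real.rpow_nonneg (integral_nonneg fun y => by
      have := h0 y
      simp only [Pi.zero_apply]
      positivity) _

lemma weight_rpow {d : ℝ} (hd : 0 < d) (y : ℂ) :
    (((‖y - x‖ + d)⁻¹) ^ 2) ^ (q / (q - 1)) = (‖y - x‖ + d) ^ (-(2 * (q / (q - 1)))) := by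
  have : 0 < ‖y - x‖ + d := by positivity
  rw [← Real.rpow_neg_one, ← Real.rpow_natCast, ← Real.rpow_mul this.le, ← Real.rpow_mul this.le]
  congr 1
  push_cast; ring

/-- The constant in the weighted Hölder estimate. -/
noncomputable def holdC (q : ℝ) : ℝ :=
  (∫ y : ℂ, (1 + ‖y‖) ^ (-(2 * (q / (q - 1))))) ^ (1 - 1 / q)

lemma holdC_nonneg : 0 ≤ holdC q :=
  Real.rpow_nonneg (integral_nonneg fun y => by simp only [Pi.zero_apply]; positivity) _

lemma holder_weight (h : IsSol Γ q M N f W g) (x : ℂ) {d : ℝ} (hd : 0 < d) :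
    IntegrableOn (fun y => ‖fderiv ℝ W y‖ * ((‖y - x‖ + d)⁻¹) ^ 2) Γ.dom ∧
    ∫ y in Γ.dom, ‖fderiv ℝ W y‖ * ((‖y - x‖ + d)⁻¹) ^ 2 ≤ N * (holdC q * d ^ (-(2 / q))) := by
  have hq := h.two_lt
  have hp : 2 < 2 * (q / (q - 1)) := by
    have : 1 < q / (q - 1) := by rw [lt_div_iff₀ (by linarith)]; linarith
    linarith
  have hi : Integrable fun y : ℂ => (((‖y - x‖ + d)⁻¹) ^ 2) ^ (q / (q - 1)) := by
    simp_rw [weight_rpow (q := q) hd]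
    exact integrable_add_rpow hp x hd
  obtain ⟨h1, h2⟩ := h.holder (φ := fun y => ((‖y - x‖ + d)⁻¹) ^ 2) (by fun_prop)
    (fun y => by positivity) hi.integrableOn
  refine ⟨h1, h2.trans ?_⟩
  have hN := h.nonneg
  have he : 0 ≤ 1 - 1 / q := by
    have : 1 / q ≤ 1 := by rw [div_le_one (by linarith)]; linarith
    linarith
  have hI : 0 ≤ ∫ y : ℂ, (1 + ‖y‖) ^ (-(2 * (q / (q - 1)))) :=
    integral_nonneg fun y => by simp only [Pi.zero_apply]; positivity
  have h3 : ∫ y in Γ.dom, (((‖y - x‖ + d)⁻¹) ^ 2) ^ (q / (q - 1))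
      ≤ (∫ y : ℂ, (1 + ‖y‖) ^ (-(2 * (q / (q - 1))))) * d ^ (2 - 2 * (q / (q - 1))) := by
    rw [← integral_add_rpow x hd]
    refine (setIntegral_le_integral hi (Filter.Eventually.of_forall fun y => ?_)).trans
      (le_of_eq ?_)
    · simp only [Pi.zero_apply]; positivity
    · simp_rw [weight_rpow (q := q) hd]
  have h4 : d ^ (-(2 / q)) = (d ^ (2 - 2 * (q / (q - 1)))) ^ (1 - 1 / q) := by
    rw [← Real.rpow_mul hd.le]
    congr 1
    have : q - 1 ≠ 0 := by linarith
    have : q ≠ 0 := by linarith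
    field_simp
    ring
  rw [holdC, h4, ← Real.mul_rpow hI (by positivity)]
  gcongr

lemma integrableOn_fderiv_W (h : IsSol Γ q M N f W g) :
    IntegrableOn (fun z => fderiv ℝ W z) Γ.dom := by
  have : IsFiniteMeasure (volume.restrict Γ.dom) := ⟨by simpa using Γ.volume_dom_lt_top⟩
  exact h.memLp.integrable (by
    rw [← ENNReal.ofReal_one]; exact ENNReal.ofReal_le_ofReal (by linarith [h.two_lt]))

lemma int_dz_W (h : IsSol Γ q M N f W g) : IntegrableOn (dz W) Γ.dom :=
  h.integrableOn_fderiv_W.norm.mono' ((continuousOn_dz Γ.isOpen_dom h.contDiff_W).aestronglyMeasurable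
    Γ.measurableSet_dom) (Filter.Eventually.of_forall fun _ => norm_dz_le _ _)

end IsSol
end Geo

namespace Geo

variable {Γ : Geo} {x : ℂ}

namespace IsSol

variable {q M N : ℝ} {f W g : ℂ → ℂ}

lemma holo_sub (h : IsSol Γ q M N f W g) (c : ℂ) : DifferentiableOn ℂ (fun y => g y - c) Γ.dom :=
  h.holo.sub_const c

lemma vanish_δ_sub (h : IsSol Γ q M N f W g) (c : ℂ) :
    Γ.Vanish fun y => (Γ.δ y : ℂ) * (g y - c) := by
  refine (h.vanish_δ_mul.add (vanish_δ_mul_bdd (u := fun _ => -c) (B := ‖c‖)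
    fun y _ => by simp)).mono fun y _ => ?_
  rw [← mul_add, sub_eq_add_neg]

lemma integral_conj_sub_mul (h : IsSol Γ q M N f W g) (hx : x ∈ Γ.dom) (c : ℂ) :
    ∫ y, conj (g y - c) * conj (ker2 x (Γ.rad x) y) = -Real.pi * conj (deriv g x) := by
  have h1 := integral_holo_mul_ker2 Γ.isOpen_dom (h.holo_sub c) (Γ.rad_pos hx) (Γ.closedBall_rad hx)
  have h2 : deriv (fun y => g y - c) x = deriv g x := deriv_sub_const c
  rw [h2] at h1
  have h3 := congrArg conj h1
  rw [← integral_conj] at h3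
  simpa using h3

lemma dz_conj_sub (h : IsSol Γ q M N f W g) (c : ℂ) {y : ℂ} (hy : y ∈ Γ.dom) :
    HasWirt (fun y => conj (g y - c)) 0 (conj (deriv g y)) y := by
  have := hasWirt_conj_holo Γ.isOpen_dom (h.holo_sub c) hy
  rwa [show deriv (fun y => g y - c) y = deriv g y from deriv_sub_const c] at this

lemma contDiff_conj_sub (h : IsSol Γ q M N f W g) (c : ℂ) :
    ContDiffOn ℝ 1 (fun y => conj (g y - c)) Γ.dom :=
  contDiffOn_conj (contDiffOn_holo (h.holo_sub c))

/-- Bootstrap step using only the bound on `W`. -/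
lemma deriv_le_one (Γ : Geo) : ∃ C > 0, ∀ {q M N : ℝ} {f W g : ℂ → ℂ}, IsSol Γ q M N f W g →
    ∀ P : ℝ, 0 ≤ P → (∀ z ∈ Γ.dom, ‖deriv g z‖ ≤ P * Γ.δ z ^ (-2 : ℝ)) →
    (∀ z, Γ.t0 ≤ Γ.δ z → |(g z).im| ≤ P) → ∀ x ∈ Γ.dom, Γ.δ x < Γ.κ →
    ‖deriv g x‖ ≤ C * ((P + M) * (Γ.δ x)⁻¹ + ∫ y in Γ.dom, ‖f y‖) := by
  obtain ⟨C0, hC0, hn⟩ := normalise Γ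
  have hR := Γ.reflC_pos
  set I : ℝ := ∫ y : ℂ, (1 + ‖y‖) ^ (-(2 + 1) : ℝ) with hI
  have hI0 : 0 ≤ I := integral_nonneg fun y => by simp only [Pi.zero_apply]; positivity
  refine ⟨2 * Γ.reflC * (C0 * I + I + 1), by positivity, ?_⟩
  intro q M N f W g h P hP hd hm x hx hk
  obtain ⟨c, hc⟩ := hn g h.holo 1 P one_pos le_rfl hP (by
    rw [show (-1 - 1 : ℝ) = -2 by norm_num]; exact hd) hm x hx hk
  have hδ := Γ.δ_pos hx
  have H : ReflHyp Γ x (C0 * P) 1 f (fun y => g y - c) (fun y => conj (g y - c)) W :=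
    { mem := hx
      near := hk
      s_pos := one_pos
      s_le := le_rfl
      nonneg := by positivity
      holo := h.holo_sub c
      contDiff_Q := h.contDiff_conj_sub c
      contDiff_f := h.contDiff_one
      bound_G := by simpa using hc
      bound_Q := by simpa [← map_sub] using hc
      vanish_G := h.vanish_δ_sub c
      vanish_Q := (h.vanish_δ_sub c).mono fun y _ => by
        simp only [norm_mul, norm_real, RCLike.norm_conj]; exact le_rfl
      vanish_f := h.vanish
      eqn := fun y hy => by rw [h.eqn y hy, map_sub, conj_ofReal]; ring
      int_f := h.integrableOn_f
      int_S := h.integrableOn_W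
      int_Q := (integrableOn_zero (μ := volume) (s := Γ.dom)).congr_fun
        (fun y hy => (h.dz_conj_sub c hy).dz_eq.symm) Γ.measurableSet_dom }
  have h1 := H.estimate
  rw [h.integral_conj_sub_mul hx] at h1
  have e1 : ∫ y in Γ.dom, ‖dz (fun y => conj (g y - c)) y‖ * ((‖y - x‖ + Γ.δ x)⁻¹) ^ 2 = 0 := by
    rw [setIntegral_congr_fun Γ.measurableSet_dom (g := fun _ => (0 : ℝ))]
    · simp
    · intro y hy
      simp only
      rw [(h.dz_conj_sub c hy).dz_eq]; simp
  have i3 : Integrable fun y : ℂ => (‖y - x‖ + Γ.δ x) ^ (-(2 + 1) : ℝ) :=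
    integrable_add_rpow (by norm_num) x hδ
  have e2 : ∫ y in Γ.dom, ‖W y‖ * ((‖y - x‖ + Γ.δ x)⁻¹) ^ 3 ≤ M * (I * (Γ.δ x)⁻¹) := by
    have e3 := integral_add_rpow (a := 2 + 1) x hδ
    rw [show (2 : ℝ) - (2 + 1) = -1 by norm_num, Real.rpow_neg_one] at e3
    rw [← e3, ← integral_const_mul]
    refine le_trans ?_ (setIntegral_le_integral (s := Γ.dom) (i3.const_mul M)
      (Filter.Eventually.of_forall fun y => ?_))
    · refine integral_mono_of_nonneg (Filter.Eventually.of_forall fun y => ?_)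
        (i3.const_mul M).integrableOn ?_
      · simp only [Pi.zero_apply]; positivity
      · filter_upwards [ae_restrict_mem Γ.measurableSet_dom] with y hy
        have h4 : ((‖y - x‖ + Γ.δ x)⁻¹) ^ 3 = (‖y - x‖ + Γ.δ x) ^ (-(2 + 1) : ℝ) := by
          rw [inv_pow, Real.rpow_neg (by positivity)]
          norm_num
        rw [h4]
        have := h.norm_W y hy
        gcongr
    · have := h.M_pos
      simp only [Pi.zero_apply]; positivity
  rw [e1, add_zero, Real.rpow_neg_one] at h1
  have h5 : ‖-(Real.pi : ℂ) * conj (deriv g x)‖ = Real.pi * ‖deriv g x‖ := by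
    rw [norm_mul, norm_neg, norm_real, RCLike.norm_conj, Real.norm_of_nonneg Real.pi_pos.le]
  rw [h5] at h1
  have hΦ : 0 ≤ ∫ y in Γ.dom, ‖f y‖ := integral_nonneg fun y => norm_nonneg _
  have h6 : ‖deriv g x‖ ≤ Real.pi * ‖deriv g x‖ :=
    le_mul_of_one_le_left (norm_nonneg _) (by linarith [Real.pi_gt_three])
  refine (h6.trans h1).trans ?_
  rw [mul_assoc (2 * Γ.reflC)]
  gcongr
  set Φ := ∫ y in Γ.dom, ‖f y‖
  have hM := h.M_pos
  have hδ1 : 0 < (Γ.δ x)⁻¹ := by positivity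
  rw [← hI]
  have : 0 ≤ C0 * I * M * (Γ.δ x)⁻¹ + (I * P + P + M) * (Γ.δ x)⁻¹ + C0 * I * Φ + I * Φ := by
    positivity
  linarith

lemma norm_integral_W_le (h : IsSol Γ q M N f W g) (hx : x ∈ Γ.dom) :
    ‖∫ y, W y * conj (ker2 x (Γ.rad x) y)‖
      ≤ 25 * Γ.L ^ 2 * profK * (N * (holdC q * Γ.δ x ^ (-(2 / q)))) := by
  have hL := Γ.one_le_L
  have hr := Γ.rad_pos hx
  have hδ := Γ.δ_pos hx
  have hK := profK_pos
  have h1 := integral_mul_ker2 Γ.isOpen_dom (contDiffOn_conj h.contDiff_W) hr (Γ.closedBall_rad hx)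
  have h2 : ‖∫ y, W y * conj (ker2 x (Γ.rad x) y)‖
      = ‖∫ y, conj (W y) * ker2 x (Γ.rad x) y‖ := by
    rw [← RCLike.norm_conj, ← integral_conj]
    simp
  obtain ⟨i1, i2⟩ := h.holder_weight x hδ
  rw [h2, h1, ← integral_const_mul, ← setIntegral_eq_integral_of_forall_compl_eq_zero (s := Γ.dom)]
  swap
  · intro y hy
    rw [pot_eq_zero hr (by by_contra hn; exact hy (Γ.mem_of_le_rad hx (not_le.1 hn).le))]
    simp
  refine (norm_integral_le_of_norm_le (i1.const_mul (25 * Γ.L ^ 2 * profK)) ?_).trans ?_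
  · filter_upwards [ae_restrict_mem Γ.measurableSet_dom] with y hy
    rcases lt_or_ge ‖y - x‖ (Γ.rad x) with h4 | h4
    · have h5 : ‖dz (fun y => conj (W y)) y‖ ≤ ‖fderiv ℝ W y‖ := by
        rw [(hasWirt_C1 h.contDiff_W hy).conjugate.dz_eq, RCLike.norm_conj]
        exact norm_db_le _ _
      have h6 : (Γ.rad x ^ 2)⁻¹ ≤ 25 * Γ.L ^ 2 * ((‖y - x‖ + Γ.δ x)⁻¹) ^ 2 := by
        rw [inv_pow, ← div_eq_mul_inv, inv_eq_one_div, div_le_div_iff₀ (by positivity)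
          (by positivity)]
        have h7 : ‖y - x‖ + Γ.δ x ≤ 5 * Γ.L * Γ.rad x := by
          rw [Γ.δ_eq_rad x]; nlinarith
        calc 1 * (‖y - x‖ + Γ.δ x) ^ 2 ≤ 1 * (5 * Γ.L * Γ.rad x) ^ 2 := by gcongr
          _ = _ := by ring
      rw [norm_mul, norm_mul, norm_neg, norm_inv, norm_pow, norm_real, Real.norm_of_nonneg hr.le]
      calc _ ≤ 25 * Γ.L ^ 2 * ((‖y - x‖ + Γ.δ x)⁻¹) ^ 2 * (‖fderiv ℝ W y‖ * profK) := by
            gcongr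
            exact norm_pot_le
        _ = _ := by ring
    · rw [pot_eq_zero hr h4]
      simp only [mul_zero, norm_zero]
      positivity
  · rw [integral_const_mul]
    gcongr

/-- Bootstrap step using the bound on the gradient of `W`. -/
lemma deriv_le_two (Γ : Geo) {q : ℝ} (hq : 2 < q) : ∃ C > 0, ∀ {M N : ℝ} {f W g : ℂ → ℂ},
    IsSol Γ q M N f W g →
    ∀ P : ℝ, 0 ≤ P → (∀ z ∈ Γ.dom, ‖deriv g z‖ ≤ P * Γ.δ z ^ (-1 - 2 / q)) →
    (∀ z, Γ.t0 ≤ Γ.δ z → |(g z).im| ≤ P) → ∀ x ∈ Γ.dom, Γ.δ x < Γ.κ →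
    ‖deriv g x‖ ≤ C * ((P + M + N) * Γ.δ x ^ (-(2 / q)) + ∫ y in Γ.dom, ‖f y‖) := by
  obtain ⟨C0, hC0, hn⟩ := normalise Γ
  have hR := Γ.reflC_pos
  have hK := profK_pos
  have hL := Γ.L_pos
  have hs : 0 < 2 / q := by positivity
  have hs1 : 2 / q ≤ 1 := by rw [div_le_one (by linarith)]; exact hq.le
  set I : ℝ := ∫ y : ℂ, (1 + ‖y‖) ^ (-(2 + 2 / q) : ℝ) with hI
  have hI0 : 0 ≤ I := integral_nonneg fun y => by simp only [Pi.zero_apply]; positivity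
  have hH : 0 ≤ holdC q := holdC_nonneg
  refine ⟨2 * Γ.reflC * ((C0 / (2 / q) + 1) * I + 1 + holdC q)
    + 25 * Γ.L ^ 2 * profK * holdC q, by positivity, ?_⟩
  intro M N f W g h P hP hd hm x hx hk
  obtain ⟨c, hc⟩ := hn g h.holo (2 / q) P hs hs1 hP hd hm x hx hk
  have hδ := Γ.δ_pos hx
  have hM := h.M_pos
  have hN := h.nonneg
  set A := C0 / (2 / q) with hA
  have hA0 : 0 < A := by positivity
  have hW : ∀ y ∈ Γ.dom, ‖y - x‖ ≤ Γ.κ → ‖W y‖ ≤ M * Γ.δ y ^ (-(2 / q)) := fun y hy hyx =>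
    (h.norm_W y hy).trans (le_mul_of_one_le_right hM.le
      (Real.one_le_rpow_of_pos_of_le_one_of_nonpos (Γ.δ_pos hy) (δ_le_one hk hyx) (by linarith)))
  have hQ : ∀ y ∈ Γ.dom, HasWirt (fun y => conj (g y - c) + W y) (0 + dz W y)
      (conj (deriv g y) + db W y) y := fun y hy =>
    (h.dz_conj_sub c hy).add (hasWirt_C1 h.contDiff_W hy)
  have H : ReflHyp Γ x (A * P + M) (2 / q) f (fun y => g y - c) (fun y => conj (g y - c) + W y)
      (fun _ => 0) :=
    { mem := hx
      near := hk
      s_pos := hs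
      s_le := hs1
      nonneg := by positivity
      holo := h.holo_sub c
      contDiff_Q := (h.contDiff_conj_sub c).add h.contDiff_W
      contDiff_f := h.contDiff_one
      bound_G := fun y hy hyx => (hc y hy hyx).trans
        (mul_le_mul_of_nonneg_right (by linarith) (Real.rpow_nonneg (Γ.δ_pos hy).le _))
      bound_Q := fun y hy hyx => by
        refine (norm_add_le _ _).trans ?_
        rw [RCLike.norm_conj, add_mul]
        exact add_le_add (hc y hy hyx) (hW y hy hyx)
      vanish_G := h.vanish_δ_sub c
      vanish_Q := by
        refine (((h.vanish_δ_sub c).mono (v := fun y => (Γ.δ y : ℂ) * conj (g y - c))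
          fun y _ => ?_).add (vanish_δ_mul_bdd h.norm_W)).mono fun y _ => ?_
        · simp only [norm_mul, norm_real, RCLike.norm_conj]; exact le_rfl
        · rw [mul_add]
      vanish_f := h.vanish
      eqn := fun y hy => by rw [h.eqn y hy, map_sub, conj_ofReal]; ring
      int_f := h.integrableOn_f
      int_S := integrableOn_zero
      int_Q := h.int_dz_W.congr_fun
        (fun y hy => by rw [(hQ y hy).dz_eq, zero_add]) Γ.measurableSet_dom }
  have h1 := H.estimate
  obtain ⟨i1, i2⟩ := h.holder_weight x hδ
  have e1 : ∫ y in Γ.dom, ‖dz (fun y => conj (g y - c) + W y) y‖ * ((‖y - x‖ + Γ.δ x)⁻¹) ^ 2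
      ≤ N * (holdC q * Γ.δ x ^ (-(2 / q))) := by
    refine le_trans (integral_mono_of_nonneg (Filter.Eventually.of_forall fun y => ?_) i1 ?_) i2
    · simp only [Pi.zero_apply]; positivity
    · filter_upwards [ae_restrict_mem Γ.measurableSet_dom] with y hy
      rw [(hQ y hy).dz_eq, zero_add]
      gcongr
      exact norm_dz_le _ _
  simp only [norm_zero, zero_mul, integral_zero, add_zero] at h1
  have h_int : ∫ y, (conj (g y - c) + W y) * conj (ker2 x (Γ.rad x) y)
      = -Real.pi * conj (deriv g x) + ∫ y, W y * conj (ker2 x (Γ.rad x) y) := by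
    rw [← h.integral_conj_sub_mul hx c, ← integral_add]
    · simp only [add_mul]
    · have := (integrable_mul_ker2 Γ.isOpen_dom (h.holo_sub c).continuousOn (Γ.rad_pos hx)
        (Γ.closedBall_rad hx))
      simpa using (Complex.conjCLE.toContinuousLinearMap.integrable_comp this)
    · have := (integrable_mul_ker2 Γ.isOpen_dom (contDiffOn_conj h.contDiff_W).continuousOn
        (Γ.rad_pos hx) (Γ.closedBall_rad hx))
      simpa using (Complex.conjCLE.toContinuousLinearMap.integrable_comp this)
  have h2 := h.norm_integral_W_le hx
  rw [h_int] at h1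
  have h5 : ‖-(Real.pi : ℂ) * conj (deriv g x)‖ = Real.pi * ‖deriv g x‖ := by
    rw [norm_mul, norm_neg, norm_real, RCLike.norm_conj, Real.norm_of_nonneg Real.pi_pos.le]
  have hΦ : 0 ≤ ∫ y in Γ.dom, ‖f y‖ := integral_nonneg fun y => norm_nonneg _
  have h6 : ‖deriv g x‖ ≤ Real.pi * ‖deriv g x‖ :=
    le_mul_of_one_le_left (norm_nonneg _) (by linarith [Real.pi_gt_three])
  have h7 := norm_le_add_norm_add (-(Real.pi : ℂ) * conj (deriv g x))
    (∫ y, W y * conj (ker2 x (Γ.rad x) y))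
  rw [h5] at h7
  rw [← hI] at h1
  set Φ := ∫ y in Γ.dom, ‖f y‖
  set D := Γ.δ x ^ (-(2 / q)) with hD
  have hD0 : 0 < D := by positivity
  have h8 : 2 * Γ.reflC * ((A * P + M) * (I * D) + Φ + N * (holdC q * D))
      ≤ 2 * Γ.reflC * ((A + 1) * I + 1 + holdC q) * ((P + M + N) * D + Φ) := by
    rw [mul_assoc (2 * Γ.reflC)]
    refine mul_le_mul_of_nonneg_left ?_ (by positivity)
    have : 0 ≤ A * I * (M + N) * D + I * (P + N) * D + (P + M + N) * D + holdC q * (P + M) * D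
      + ((A + 1) * I + holdC q) * Φ := by positivity
    linarith
  have h9 : 25 * Γ.L ^ 2 * profK * (N * (holdC q * D))
      ≤ 25 * Γ.L ^ 2 * profK * holdC q * ((P + M + N) * D + Φ) := by
    rw [mul_assoc (25 * Γ.L ^ 2 * profK)]
    refine mul_le_mul_of_nonneg_left ?_ (by positivity)
    have : 0 ≤ holdC q * ((P + M) * D + Φ) := by positivity
    linarith
  have h10 : 2 * Γ.reflC * ((A * P + M) * (I * D) + Φ
      + ∫ y in Γ.dom, ‖dz (fun y => conj (g y - c) + W y) y‖ * ((‖y - x‖ + Γ.δ x)⁻¹) ^ 2)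
      ≤ 2 * Γ.reflC * ((A * P + M) * (I * D) + Φ + N * (holdC q * D)) := by gcongr
  rw [add_mul]
  linarith

end IsSol
end Geo

namespace Geo

variable {Γ : Geo} {x : ℂ}

lemma exists_δ_le (Γ : Geo) : ∃ B, 1 ≤ B ∧ ∀ z ∈ Γ.dom, Γ.δ z ≤ B := by
  obtain ⟨K, hK⟩ := (isCompact_closedBall (0 : ℂ) Γ.D).exists_bound_of_continuousOn
    Γ.continuous_δ.continuousOn
  exact ⟨max 1 K, le_max_left _ _, fun z hz => (le_abs_self _).trans
    ((hK z (Γ.dom_subset hz)).trans (le_max_right _ _))⟩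

lemma dom_subset_ball (hx : x ∈ Γ.dom) : Γ.dom ⊆ Metric.ball x (2 * Γ.D + 1) := fun y hy => by
  rw [mem_ball_iff_norm]
  have h1 := Γ.norm_le x hx
  have h2 := Γ.norm_le y hy
  have := norm_sub_le y x
  linarith

lemma integrableOn_dom_rpow (hx : x ∈ Γ.dom) {a : ℝ} (ha : a < 2) :
    IntegrableOn (fun y => ‖y - x‖ ^ (-a)) Γ.dom ∧
    ∫ y in Γ.dom, ‖y - x‖ ^ (-a) ≤ 2 * Real.pi / (2 - a) * (2 * |Γ.D| + 1) ^ (2 - a) := by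
  have h1 := integrableOn_ball_rpow ha x (2 * Γ.D + 1)
  refine ⟨h1.mono_set (dom_subset_ball hx), ?_⟩
  have hD : 0 ≤ Γ.D := (norm_nonneg x).trans (Γ.norm_le x hx)
  rw [abs_of_nonneg hD, ← integral_ball_rpow ha x (by positivity)]
  exact setIntegral_mono_set h1 (Filter.Eventually.of_forall fun y => by
    simp only [Pi.zero_apply]; positivity) (dom_subset_ball hx).eventuallyLE

/-- Negative powers of the boundary distance of order less than one are integrable. -/
lemma integrableOn_δ_rpow (Γ : Geo) {a : ℝ} (ha : 0 < a) (ha1 : a < 1) :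
    IntegrableOn (fun y => Γ.δ y ^ (-a)) Γ.dom := by
  have hL := Γ.L_pos
  have hm : Measurable fun y => Γ.δ y ^ (-a) := Γ.continuous_δ.measurable.pow_const _
  refine ⟨hm.aestronglyMeasurable, ?_⟩
  have h0 : ∀ᵐ y ∂(volume.restrict Γ.dom), 0 ≤ Γ.δ y ^ (-a) := by
    filter_upwards [ae_restrict_mem Γ.measurableSet_dom] with y hy
    exact Real.rpow_nonneg (Γ.δ_pos hy).le _
  rw [hasFiniteIntegral_iff_ofReal h0, lintegral_eq_lintegral_meas_lt _ h0 hm.aemeasurable]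
  have hI : Ioi (0 : ℝ) = Ioc 0 1 ∪ Ioi 1 := (Ioc_union_Ioi_eq_Ioi zero_le_one).symm
  rw [hI]
  refine (lintegral_union_le _ _ _).trans_lt (ENNReal.add_lt_top.2 ⟨?_, ?_⟩)
  · calc _ ≤ ∫⁻ _ in Ioc (0 : ℝ) 1, volume Γ.dom := by
          refine lintegral_mono fun t => (measure_mono (subset_univ _)).trans ?_
          simp
      _ < ⊤ := by simpa using Γ.volume_dom_lt_top
  · have h1 : IntegrableOn (fun t : ℝ => Γ.L * t ^ (-(1 / a))) (Ioi 1) :=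
      (integrableOn_Ioi_rpow_of_lt (by
        rw [neg_lt_neg_iff, lt_div_iff₀ ha]; linarith) one_pos).const_mul _
    refine lt_of_le_of_lt ?_ (h1.hasFiniteIntegral)
    refine setLIntegral_mono' measurableSet_Ioi fun t ht => ?_
    have ht0 : (0 : ℝ) < t := one_pos.trans ht
    rw [← ofReal_norm, Real.norm_of_nonneg (by positivity)]
    refine le_trans ?_ (Γ.strip (t ^ (-(1 / a))) (by positivity))
    rw [Measure.restrict_apply' Γ.measurableSet_dom]
    refine measure_mono fun y hy => ?_
    have hy2 := Γ.δ_pos hy.2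
    have hy1 : t < Γ.δ y ^ (-a) := hy.1
    have h3 : Γ.δ y < t ^ (-(1 / a)) := by
      have := Real.rpow_lt_rpow_of_neg ht0 hy1 (z := -(1 / a)) (by
        have : 0 < 1 / a := by positivity
        linarith)
      rwa [← Real.rpow_mul hy2.le, show -a * -(1 / a) = 1 by field_simp, Real.rpow_one] at this
    exact ⟨by rw [δ] at h3; linarith, hy.2⟩

lemma rpow_le_rpow_of_δ {B a b d : ℝ} (hd : 0 < d) (hB : d ≤ B) (h : b ≤ a) :
    d ^ (-b) ≤ B ^ (a - b) * d ^ (-a) := by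
  have h1 : d ^ (-b) = d ^ (a - b) * d ^ (-a) := by
    rw [← Real.rpow_add hd]; congr 1; ring
  rw [h1]
  exact mul_le_mul_of_nonneg_right (Real.rpow_le_rpow hd.le hB (by linarith))
    (Real.rpow_nonneg hd.le _)

/-- A bound near the boundary by a negative power of the distance extends to the domain. -/
lemma exists_bound_rpow {u : ℂ → ℂ} (hu : ContinuousOn u Γ.dom) {K a ε : ℝ} (hK : 0 ≤ K)
    (hε : 0 < ε) (h : ∀ z ∈ Γ.dom, Γ.δ z < ε → ‖u z‖ ≤ K * Γ.δ z ^ (-a)) :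
    ∃ K', 0 ≤ K' ∧ ∀ z ∈ Γ.dom, ‖u z‖ ≤ K' * Γ.δ z ^ (-a) := by
  have hv : ContinuousOn (fun z => ((Γ.δ z ^ a : ℝ) : ℂ) * u z) Γ.dom := by
    refine ContinuousOn.mul (continuous_ofReal.comp_continuousOn ?_) hu
    exact Γ.continuous_δ.continuousOn.rpow_const fun z hz => Or.inl (Γ.δ_pos hz).ne'
  obtain ⟨K1, h0, h1⟩ := exists_bound_depth hv hε
  refine ⟨K + K1, by positivity, fun z hz => ?_⟩
  have hδ := Γ.δ_pos hz
  rcases lt_or_ge (Γ.δ z) ε with h3 | h3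
  · refine (h z hz h3).trans ?_
    gcongr
    linarith
  · have h4 := h1 z h3
    rw [norm_mul, norm_real, Real.norm_of_nonneg (by positivity)] at h4
    rw [Real.rpow_neg hδ.le, ← div_eq_mul_inv, le_div_iff₀ (by positivity)]
    linarith

namespace IsSol

variable {q M N : ℝ} {f W g : ℂ → ℂ}

lemma continuousOn_deriv (h : IsSol Γ q M N f W g) : ContinuousOn (deriv g) Γ.dom :=
  (h.holo.deriv Γ.isOpen_dom).continuousOn

lemma norm_db_f_le (h : IsSol Γ q M N f W g) {y : ℂ} (hy : y ∈ Γ.dom) :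
    ‖db f y‖ ≤ M + 2 * ‖g y‖ := by
  rw [h.eqn y hy]
  have h1 := norm_sub_le (W y + conj (g y)) (g y)
  have h2 := norm_add_le (W y) (conj (g y))
  rw [RCLike.norm_conj] at h2
  linarith [h.norm_W y hy]

lemma norm_db_f_le_im (h : IsSol Γ q M N f W g) {y : ℂ} (hy : y ∈ Γ.dom) :
    ‖db f y‖ ≤ M + 2 * |(g y).im| := by
  have h0 : conj (g y) - g y = -(2 * (g y).im * I) := by
    apply Complex.ext <;> (simp; try ring)
  rw [h.eqn y hy, add_sub_assoc, h0]
  refine (norm_add_le _ _).trans (add_le_add (h.norm_W y hy) (le_of_eq ?_))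
  simp

/-- Qualitative boundary growth of the pressure variable. -/
lemma exists_norm_g_le (h : IsSol Γ q M N f W g) :
    ∃ K, 0 ≤ K ∧ ∀ z ∈ Γ.dom, ‖g z‖ ≤ K * Γ.δ z ^ (-(1 / 8) : ℝ) := by
  have hL := Γ.L_pos
  have hκ := Γ.κ_pos
  have hM := h.M_pos
  have hP := profK_pos
  obtain ⟨B, hB1, hB⟩ := exists_δ_le Γ
  obtain ⟨τ, hτ0, hτ⟩ := h.vanish.exists_bound h.contDiff_f.continuousOn
  obtain ⟨G, hG0, hG⟩ := exists_bound_depth h.holo.continuousOn Γ.t0_pos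
  obtain ⟨C, hC, hC1⟩ := deriv_le_one Γ
  set K1 := profK * (2 * τ * (16 * Γ.L ^ 2) + M * (4 * Γ.L * B)) + G with hK1
  have h1 : ∀ z ∈ Γ.dom, ‖deriv g z‖ ≤ K1 * Γ.δ z ^ (-2 : ℝ) := fun z hz => by
    have hδ := Γ.δ_pos hz
    refine (h.deriv_rad hz fun y hy => hτ y (Γ.mem_of_le_rad hz hy)).trans ?_
    rw [Real.rpow_neg hδ.le, Real.rpow_ofNat, ← div_eq_mul_inv, le_div_iff₀ (by positivity), rad]
    have h2 : profK * (2 * τ / (Γ.δ z / (4 * Γ.L)) ^ 2 + M / (Γ.δ z / (4 * Γ.L))) * Γ.δ z ^ 2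
        = profK * (2 * τ * (16 * Γ.L ^ 2) + M * (4 * Γ.L * Γ.δ z)) := by
      field_simp
      ring
    rw [h2, hK1]
    have := hB z hz
    have h3 : profK * (2 * τ * (16 * Γ.L ^ 2) + M * (4 * Γ.L * Γ.δ z))
        ≤ profK * (2 * τ * (16 * Γ.L ^ 2) + M * (4 * Γ.L * B)) := by gcongr
    linarith
  have hK10 : G ≤ K1 := by
    have : 0 ≤ profK * (2 * τ * (16 * Γ.L ^ 2) + M * (4 * Γ.L * B)) := by positivity
    linarith
  have h2 := hC1 h K1 (hG0.trans hK10) h1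
    (fun z hz => (abs_im_le_norm _).trans ((hG z hz).trans hK10))
  have hΦ : 0 ≤ ∫ y in Γ.dom, ‖f y‖ := integral_nonneg fun y => norm_nonneg _
  set Φ := ∫ y in Γ.dom, ‖f y‖
  have hK1' : 0 ≤ K1 := hG0.trans hK10
  have h3 : ∀ z ∈ Γ.dom, Γ.δ z < Γ.κ →
      ‖deriv g z‖ ≤ C * ((K1 + M) + Φ) * B ^ (1 / 8 : ℝ) * Γ.δ z ^ (-(9 / 8) : ℝ) := by
    intro z hz hk
    have hδ := Γ.δ_pos hz
    have hδ1 : Γ.δ z ≤ 1 := hk.le.trans Γ.κ_le_one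
    refine (h2 z hz hk).trans ?_
    have h4 : (Γ.δ z)⁻¹ ≤ B ^ (1 / 8 : ℝ) * Γ.δ z ^ (-(9 / 8) : ℝ) := by
      have := rpow_le_rpow_of_δ (a := 9 / 8) (b := 1) hδ (hB z hz) (by norm_num)
      rw [Real.rpow_neg_one] at this
      convert this using 3
      norm_num
    have h5 : 1 ≤ (Γ.δ z)⁻¹ := (one_le_inv₀ hδ).2 hδ1
    have h6 : (K1 + M) * (Γ.δ z)⁻¹ + Φ ≤ ((K1 + M) + Φ) * (Γ.δ z)⁻¹ := by nlinarith
    calc _ ≤ C * (((K1 + M) + Φ) * (Γ.δ z)⁻¹) := by gcongr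
      _ ≤ C * (((K1 + M) + Φ) * (B ^ (1 / 8 : ℝ) * Γ.δ z ^ (-(9 / 8) : ℝ))) := by gcongr
      _ = _ := by ring
  obtain ⟨K2, hK2, h4⟩ := exists_bound_rpow h.continuousOn_deriv (by positivity) hκ h3
  refine exists_bound_rpow h.holo.continuousOn (K := Γ.L * (K2 / (1 / 8)) + G) (by positivity) hκ
    fun z hz hk => ?_
  have hV := inv_self hz hk
  have hδ := Γ.δ_pos hz
  have h5 := path_bound_rpow h.holo (s := 1 / 8) (by norm_num) hK2
    (fun z hz => by convert h4 z hz using 3; norm_num) hz hV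
  have h6 := hG _ ((by linarith : Γ.t0 ≤ Γ.δ z + Γ.t0).trans (endpoint_depth hV))
  have h7 : ‖g z‖ ≤ ‖g (z - Γ.t0 * Γ.V z) - g z‖ + ‖g (z - Γ.t0 * Γ.V z)‖ := by
    have := norm_sub_le (g (z - Γ.t0 * Γ.V z)) (g (z - Γ.t0 * Γ.V z) - g z)
    rw [sub_sub_cancel] at this
    linarith
  have h8 : 1 ≤ Γ.δ z ^ (-(1 / 8) : ℝ) :=
    Real.one_le_rpow_of_pos_of_le_one_of_nonpos hδ (hk.le.trans Γ.κ_le_one) (by norm_num)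
  nlinarith

lemma exists_norm_db_f_le (h : IsSol Γ q M N f W g) :
    ∃ K, 0 ≤ K ∧ ∀ z ∈ Γ.dom, ‖db f z‖ ≤ K * Γ.δ z ^ (-(1 / 8) : ℝ) := by
  obtain ⟨K, hK, h1⟩ := h.exists_norm_g_le
  have hM := h.M_pos
  refine exists_bound_rpow (continuousOn_db Γ.isOpen_dom h.contDiff_one) (K := M + 2 * K)
    (by positivity) one_pos fun z hz hk => ?_
  have h2 := h.norm_db_f_le hz
  have h3 := h1 z hz
  have h4 : 1 ≤ Γ.δ z ^ (-(1 / 8) : ℝ) :=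
    Real.one_le_rpow_of_pos_of_le_one_of_nonpos (Γ.δ_pos hz) hk.le (by norm_num)
  nlinarith

lemma integrableOn_db_f (h : IsSol Γ q M N f W g) : IntegrableOn (db f) Γ.dom := by
  obtain ⟨K, hK, h1⟩ := h.exists_norm_db_f_le
  refine ((integrableOn_δ_rpow Γ (a := 1 / 8) (by norm_num) (by norm_num)).const_mul K).mono'
    ((continuousOn_db Γ.isOpen_dom h.contDiff_one).aestronglyMeasurable Γ.measurableSet_dom) ?_
  filter_upwards [ae_restrict_mem Γ.measurableSet_dom] with y hy using h1 y hy

lemma weight_le {r d : ℝ} (hr : 0 < r) (hd : 0 < d) :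
    d ^ 2 * ((r + d) ^ 2 * r)⁻¹ ≤ d ^ (1 / 4 : ℝ) * r ^ (-(5 / 4) : ℝ) := by
  have h1 : d ^ (7 / 4 : ℝ) * r ^ (1 / 4 : ℝ) ≤ (r + d) ^ 2 := by
    calc d ^ (7 / 4 : ℝ) * r ^ (1 / 4 : ℝ) ≤ (r + d) ^ (7 / 4 : ℝ) * (r + d) ^ (1 / 4 : ℝ) := by
          gcongr <;> linarith
      _ = (r + d) ^ 2 := by
          rw [← Real.rpow_add (by positivity)]
          norm_num
  rw [← div_eq_mul_inv, div_le_iff₀ (by positivity)]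
  have h2 : d ^ 2 = d ^ (1 / 4 : ℝ) * d ^ (7 / 4 : ℝ) := by
    rw [← Real.rpow_add hd]; norm_num
  have h3 : r ^ (-(5 / 4) : ℝ) * r ^ (1 / 4 : ℝ) * r = 1 := by
    rw [← Real.rpow_add hr, ← Real.rpow_add_one hr.ne']
    norm_num
  calc d ^ 2 = d ^ (1 / 4 : ℝ) * d ^ (7 / 4 : ℝ) := h2
    _ = d ^ (1 / 4 : ℝ) * (r ^ (-(5 / 4) : ℝ) * r) * (d ^ (7 / 4 : ℝ) * r ^ (1 / 4 : ℝ)) := by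
        linear_combination (d ^ (1 / 4 : ℝ) * d ^ (7 / 4 : ℝ)) * (-h3)
    _ ≤ d ^ (1 / 4 : ℝ) * (r ^ (-(5 / 4) : ℝ) * r) * (r + d) ^ 2 := by gcongr
    _ = _ := by ring

lemma young_le {r d : ℝ} (hr : 0 < r) (hd : 0 < d) :
    d ^ (-(1 / 8) : ℝ) * r ^ (-(5 / 4) : ℝ) ≤ d ^ (-(1 / 2) : ℝ) + r ^ (-(5 / 3) : ℝ) := by
  have h := Real.young_inequality_of_nonneg (a := d ^ (-(1 / 8) : ℝ)) (b := r ^ (-(5 / 4) : ℝ))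
    (by positivity) (by positivity) (p := 4) (q := 4 / 3)
    (by rw [Real.holderConjugate_iff]; norm_num)
  rw [← Real.rpow_mul hd.le, ← Real.rpow_mul hr.le] at h
  norm_num at h ⊢
  have h1 : 0 < d ^ (-(1 / 2) : ℝ) := by positivity
  have h2 : 0 < r ^ (-(5 / 3) : ℝ) := by positivity
  norm_num at h1 h2
  linarith

/-- Qualitative boundary decay of the velocity variable. -/
lemma exists_norm_f_le (h : IsSol Γ q M N f W g) :
    ∃ K, 0 ≤ K ∧ ∀ z ∈ Γ.dom, ‖f z‖ ≤ K * Γ.δ z ^ (-(-(1 / 4)) : ℝ) := by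
  have hL := Γ.L_pos
  obtain ⟨K, hK, h1⟩ := h.exists_norm_db_f_le
  have i1 := integrableOn_δ_rpow Γ (a := 1 / 2) (by norm_num) (by norm_num)
  set J1 := ∫ y in Γ.dom, Γ.δ y ^ (-(1 / 2) : ℝ) with hJ1
  have hJ0 : 0 ≤ J1 := setIntegral_nonneg Γ.measurableSet_dom fun y hy =>
    Real.rpow_nonneg (Γ.δ_pos hy).le _
  set J2 := 2 * Real.pi / (2 - 5 / 3) * (2 * |Γ.D| + 1) ^ (2 - 5 / 3 : ℝ) with hJ2
  have hJ20 : 0 ≤ J2 := by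
    have : (0 : ℝ) < 2 - 5 / 3 := by norm_num
    positivity
  refine exists_bound_rpow h.contDiff_f.continuousOn (K := K * (25 * Γ.L ^ 6) * (J1 + J2))
    (by positivity) Γ.κ_pos fun z hz hk => ?_
  have hδ := Γ.δ_pos hz
  obtain ⟨i2, h2⟩ := rep_near hz hk h.contDiff_one h.vanish h.integrableOn_db_f
  obtain ⟨i3, h3⟩ := integrableOn_dom_rpow hz (a := 5 / 3) (by norm_num)
  refine h2.trans ?_
  set A := K * (25 * Γ.L ^ 6) * Γ.δ z ^ (1 / 4 : ℝ) with hA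
  have hA0 : 0 ≤ A := by positivity
  calc _ ≤ ∫ y in Γ.dom, A * (Γ.δ y ^ (-(1 / 2) : ℝ) + ‖y - z‖ ^ (-(5 / 3) : ℝ)) := by
        refine integral_mono_of_nonneg (Filter.Eventually.of_forall fun y => ?_)
          ((i1.add i3).const_mul A) ?_
        · simp only [Pi.zero_apply]; positivity
        · filter_upwards [ae_restrict_mem Γ.measurableSet_dom] with y hy
          have hδy := Γ.δ_pos hy
          rcases (norm_nonneg (y - z)).eq_or_lt with hr | hr
          · rw [← hr]
            simp only [mul_zero, inv_zero]
            positivity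
          · calc _ ≤ K * Γ.δ y ^ (-(1 / 8) : ℝ) * (25 * Γ.L ^ 6 *
                  (Γ.δ z ^ (1 / 4 : ℝ) * ‖y - z‖ ^ (-(5 / 4) : ℝ))) := by
                  exact mul_le_mul (h1 y hy) (mul_le_mul_of_nonneg_left (weight_le hr hδ)
                    (by positivity)) (by positivity) (by positivity)
              _ = A * (Γ.δ y ^ (-(1 / 8) : ℝ) * ‖y - z‖ ^ (-(5 / 4) : ℝ)) := by rw [hA]; ring
              _ ≤ _ := by
                  gcongr
                  exact young_le hr hδy
    _ = A * (J1 + ∫ y in Γ.dom, ‖y - z‖ ^ (-(5 / 3) : ℝ)) := by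
        rw [integral_const_mul, integral_add i1 i3]
    _ ≤ A * (J1 + J2) := by gcongr
    _ = _ := by rw [hA, neg_neg]; ring

end IsSol
end Geo

namespace Geo

variable {Γ : Geo} {x : ℂ}

namespace IsSol

variable {q M N : ℝ} {f W g : ℂ → ℂ}

lemma integrableOn_im_sq (h : IsSol Γ q M N f W g) :
    IntegrableOn (fun y => (g y).im ^ 2) Γ.dom := by
  obtain ⟨K, hK, h1⟩ := h.exists_norm_g_le
  refine ((integrableOn_δ_rpow Γ (a := 1 / 4) (by norm_num) (by norm_num)).const_mul (K ^ 2)).mono'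
    (((continuous_im.comp_continuousOn h.holo.continuousOn).pow 2).aestronglyMeasurable
      Γ.measurableSet_dom) ?_
  filter_upwards [ae_restrict_mem Γ.measurableSet_dom] with y hy
  have hδ := Γ.δ_pos hy
  rw [Real.norm_of_nonneg (by positivity), ← sq_abs]
  calc |(g y).im| ^ 2 ≤ (K * Γ.δ y ^ (-(1 / 8) : ℝ)) ^ 2 := by
        gcongr; exact (abs_im_le_norm _).trans (h1 y hy)
    _ = _ := by
        rw [mul_pow, ← Real.rpow_natCast (Γ.δ y ^ _), ← Real.rpow_mul hδ.le]
        norm_num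

/-- The energy identity. -/
lemma integral_im_sq_le (h : IsSol Γ q M N f W g) :
    ∫ y in Γ.dom, (g y).im ^ 2 ≤ M ^ 2 * volume.real Γ.dom := by
  obtain ⟨K, hK, h1⟩ := h.exists_norm_g_le
  obtain ⟨K1, hK1, h2⟩ := h.exists_norm_db_f_le
  obtain ⟨K2, hK2, h3⟩ := h.exists_norm_f_le
  have hM := h.M_pos
  have hw : ∀ y ∈ Γ.dom, HasWirt (fun y => f y * g y) (dz f y * g y + f y * deriv g y)
      (db f y * g y + f y * 0) y := fun y hy =>
    (hasWirt_C1 h.contDiff_one hy).mul (hasWirt_holo h.holo hy)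
  have hc : ContDiffOn ℝ 1 (fun y => f y * g y) Γ.dom :=
    h.contDiff_one.mul (contDiffOn_holo h.holo)
  have hv : Γ.Vanish fun y => f y * g y := by
    intro τ hτ
    refine ⟨(τ / (K2 * K + 1)) ^ (8 : ℝ), by positivity, fun z hz hd => ?_⟩
    have hδ := Γ.δ_pos hz
    have h4 : Γ.δ z ^ (1 / 8 : ℝ) ≤ τ / (K2 * K + 1) := by
      have := Real.rpow_le_rpow hδ.le hd.le (z := 1 / 8) (by norm_num)
      rwa [← Real.rpow_mul (by positivity), show (8 : ℝ) * (1 / 8) = 1 by norm_num,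
        Real.rpow_one] at this
    rw [norm_mul]
    calc ‖f z‖ * ‖g z‖ ≤ (K2 * Γ.δ z ^ (-(-(1 / 4)) : ℝ)) * (K * Γ.δ z ^ (-(1 / 8) : ℝ)) := by
          gcongr
          · exact h3 z hz
          · exact h1 z hz
      _ = K2 * K * Γ.δ z ^ (1 / 8 : ℝ) := by
          rw [show (1 / 8 : ℝ) = -(-(1 / 4)) + -(1 / 8) by norm_num, Real.rpow_add hδ]
          norm_num
          ring
      _ ≤ (K2 * K + 1) * (τ / (K2 * K + 1)) := by gcongr; linarith
      _ = τ := by field_simp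
  have hi : IntegrableOn (fun y => db f y * g y) Γ.dom := by
    refine ((integrableOn_δ_rpow Γ (a := 1 / 4) (by norm_num)
      (by norm_num)).const_mul (K1 * K)).mono'
      (((continuousOn_db Γ.isOpen_dom h.contDiff_one).mul h.holo.continuousOn).aestronglyMeasurable
      Γ.measurableSet_dom) ?_
    filter_upwards [ae_restrict_mem Γ.measurableSet_dom] with y hy
    have hδ := Γ.δ_pos hy
    rw [norm_mul]
    calc ‖db f y‖ * ‖g y‖ ≤ (K1 * Γ.δ y ^ (-(1 / 8) : ℝ)) * (K * Γ.δ y ^ (-(1 / 8) : ℝ)) := by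
          gcongr
          · exact h2 y hy
          · exact h1 y hy
      _ = _ := by
          rw [show (-(1 / 4) : ℝ) = -(1 / 8) + -(1 / 8) by norm_num, Real.rpow_add hδ]
          ring
  have he : ∀ y ∈ Γ.dom, db (fun y => f y * g y) y + dz (fun _ => (0 : ℂ)) y = db f y * g y :=
    fun y hy => by rw [(hw y hy).db_eq, (hasWirt_const 0 y).dz_eq]; ring
  have h0 := Γ.divergence hc contDiffOn_const hv vanish_zero
    (hi.congr_fun (fun y hy => (he y hy).symm) Γ.measurableSet_dom)
  rw [setIntegral_congr_fun Γ.measurableSet_dom he] at h0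
  have h4 : ∫ y in Γ.dom, (db f y * g y).re = 0 := by
    have := integral_re hi
    simp only [RCLike.re_eq_complex_re] at this
    rw [this, h0, zero_re]
  have hq := h.integrableOn_im_sq
  have hre : IntegrableOn (fun y => (db f y * g y).re) Γ.dom := hi.re
  have hm : IntegrableOn (fun _ : ℂ => M ^ 2) Γ.dom :=
    integrableOn_const Γ.volume_dom_lt_top.ne
  have h5 : ∫ y in Γ.dom, (g y).im ^ 2
      ≤ ∫ y in Γ.dom, ((db f y * g y).re + M ^ 2) := by
    refine setIntegral_mono_on hq (hre.add hm) Γ.measurableSet_dom fun y hy => ?_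
    have h6 : |(W y).im| ≤ M := (abs_im_le_norm _).trans (h.norm_W y hy)
    have h7 : (W y).im ^ 2 ≤ M ^ 2 := sq_le_sq' (by linarith [abs_le.1 h6]) (by linarith [abs_le.1 h6])
    have h8 : (db f y * g y).re = 2 * (g y).im ^ 2 - (W y).im * (g y).im := by
      rw [h.eqn y hy]
      simp [h.re_W y hy]
      ring
    rw [h8]
    nlinarith [sq_nonneg ((g y).im - (W y).im / 2)]
  rw [integral_add hre hm, h4, zero_add, setIntegral_const, smul_eq_mul] at h5
  linarith

lemma integral_norm_db_f_le (h : IsSol Γ q M N f W g) :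
    ∫ y in Γ.dom, ‖db f y‖ ≤ 4 * volume.real Γ.dom * M := by
  have hM := h.M_pos
  have h1 := h.integral_im_sq_le
  have hq := h.integrableOn_im_sq
  have hm : IntegrableOn (fun _ : ℂ => 2 * M) Γ.dom :=
    integrableOn_const Γ.volume_dom_lt_top.ne
  have h2 : ∫ y in Γ.dom, ‖db f y‖ ≤ ∫ y in Γ.dom, (2 * M + M⁻¹ * (g y).im ^ 2) := by
    refine setIntegral_mono_on h.integrableOn_db_f.norm (hm.add (hq.const_mul _))
      Γ.measurableSet_dom fun y hy => (h.norm_db_f_le_im hy).trans ?_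
    have h3 : M⁻¹ * (g y).im ^ 2 - 2 * |(g y).im| + M = M⁻¹ * (|(g y).im| - M) ^ 2 := by
      rw [sub_sq, sq_abs]; field_simp
    have : 0 ≤ M⁻¹ * (|(g y).im| - M) ^ 2 := by positivity
    linarith
  rw [integral_add hm (hq.const_mul _), setIntegral_const, integral_const_mul, smul_eq_mul] at h2
  have h4 : M⁻¹ * ∫ y in Γ.dom, (g y).im ^ 2 ≤ M⁻¹ * (M ^ 2 * volume.real Γ.dom) := by gcongr
  have h5 : M⁻¹ * (M ^ 2 * volume.real Γ.dom) = M * volume.real Γ.dom := by field_simp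
  have : 0 ≤ volume.real Γ.dom * M := by positivity
  linarith

end IsSol
end Geo

namespace Geo

variable {Γ : Geo} {x : ℂ}

namespace IsSol

variable {q M N : ℝ} {f W g : ℂ → ℂ}

/-- The local mean of the vorticity is controlled by the energy. -/
lemma norm_integral_im_le (h : IsSol Γ q M N f W g) (hx : x ∈ Γ.dom) {k : ℂ → ℂ} {A : ℝ}
    (hk : ∀ y, Γ.rad x < ‖y - x‖ → k y = 0) (hA : ∀ y, ‖k y‖ ≤ A) :
    ‖∫ y, (g y - conj (g y)) * k y‖ ≤ A * ((volume.real Γ.dom + Real.pi) * M * Γ.rad x) := by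
  have hr := Γ.rad_pos hx
  have hM := h.M_pos
  have hA0 : 0 ≤ A := (norm_nonneg _).trans (hA x)
  have hb := Γ.closedBall_rad hx
  have hq := h.integrableOn_im_sq
  have hm : IntegrableOn (fun _ : ℂ => M / Γ.rad x) (Metric.closedBall x (Γ.rad x)) :=
    integrableOn_const measure_closedBall_lt_top.ne
  have hq2 := (hq.mono_set hb).const_mul (Γ.rad x / M)
  rw [← setIntegral_eq_integral_of_forall_compl_eq_zero (s := Metric.closedBall x (Γ.rad x))]
  swap
  · intro y hy
    rw [hk y (by rw [mem_closedBall_iff_norm] at hy; exact not_le.1 hy), mul_zero]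
  refine (norm_integral_le_of_norm_le ((hq2.add hm).const_mul A)
    (Filter.Eventually.of_forall fun y => ?_)).trans ?_
  · have h0 : g y - conj (g y) = 2 * (g y).im * I := by
      apply Complex.ext <;> (simp; try ring)
    rw [h0, norm_mul, mul_comm]
    have h1 : ‖2 * ((g y).im : ℂ) * I‖ = 2 * |(g y).im| := by simp
    rw [h1]
    have h2 : Γ.rad x / M * (g y).im ^ 2 + M / Γ.rad x - 2 * |(g y).im|
        = Γ.rad x / M * (|(g y).im| - M / Γ.rad x) ^ 2 := by
      rw [sub_sq, sq_abs]; field_simp; ring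
    have h3 : 0 ≤ Γ.rad x / M * (|(g y).im| - M / Γ.rad x) ^ 2 := by positivity
    exact mul_le_mul (hA y) (by simp only [Pi.add_apply]; linarith) (by positivity) hA0
  · rw [integral_const_mul]
    simp only [Pi.add_apply]
    rw [integral_add hq2 hm, setIntegral_const, integral_const_mul, smul_eq_mul]
    have h1 : ∫ y in Metric.closedBall x (Γ.rad x), (g y).im ^ 2 ≤ M ^ 2 * volume.real Γ.dom :=
      (setIntegral_mono_set hq (Filter.Eventually.of_forall fun y => sq_nonneg _)
        hb.eventuallyLE).trans h.integral_im_sq_le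
    have h2 : volume.real (Metric.closedBall x (Γ.rad x)) = Real.pi * Γ.rad x ^ 2 := by
      rw [measureReal_def, Complex.volume_closedBall]
      simp [hr.le, mul_comm]
    rw [h2]
    have h3 : Γ.rad x / M * ∫ y in Metric.closedBall x (Γ.rad x), (g y).im ^ 2
        ≤ Γ.rad x / M * (M ^ 2 * volume.real Γ.dom) := by gcongr
    have h4 : Γ.rad x / M * (M ^ 2 * volume.real Γ.dom) + Real.pi * Γ.rad x ^ 2 * (M / Γ.rad x)
        = (volume.real Γ.dom + Real.pi) * M * Γ.rad x := by field_simp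
    gcongr
    linarith

lemma deriv_le_of_energy (h : IsSol Γ q M N f W g) (hx : x ∈ Γ.dom) :
    ‖deriv g x‖ ≤ profK * (volume.real Γ.dom + Real.pi) * (16 * Γ.L ^ 2) * M * (Γ.δ x ^ 2)⁻¹ := by
  have hr := Γ.rad_pos hx
  have hL := Γ.L_pos
  have h1 := h.norm_integral_im_le hx (k := ker2 x (Γ.rad x))
    (fun y hy => ker2_eq_zero hr hy) (fun y => norm_ker2_le hr)
  rw [integral_sub_conj_mul_ker2 Γ.isOpen_dom h.holo hr (Γ.closedBall_rad hx), norm_mul, norm_neg,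
    norm_real, Real.norm_of_nonneg Real.pi_pos.le] at h1
  have h6 : ‖deriv g x‖ ≤ Real.pi * ‖deriv g x‖ :=
    le_mul_of_one_le_left (norm_nonneg _) (by linarith [Real.pi_gt_three])
  refine (h6.trans h1).trans (le_of_eq ?_)
  rw [Γ.δ_eq_rad x]
  field_simp
  ring

lemma im_le_of_energy (h : IsSol Γ q M N f W g) (hx : x ∈ Γ.dom) :
    |(g x).im| ≤ profK * (volume.real Γ.dom + Real.pi) * (4 * Γ.L) * M * (Γ.δ x)⁻¹ := by
  have hr := Γ.rad_pos hx
  have hL := Γ.L_pos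
  have hb := Γ.closedBall_rad hx
  set k : ℂ → ℂ := fun y => (y - x) * ker2 x (Γ.rad x) y with hk
  have hkc : ∀ y, conj (k y) = k y := fun y => by
    simp only [hk, ker2, map_mul, map_div₀, map_sub, conj_conj, conj_ofReal, map_pow]
    ring
  have hk0 : ∀ y, Γ.rad x < ‖y - x‖ → k y = 0 := fun y hy => by
    simp only [hk, ker2_eq_zero hr hy, mul_zero]
  have hk1 : ∀ y, ‖k y‖ ≤ profK / Γ.rad x ^ 2 := fun y => by
    rcases lt_or_ge (Γ.rad x) ‖y - x‖ with hy | hy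
    · rw [hk0 y hy, norm_zero]; have := profK_pos; positivity
    · calc ‖k y‖ ≤ Γ.rad x * (profK / Γ.rad x ^ 3) := by
            rw [hk, norm_mul]; gcongr; exact norm_ker2_le hr
        _ = _ := by field_simp
  have h1 := h.norm_integral_im_le hx hk0 hk1
  have e1 : ∫ y, g y * k y = -Real.pi * g x := integral_mul_ker1 Γ.isOpen_dom h.holo hr hb
  have e2 : ∫ y, conj (g y) * k y = -Real.pi * conj (g x) := by
    have := congrArg conj e1
    rw [← integral_conj] at this
    simpa [hkc] using this
  have i1 : Integrable fun y => g y * k y := by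
    have := integrable_mul_ker2 (u := fun y => g y * (y - x)) Γ.isOpen_dom
      (h.holo.continuousOn.mul (by fun_prop)) hr hb
    simpa [hk, mul_assoc] using this
  have i2 : Integrable fun y => conj (g y) * k y := by
    have := Complex.conjCLE.toContinuousLinearMap.integrable_comp i1
    simpa [hkc] using this
  simp only [sub_mul] at h1
  rw [integral_sub i1 i2, e1, e2] at h1
  have h2 : -(Real.pi : ℂ) * g x - -(Real.pi : ℂ) * conj (g x) = -(2 * Real.pi * (g x).im) * I := by
    apply Complex.ext <;> (simp; try ring)
  have h3 : ‖-(2 * (Real.pi : ℂ) * (g x).im) * I‖ = 2 * Real.pi * |(g x).im| := by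
    simp [abs_of_pos Real.pi_pos]
  rw [h2, h3] at h1
  have h4 : |(g x).im| ≤ 2 * Real.pi * |(g x).im| :=
    le_mul_of_one_le_left (abs_nonneg _) (by linarith [Real.pi_gt_three])
  refine (h4.trans h1).trans (le_of_eq ?_)
  rw [Γ.δ_eq_rad x]
  field_simp

/-- Integral control of the velocity variable. -/
lemma integral_norm_f_le (h : IsSol Γ q M N f W g) :
    ∫ y in Γ.dom, ‖f y‖ ≤ 2 * Real.pi * (2 * |Γ.D| + 1) * (4 * volume.real Γ.dom * M) := by
  have hM := h.M_pos
  have hi := h.integrableOn_db_f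
  set T : ℝ := 2 * Real.pi * (2 * |Γ.D| + 1) with hT
  have hT0 : 0 ≤ T := by positivity
  have hmeas : AEMeasurable (Function.uncurry fun x y : ℂ => ENNReal.ofReal (‖db f y‖ * ‖y - x‖⁻¹))
      ((volume.restrict Γ.dom).prod (volume.restrict Γ.dom)) := by
    refine AEMeasurable.ennreal_ofReal (AEMeasurable.mul ?_ ?_)
    · exact hi.aestronglyMeasurable.norm.aemeasurable.comp_snd
    · exact Measurable.aemeasurable (by fun_prop)
  have h1 : ∫⁻ x in Γ.dom, ENNReal.ofReal ‖f x‖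
      ≤ ∫⁻ y in Γ.dom, ENNReal.ofReal (T * ‖db f y‖) := by
    calc _ ≤ ∫⁻ x in Γ.dom, ∫⁻ y in Γ.dom, ENNReal.ofReal (‖db f y‖ * ‖y - x‖⁻¹) := by
          refine setLIntegral_mono' Γ.measurableSet_dom fun x hx => ?_
          rw [← ofReal_integral_eq_lintegral_ofReal
            (integrableOn_far hx h.contDiff_one h.vanish hi)
            (Filter.Eventually.of_forall fun y => by simp only [Pi.zero_apply]; positivity)]
          exact ENNReal.ofReal_le_ofReal (rep_far hx h.contDiff_one h.vanish hi)
      _ = ∫⁻ y in Γ.dom, ∫⁻ x in Γ.dom, ENNReal.ofReal (‖db f y‖ * ‖y - x‖⁻¹) :=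
          lintegral_lintegral_swap hmeas
      _ ≤ _ := by
          refine setLIntegral_mono' Γ.measurableSet_dom fun y hy => ?_
          obtain ⟨i1, h2⟩ := integrableOn_dom_rpow hy (a := 1) (by norm_num)
          have h3 : ∀ x : ℂ, ‖db f y‖ * ‖y - x‖⁻¹ = ‖db f y‖ * ‖x - y‖ ^ (-1 : ℝ) := fun x => by
            rw [Real.rpow_neg_one, norm_sub_rev]
          simp only [h3]
          rw [← ofReal_integral_eq_lintegral_ofReal (i1.const_mul _)
            (Filter.Eventually.of_forall fun y => by simp only [Pi.zero_apply]; positivity),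
            integral_const_mul]
          refine ENNReal.ofReal_le_ofReal ?_
          rw [mul_comm T]
          gcongr
          refine h2.trans (le_of_eq ?_)
          rw [hT, show (2 : ℝ) - 1 = 1 by norm_num, Real.rpow_one, div_one]
  rw [← ofReal_integral_eq_lintegral_ofReal h.integrableOn_f.norm
    (Filter.Eventually.of_forall fun y => norm_nonneg _),
    ← ofReal_integral_eq_lintegral_ofReal (hi.norm.const_mul _)
    (Filter.Eventually.of_forall fun y => by simp only [Pi.zero_apply]; positivity),
    ENNReal.ofReal_le_ofReal_iff (integral_nonneg fun y => by
      simp only [Pi.zero_apply]; positivity), integral_const_mul] at h1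
  exact h1.trans (by gcongr; exact h.integral_norm_db_f_le)

/-- The quantitative pressure gradient bounds. -/
lemma deriv_bounds (Γ : Geo) {q : ℝ} (hq : 2 < q) : ∃ C > 0, ∀ {M N : ℝ} {f W g : ℂ → ℂ},
    IsSol Γ q M N f W g → (∀ z ∈ Γ.dom, ‖deriv g z‖ ≤ C * M * (Γ.δ z)⁻¹) ∧
    (∀ z ∈ Γ.dom, ‖deriv g z‖ ≤ C * (M + N) * Γ.δ z ^ (-(2 / q))) ∧
    (∀ z, Γ.t0 ≤ Γ.δ z → |(g z).im| ≤ C * M) := by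
  have hL := Γ.L_pos
  have hκ := Γ.κ_pos
  have ht := Γ.t0_pos
  have hP := profK_pos
  have hβ : 0 < 2 / q := by positivity
  have hβ1 : 2 / q < 1 := by rw [div_lt_one (by linarith)]; exact hq
  obtain ⟨B, hB1, hB⟩ := exists_δ_le Γ
  have hB0 : 0 < B := by linarith
  obtain ⟨C1, hC1, h1⟩ := deriv_le_one Γ
  obtain ⟨C2, hC2, h2⟩ := deriv_le_two Γ hq
  set A1 := profK * (volume.real Γ.dom + Real.pi) * (16 * Γ.L ^ 2) with hA1
  set A2 := profK * (volume.real Γ.dom + Real.pi) * (4 * Γ.L) * (Γ.t0)⁻¹ with hA2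
  set A3 := 2 * Real.pi * (2 * |Γ.D| + 1) * (4 * volume.real Γ.dom) with hA3
  have hpi := Real.pi_pos
  have hvol : 0 ≤ volume.real Γ.dom := measureReal_nonneg
  have hA10 : 0 < A1 := by positivity
  have hA20 : 0 < A2 := by positivity
  have hA30 : 0 ≤ A3 := by positivity
  set C3 := C1 * (A1 + A2 + 1 + A3) + A1 * (Γ.κ)⁻¹ with hC3
  have hC30 : 0 < C3 := by positivity
  set P3 := C3 * B ^ (2 / q) + A2 with hP3
  have hP30 : 0 < P3 := by positivity
  set C4 := C2 * (P3 + 1 + A3) + C3 * Γ.κ ^ (2 / q - 1) with hC4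
  have hC40 : 0 < C4 := by positivity
  refine ⟨A2 + C3 + C4, by positivity, ?_⟩
  intro M N f W g h
  have hM := h.M_pos
  have hN := h.nonneg
  have e1 : ∀ z ∈ Γ.dom, ‖deriv g z‖ ≤ A1 * M * (Γ.δ z ^ 2)⁻¹ := fun z hz =>
    h.deriv_le_of_energy hz
  have e2 : ∀ z, Γ.t0 ≤ Γ.δ z → |(g z).im| ≤ A2 * M := fun z hz => by
    have hz1 : z ∈ Γ.dom := Γ.mem_dom.2 (ht.trans_le hz)
    refine (h.im_le_of_energy hz1).trans ?_
    have : (Γ.δ z)⁻¹ ≤ (Γ.t0)⁻¹ := by gcongr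
    calc _ ≤ profK * (volume.real Γ.dom + Real.pi) * (4 * Γ.L) * M * (Γ.t0)⁻¹ := by gcongr
      _ = _ := by rw [hA2]; ring
  have e3 : ∫ y in Γ.dom, ‖f y‖ ≤ A3 * M := h.integral_norm_f_le.trans (le_of_eq (by rw [hA3]; ring))
  have hle : ∀ {d : ℝ}, 0 < d → d < Γ.κ → 1 ≤ d⁻¹ := fun hd hk =>
    (one_le_inv₀ hd).2 (hk.le.trans Γ.κ_le_one)
  have e4 : ∀ z ∈ Γ.dom, ‖deriv g z‖ ≤ C3 * M * (Γ.δ z)⁻¹ := fun z hz => by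
    have hδ := Γ.δ_pos hz
    rcases lt_or_ge (Γ.δ z) Γ.κ with hk | hk
    · have := h1 h ((A1 + A2) * M) (by positivity) (fun z hz => (e1 z hz).trans (by
        have hδ := Γ.δ_pos hz
        rw [Real.rpow_neg hδ.le, Real.rpow_ofNat]
        gcongr; linarith)) (fun z hz => (e2 z hz).trans (by gcongr; linarith)) z hz hk
      refine this.trans ?_
      have h6 := hle hδ hk
      have h5 : ∫ y in Γ.dom, ‖f y‖ ≤ A3 * M * (Γ.δ z)⁻¹ :=
        e3.trans (le_mul_of_one_le_right (by positivity) h6)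
      have h7 : 0 ≤ A1 * (Γ.κ)⁻¹ * M * (Γ.δ z)⁻¹ := by positivity
      calc _ ≤ C1 * (((A1 + A2) * M + M) * (Γ.δ z)⁻¹ + A3 * M * (Γ.δ z)⁻¹) := by gcongr
        _ ≤ _ := by rw [hC3]; linarith
    · refine (e1 z hz).trans ?_
      have h5 : (Γ.δ z ^ 2)⁻¹ ≤ (Γ.κ)⁻¹ * (Γ.δ z)⁻¹ := by
        rw [sq, mul_inv]; gcongr
      have h6 : 0 ≤ C1 * (A1 + A2 + 1 + A3) * M * (Γ.δ z)⁻¹ := by positivity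
      calc _ ≤ A1 * M * ((Γ.κ)⁻¹ * (Γ.δ z)⁻¹) := by gcongr
        _ ≤ _ := by rw [hC3]; linarith
  refine ⟨fun z hz => (e4 z hz).trans ?_, fun z hz => ?_, fun z hz => (e2 z hz).trans ?_⟩
  · have := Γ.δ_pos hz
    gcongr; linarith
  · have hδ := Γ.δ_pos hz
    have h8 : ‖deriv g z‖ ≤ C4 * (M + N) * Γ.δ z ^ (-(2 / q)) := by
      rcases lt_or_ge (Γ.δ z) Γ.κ with hk | hk
      · have := h2 h (P3 * M) (by positivity) (fun z hz => (e4 z hz).trans (by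
          have hδ := Γ.δ_pos hz
          have h9 := rpow_le_rpow_of_δ (a := 1 + 2 / q) (b := 1) hδ (hB z hz) (by linarith)
          rw [Real.rpow_neg_one, add_sub_cancel_left, neg_add, ← sub_eq_add_neg] at h9
          calc C3 * M * (Γ.δ z)⁻¹ ≤ C3 * M * (B ^ (2 / q) * Γ.δ z ^ (-1 - 2 / q)) := by gcongr
            _ ≤ P3 * M * Γ.δ z ^ (-1 - 2 / q) := by
              have : 0 ≤ A2 * M * Γ.δ z ^ (-1 - 2 / q) := by positivity
              rw [hP3]; linarith))
          (fun z hz => (e2 z hz).trans (by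
            gcongr
            have : 0 ≤ C3 * B ^ (2 / q) := by positivity
            linarith)) z hz hk
        refine this.trans ?_
        have h6 : 1 ≤ Γ.δ z ^ (-(2 / q)) :=
          Real.one_le_rpow_of_pos_of_le_one_of_nonpos hδ (hk.le.trans Γ.κ_le_one) (by linarith)
        have h5 : ∫ y in Γ.dom, ‖f y‖ ≤ A3 * M * Γ.δ z ^ (-(2 / q)) :=
          e3.trans (le_mul_of_one_le_right (by positivity) h6)
        calc _ ≤ C2 * ((P3 * M + M + N) * Γ.δ z ^ (-(2 / q)) + A3 * M * Γ.δ z ^ (-(2 / q))) := by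
              gcongr
          _ ≤ _ := by
              have h7 : 0 ≤ C3 * Γ.κ ^ (2 / q - 1) * (M + N) * Γ.δ z ^ (-(2 / q)) := by positivity
              have h9 : 0 ≤ C2 * (P3 + A3) * N * Γ.δ z ^ (-(2 / q)) := by positivity
              rw [hC4]; linarith
      · refine (e4 z hz).trans ?_
        have h5 : (Γ.δ z)⁻¹ ≤ Γ.κ ^ (2 / q - 1) * Γ.δ z ^ (-(2 / q)) := by
          have h9 : Γ.δ z ^ (2 / q - 1) ≤ Γ.κ ^ (2 / q - 1) :=
            Real.rpow_le_rpow_of_nonpos hκ hk (by linarith)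
          calc (Γ.δ z)⁻¹ = Γ.δ z ^ (2 / q - 1) * Γ.δ z ^ (-(2 / q)) := by
                rw [← Real.rpow_add hδ, ← Real.rpow_neg_one]; congr 1; ring
            _ ≤ _ := by gcongr
        calc _ ≤ C3 * M * (Γ.κ ^ (2 / q - 1) * Γ.δ z ^ (-(2 / q))) := by gcongr
          _ ≤ _ := by
              have h7 : 0 ≤ C3 * Γ.κ ^ (2 / q - 1) * N * Γ.δ z ^ (-(2 / q)) := by positivity
              have h9 : 0 ≤ C2 * (P3 + 1 + A3) * (M + N) * Γ.δ z ^ (-(2 / q)) := by positivity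
              rw [hC4]; linarith
    refine h8.trans ?_
    gcongr; linarith
  · gcongr; linarith

end IsSol
end Geo

namespace Geo
variable {Γ : Geo} {x : ℂ}

lemma one_le_log {N : ℝ} (hN : 0 ≤ N) : 1 ≤ Real.log (Real.exp 1 + N) := by
  rw [Real.le_log_iff_exp_le (by positivity)]; linarith

namespace IsSol
variable {q M N : ℝ} {f W g : ℂ → ℂ}

/-- The two pressure gradient bounds combine to a logarithmic bound of the vorticity. -/
lemma norm_db_f_le_log (Γ : Geo) {q : ℝ} (hq : 2 < q) : ∃ C > 0, ∀ {M N : ℝ} {f W g : ℂ → ℂ},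
    IsSol Γ q M N f W g → (∀ z ∈ Γ.dom, ‖deriv g z‖ ≤ C * M * (Γ.δ z)⁻¹) ∧
    ∀ z ∈ Γ.dom, ‖db f z‖ ≤ C * (M * Real.log (Real.exp 1 + N)) := by
  have hL := Γ.L_pos
  have ht := Γ.t0_pos
  have ht1 := Γ.t0_le
  have hP := profK_pos
  have hpi := Real.pi_pos
  have hvol : 0 ≤ volume.real Γ.dom := measureReal_nonneg
  have hβ : 0 < 2 / q := by positivity
  have hβ1 : 2 / q < 1 := by rw [div_lt_one (by linarith)]; exact hq
  obtain ⟨C, hC, hd⟩ := deriv_bounds Γ hq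
  set γ := (1 - 2 / q) / 2 with hγ
  have hγ0 : 0 < γ := by linarith
  have hγ1 : γ ≤ 1 := by linarith
  set E := profK * (volume.real Γ.dom + Real.pi) * (4 * Γ.L) * (Γ.κ)⁻¹ with hE
  have hκ := Γ.κ_pos
  have hE0 : 0 < E := by positivity
  set A := C + Γ.L * (2 * C * (2 + 1 / γ) + C / γ * 2) with hA
  have hA0 : 0 < A := by positivity
  refine ⟨C + 1 + 2 * (A + E), by positivity, fun {M N f W g} h => ?_⟩
  have hM := h.M_pos
  have hN := h.nonneg
  have hY := one_le_log hN
  set T := Real.exp 1 + N with hT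
  set Y := Real.log T
  have hT0 : 0 < T := by positivity
  have hT1 : 1 + N ≤ T := by
    have := Real.add_one_le_exp (1 : ℝ)
    linarith
  obtain ⟨d1, d2, d3⟩ := hd h
  refine ⟨fun z hz => (d1 z hz).trans ?_, fun z hz => ?_⟩
  · have := Γ.δ_pos hz
    gcongr; linarith
  have him : |(g z).im| ≤ (A + E) * (M * Y) := by
    rcases lt_or_ge (Γ.δ z) Γ.κ with hk | hk
    · have hδ := Γ.δ_pos hz
      have hV := Γ.inv_self hz hk
      set l := T ^ (-(1 / γ)) with hl
      have hl0 : 0 < l := Real.rpow_pos_of_pos hT0 _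
      have hl1 : l ≤ 1 := Real.rpow_le_one_of_one_le_of_nonpos (by linarith) (by
        have : 0 < 1 / γ := by positivity
        linarith)
      have hlγ : l ^ γ = T⁻¹ := by
        rw [hl, ← Real.rpow_mul hT0.le, ← Real.rpow_neg_one]; congr 1; field_simp
      have hlog : Real.log l = -(1 / γ) * Y := Real.log_rpow hT0 _
      have key : ∀ w ∈ Γ.dom, ‖deriv g w‖ ≤
          2 * C * M * (Γ.δ w + l)⁻¹ + C * M * Γ.δ w ^ (γ - 1) := fun w hw => by
        have hδw := Γ.δ_pos hw
        have p1 : 0 ≤ 2 * C * M * (Γ.δ w + l)⁻¹ := by positivity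
        have p2 : 0 ≤ C * M * Γ.δ w ^ (γ - 1) := by positivity
        rcases le_or_gt l (Γ.δ w) with hc | hc
        · refine (d1 w hw).trans ?_
          have : (Γ.δ w)⁻¹ ≤ 2 * (Γ.δ w + l)⁻¹ := by
            rw [← div_eq_mul_inv, inv_eq_one_div, div_le_div_iff₀ hδw (by positivity)]
            linarith
          calc _ ≤ C * M * (2 * (Γ.δ w + l)⁻¹) := by gcongr
            _ ≤ _ := by linarith
        · refine (d2 w hw).trans ?_
          have e1 : Γ.δ w ^ (-(2 / q)) = Γ.δ w ^ γ * Γ.δ w ^ (γ - 1) := by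
            rw [← Real.rpow_add hδw]; congr 1; rw [hγ]; ring
          have e2 : Γ.δ w ^ γ ≤ T⁻¹ := hlγ ▸ Real.rpow_le_rpow hδw.le hc.le hγ0.le
          have e3 : (M + N) * T⁻¹ ≤ M := by
            rw [← div_eq_mul_inv, div_le_iff₀ hT0]
            nlinarith [h.one_le, mul_le_mul_of_nonneg_left hT1 hM.le, mul_nonneg hN (sub_nonneg.2 h.one_le)]
          calc _ ≤ C * (M + N) * (T⁻¹ * Γ.δ w ^ (γ - 1)) := by rw [e1]; gcongr
            _ = C * ((M + N) * T⁻¹) * Γ.δ w ^ (γ - 1) := by ring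
            _ ≤ C * M * Γ.δ w ^ (γ - 1) := by gcongr
            _ ≤ _ := by linarith
      have hp := path_bound h.holo (β := fun t => 2 * C * M * (t + l)⁻¹ + C * M * t ^ (γ - 1))
        (B := fun t => 2 * C * M * Real.log (t + l) + C * M / γ * t ^ γ) (by
          intro s hs t ht' hst
          have hs : 0 < s := hs
          have h1 : t ^ (γ - 1) ≤ s ^ (γ - 1) :=
            Real.rpow_le_rpow_of_nonpos hs hst (by linarith)
          dsimp only
          gcongr) (by
          intro t ht'
          have h1 := (((hasDerivAt_id t).add_const l).log (by simp only [id]; positivity)).const_mul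
            (2 * C * M)
          have h2 := (Real.hasDerivAt_rpow_const (x := t) (p := γ) (Or.inl ht'.ne')).const_mul
            (C * M / γ)
          refine (h1.add h2).congr_deriv ?_
          simp only [id]
          field_simp) key hz hV
      have h1 := d3 _ ((le_add_of_nonneg_left hδ.le).trans (endpoint_depth hV))
      have q1 : Real.log (Γ.δ z + Γ.t0 + l) ≤ 2 := by
        have := Real.log_le_sub_one_of_pos (x := Γ.δ z + Γ.t0 + l) (by positivity)
        have h5 := hk.le.trans Γ.κ_le_one
        linarith
      have q2 : -(1 / γ) * Y ≤ Real.log (Γ.δ z + l) := by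
        rw [← hlog]; exact Real.log_le_log hl0 (by linarith)
      have q3 : (Γ.δ z + Γ.t0) ^ γ ≤ 2 := by
        have h5 := hk.le.trans Γ.κ_le_one
        calc _ ≤ (2 : ℝ) ^ γ := Real.rpow_le_rpow (by positivity) (by linarith) hγ0.le
          _ ≤ (2 : ℝ) ^ (1 : ℝ) := Real.rpow_le_rpow_of_exponent_le (by norm_num) hγ1
          _ = 2 := by norm_num
      have q4 : 0 ≤ C * M / γ * Γ.δ z ^ γ := by positivity
      have q5 : Real.log (Γ.δ z + Γ.t0 + l) - Real.log (Γ.δ z + l) ≤ (2 + 1 / γ) * Y := by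
        have : 1 * 2 ≤ 2 * Y := by linarith
        linarith
      have q6 : ‖g (z - Γ.t0 * Γ.V z) - g z‖ ≤
          Γ.L * (2 * C * M * ((2 + 1 / γ) * Y) + C * M / γ * (2 * Y)) := by
        refine hp.trans ?_
        gcongr
        have : 2 * C * M * (Real.log (Γ.δ z + Γ.t0 + l) - Real.log (Γ.δ z + l)) ≤
          2 * C * M * ((2 + 1 / γ) * Y) := by gcongr
        have : C * M / γ * (Γ.δ z + Γ.t0) ^ γ ≤ C * M / γ * (2 * Y) := by
          gcongr; linarith
        linarith
      have q7 : |(g z).im| ≤ |(g (z - Γ.t0 * Γ.V z)).im| + ‖g (z - Γ.t0 * Γ.V z) - g z‖ := by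
        have := abs_im_le_norm (g (z - Γ.t0 * Γ.V z) - g z)
        rw [sub_im] at this
        have h3 := abs_sub_abs_le_abs_sub (g z).im (g (z - Γ.t0 * Γ.V z)).im
        rw [abs_sub_comm] at h3
        linarith
      have q8 : C * M ≤ C * M * Y := le_mul_of_one_le_right (by positivity) hY
      have q9 : 0 ≤ E * (M * Y) := by positivity
      calc _ ≤ C * M * Y + Γ.L * (2 * C * M * ((2 + 1 / γ) * Y) + C * M / γ * (2 * Y)) := by
            linarith
        _ = A * (M * Y) := by rw [hA]; ring
        _ ≤ _ := by linarith
    · refine (h.im_le_of_energy hz).trans ?_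
      have h6 : 0 ≤ A * (M * Y) := by positivity
      have h7 : E * M ≤ E * M * Y := le_mul_of_one_le_right (by positivity) hY
      calc _ ≤ profK * (volume.real Γ.dom + Real.pi) * (4 * Γ.L) * M * (Γ.κ)⁻¹ := by gcongr
        _ = E * M := by rw [hE]; ring
        _ ≤ _ := by linarith
  refine (h.norm_db_f_le_im hz).trans ?_
  have h7 : M ≤ M * Y := le_mul_of_one_le_right (by positivity) hY
  have h8 : 0 ≤ C * (M * Y) := by positivity
  linarith

end IsSol
end Geo

namespace Geo
variable {Γ : Geo} {x : ℂ}

lemma near_weight_le {r d : ℝ} (hd : 0 < d) (h : d ≤ r) :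
    d ^ 2 * ((r + d) ^ 2 * r)⁻¹ ≤ 2 * d ^ 2 * (r + d) ^ (-3 : ℝ) := by
  have hr : 0 < r := hd.trans_le h
  have h1 : ((r + d) ^ 2 * r)⁻¹ ≤ 2 * ((r + d) ^ 3)⁻¹ := by
    rw [← div_eq_mul_inv, inv_eq_one_div, div_le_div_iff₀ (by positivity) (by positivity)]
    nlinarith [sq_nonneg (r + d), mul_nonneg (sq_nonneg (r + d)) (sub_nonneg.2 h)]
  rw [Real.rpow_neg (by positivity), show (3 : ℝ) = (3 : ℕ) by norm_num, Real.rpow_natCast]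
  calc _ ≤ d ^ 2 * (2 * ((r + d) ^ 3)⁻¹) := by gcongr
    _ = _ := by ring

namespace IsSol
variable {q M N : ℝ} {f W g : ℂ → ℂ}

/-- The velocity vanishes linearly at the boundary, with a logarithmic constant. -/
lemma norm_f_le (Γ : Geo) : ∃ C > 0, ∀ {q M N : ℝ} {f W g : ℂ → ℂ} {K : ℝ},
    IsSol Γ q M N f W g → 0 ≤ K → (∀ z ∈ Γ.dom, ‖db f z‖ ≤ K) →
    ∀ z ∈ Γ.dom, ‖f z‖ ≤ C * K * Γ.δ z := by
  have hL := Γ.L_pos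
  have hκ := Γ.κ_pos
  have hpi := Real.pi_pos
  set J := ∫ y : ℂ, (1 + ‖y‖) ^ (-(3 : ℝ)) with hJ
  have hJ0 : 0 ≤ J := integral_nonneg fun y => by positivity
  set A := 25 * Γ.L ^ 6 * (2 * Real.pi + 2 * J) with hA
  set E := 2 * Real.pi * (2 * |Γ.D| + 1) * (Γ.κ)⁻¹ with hE
  have hA0 : 0 < A := by positivity
  have hE0 : 0 < E := by positivity
  refine ⟨A + E, by positivity, fun {q M N f W g K} h hK hb z hz => ?_⟩
  have hδ := Γ.δ_pos hz
  rcases lt_or_ge (Γ.δ z) Γ.κ with hk | hk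
  · obtain ⟨i1, h1⟩ := rep_near hz hk h.contDiff_one h.vanish h.integrableOn_db_f
    set d := Γ.δ z with hd
    refine h1.trans ?_
    set φ : ℂ → ℝ := fun y => (Metric.ball z d).indicator (fun y => ‖y - z‖ ^ (-(1 : ℝ))) y +
      2 * d ^ 2 * (‖y - z‖ + d) ^ (-3 : ℝ) with hφ
    have j1 : Integrable ((Metric.ball z d).indicator (fun y : ℂ => ‖y - z‖ ^ (-(1 : ℝ)))) :=
      (integrableOn_ball_rpow (by norm_num) z d).integrable_indicator measurableSet_ball
    have j2 : Integrable (fun y : ℂ => 2 * d ^ 2 * (‖y - z‖ + d) ^ (-3 : ℝ)) :=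
      (integrable_add_rpow (a := 3) (by norm_num) z hδ).const_mul _
    have j3 : Integrable φ := j1.add j2
    have hφ0 : ∀ y, 0 ≤ φ y := fun y => by
      refine add_nonneg (indicator_nonneg (fun y _ => by positivity) y) (by positivity)
    have hw : ∀ y, d ^ 2 * ((‖y - z‖ + d) ^ 2 * ‖y - z‖)⁻¹ ≤ φ y := fun y => by
      simp only [hφ]
      rcases lt_or_ge ‖y - z‖ d with hr | hr
      · rw [indicator_of_mem (by rwa [mem_ball_iff_norm])]
        have : d ^ 2 * ((‖y - z‖ + d) ^ 2 * ‖y - z‖)⁻¹ ≤ ‖y - z‖ ^ (-(1 : ℝ)) := by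
          rw [Real.rpow_neg_one, mul_inv, ← mul_assoc]
          refine mul_le_of_le_one_left (by positivity) ?_
          rw [← div_eq_mul_inv, div_le_one (by positivity)]
          gcongr
          linarith [norm_nonneg (y - z)]
        have : 0 ≤ 2 * d ^ 2 * (‖y - z‖ + d) ^ (-3 : ℝ) := by positivity
        linarith
      · rw [indicator_of_notMem (by rw [mem_ball_iff_norm]; exact not_lt.2 hr), zero_add]
        exact near_weight_le hδ hr
    have hI : ∫ y, φ y = (2 * Real.pi + 2 * J) * d := by
      rw [integral_add j1 j2, integral_indicator measurableSet_ball, integral_const_mul,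
        integral_add_rpow (a := 3) z hδ, integral_ball_rpow (by norm_num) z hδ.le, ← hJ]
      norm_num
      rw [Real.rpow_neg_one]
      field_simp
    calc _ ≤ ∫ y in Γ.dom, K * (25 * Γ.L ^ 6) * φ y := by
          refine setIntegral_mono_on i1 (j3.integrableOn.const_mul _) Γ.measurableSet_dom
            fun y hy => ?_
          have := hb y hy
          rw [mul_assoc K]
          gcongr
          exact hw y
      _ ≤ K * (25 * Γ.L ^ 6) * ∫ y, φ y := by
          rw [integral_const_mul]
          refine mul_le_mul_of_nonneg_left ?_ (by positivity)
          exact setIntegral_le_integral j3 (Filter.Eventually.of_forall hφ0)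
      _ = A * K * d := by rw [hI, hA]; ring
      _ ≤ _ := by
          have : 0 ≤ E * K * d := by positivity
          linarith
  · obtain ⟨i3, h3⟩ := integrableOn_dom_rpow hz (a := 1) (by norm_num)
    refine (rep_far hz h.contDiff_one h.vanish h.integrableOn_db_f).trans ?_
    calc _ ≤ ∫ y in Γ.dom, K * ‖y - z‖ ^ (-(1 : ℝ)) := by
          refine setIntegral_mono_on (integrableOn_far hz h.contDiff_one h.vanish h.integrableOn_db_f)
            (i3.const_mul _) Γ.measurableSet_dom fun y hy => ?_
          rw [Real.rpow_neg_one]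
          gcongr
          exact hb y hy
      _ ≤ K * (2 * Real.pi / (2 - 1) * (2 * |Γ.D| + 1) ^ (2 - 1 : ℝ)) := by
          rw [integral_const_mul]; gcongr
      _ = E * K * Γ.κ := by
          rw [hE, show (2 - 1 : ℝ) = 1 by norm_num, Real.rpow_one]; field_simp
      _ ≤ E * K * Γ.δ z := by gcongr
      _ ≤ _ := by
          have : 0 ≤ A * K * Γ.δ z := by positivity
          linarith

end IsSol
end Geo

lemma contDiffOn_dz {u : ℂ → ℂ} {U : Set ℂ} (hU : IsOpen U) (hu : ContDiffOn ℝ 2 u U) :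
    ContDiffOn ℝ 1 (dz u) U := by
  have := hu.fderiv_of_isOpen hU (m := 1) (by norm_num)
  unfold dz
  fun_prop

lemma db_dz_eq_dz_db {u : ℂ → ℂ} {U : Set ℂ} (hU : IsOpen U) (hu : ContDiffOn ℝ 2 u U) {z : ℂ}
    (hz : z ∈ U) : db (dz u) z = dz (db u) z := by
  have hc := hu.contDiffAt (hU.mem_nhds hz)
  have hs : IsSymmSndFDerivAt ℝ u z := hc.isSymmSndFDerivAt (by simp)
  have hd : DifferentiableAt ℝ (fderiv ℝ u) z :=
    (hc.fderiv_right (m := 1) (by norm_num)).differentiableAt one_ne_zero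
  have h1 : ∀ v : ℂ, HasFDerivAt (fun y => fderiv ℝ u y v) ((fderiv ℝ (fderiv ℝ u) z).flip v) z :=
    fun v => by
      have := hd.hasFDerivAt.clm_apply (hasFDerivAt_const v z)
      refine this.congr_fderiv ?_
      ext w; simp
  have e1 : HasFDerivAt (dz u) _ z := ((h1 1).sub ((h1 I).const_mul I)).mul_const (2 : ℂ)⁻¹
  have e2 : HasFDerivAt (db u) _ z := ((h1 1).add ((h1 I).const_mul I)).mul_const (2 : ℂ)⁻¹
  rw [db, dz, e1.fderiv, e2.fderiv]
  have := hs.eq 1 I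
  simp
  rw [this]
  ring

lemma integrable_mul_inv {ψ : ℂ → ℂ} (h : Continuous ψ) (hc : HasCompactSupport ψ) (x : ℂ) :
    Integrable fun y => ψ y * (y - x)⁻¹ := by
  refine (integrable_of_bound_inv h hc x).mono' ?_ (Filter.Eventually.of_forall fun y => ?_)
  · exact (h.measurable.mul ((measurable_id.sub_const x).inv)).aestronglyMeasurable
  · rw [norm_mul, norm_inv]

section annulus
variable {x : ℂ} {s l : ℝ}

lemma contDiff_ck_sub (hl : 0 < l) (hs : 0 < s) (x : ℂ) :
    ContDiff ℝ 1 (fun y => ck x l y - ck x s y) :=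
  (contDiff_ck hl x).sub (contDiff_ck hs x)

lemma ck_sub_eq_zero (hl : 0 < l) (hls : l ≤ s) (y : ℂ) (h : s < ‖y - x‖) :
    ck x l y - ck x s y = 0 := by
  rw [ck, ck, cut_eq_zero hl (hls.trans h.le), cut_eq_zero (hl.trans_le hls) h.le, sub_self]

lemma norm_sub_mul_ker2_le (hs : 0 < s) (y : ℂ) : ‖(y - x) * ker2 x s y‖ ≤
    (Metric.closedBall x s).indicator (fun _ => profK / s ^ 2) y := by
  have hP := profK_pos
  rcases lt_or_ge s ‖y - x‖ with h | h
  · rw [ker2_eq_zero hs h, mul_zero, norm_zero]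
    exact indicator_nonneg (fun _ _ => by positivity) _
  · rw [indicator_of_mem (by simpa [dist_eq] using h), norm_mul]
    calc _ ≤ s * (profK / s ^ 3) := by gcongr; exact norm_ker2_le hs
      _ = _ := by field_simp

lemma dz_cut_div (hs : 0 < s) (y : ℂ) :
    ‖dz (cut x s) y * (y - x)⁻¹‖ = ‖(y - x) * ker2 x s y‖ := by
  rw [(hasWirt_cut hs.ne').dz_eq, norm_mul, RCLike.norm_conj, ← norm_mul]
  congr 1
  rcases eq_or_ne y x with rfl | h
  · simp
  · have := sub_ne_zero.2 h
    field_simp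

lemma norm_dz_ck_sub_le (hl : 0 < l) (hls : l ≤ s) (y : ℂ) :
    ‖dz (fun y => ck x l y - ck x s y) y‖ ≤
      (Metric.closedBall x l).indicator (fun _ => profK / l ^ 2) y +
      (Metric.closedBall x s).indicator (fun _ => profK / s ^ 2) y +
      {y : ℂ | l / 2 ≤ ‖y - x‖ ∧ ‖y - x‖ ≤ s}.indicator (fun y => 2 * (‖y - x‖ ^ 2)⁻¹) y := by
  have hs := hl.trans_le hls
  rw [((hasWirt_ck hl x y).sub (hasWirt_ck hs x y)).dz_eq]
  have e : -(dz (cut x l) y * (y - x)⁻¹) - (1 - cut x l y) * ((y - x) ^ 2)⁻¹ -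
      (-(dz (cut x s) y * (y - x)⁻¹) - (1 - cut x s y) * ((y - x) ^ 2)⁻¹) =
      -(dz (cut x l) y * (y - x)⁻¹) + dz (cut x s) y * (y - x)⁻¹
        + (cut x l y - cut x s y) * ((y - x) ^ 2)⁻¹ := by ring
  rw [e]
  refine (norm_add₃_le).trans (add_le_add (add_le_add ?_ ?_) ?_)
  · rw [norm_neg, dz_cut_div hl]; exact norm_sub_mul_ker2_le hl y
  · rw [dz_cut_div hs]; exact norm_sub_mul_ker2_le hs y
  · by_cases h : y ∈ {y : ℂ | l / 2 ≤ ‖y - x‖ ∧ ‖y - x‖ ≤ s}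
    · rw [indicator_of_mem h, norm_mul, norm_inv, norm_pow]
      gcongr
      refine (norm_sub_le _ _).trans ?_
      linarith [norm_cut_le (x := x) (s := l) (y := y), norm_cut_le (x := x) (s := s) (y := y)]
    · rw [indicator_of_notMem h]
      have h2 : cut x l y = cut x s y := by
        rcases lt_or_ge ‖y - x‖ (l / 2) with h3 | h3
        · rw [cut_eq_one hl h3.le, cut_eq_one hs (by linarith)]
        · have h4 : s < ‖y - x‖ := by
            by_contra h4; exact h ⟨h3, not_lt.1 h4⟩
          rw [cut_eq_zero hl (hls.trans h4.le), cut_eq_zero hs h4.le]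
      rw [h2, sub_self, zero_mul, norm_zero]

/-- A singular integral over an annulus costs a logarithm. -/
lemma norm_integral_annulus_le {U : Set ℂ} {W : ℂ → ℂ} {M : ℝ} (hU : IsOpen U)
    (hW : ContDiffOn ℝ 1 W U) (hM : ∀ z ∈ U, ‖W z‖ ≤ M) (hM0 : 0 ≤ M) (hl : 0 < l) (hls : l ≤ s)
    (hb : Metric.closedBall x s ⊆ U) :
    Integrable (fun y => dz W y * (ck x l y - ck x s y)) ∧
    ‖∫ y, dz W y * (ck x l y - ck x s y)‖ ≤
      M * (2 * Real.pi * profK + 4 * Real.pi * Real.log (2 * s / l)) := by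
  have hs := hl.trans_le hls
  have hX0 := ck_sub_eq_zero (x := x) hl hls
  have hc := hasCompactSupport_of_ball hX0
  have ht := (tsupport_subset_closedBall hX0).trans hb
  have hX := contDiff_ck_sub hl hs x
  refine ⟨(continuous_mul_of_tsupport hU (continuousOn_dz hU hW) hX.continuous
    ht).integrable_of_hasCompactSupport hc.mul_left, ?_⟩
  rw [ibp_dz hU hW hX hc ht, norm_neg]
  have hm : MeasurableSet {y : ℂ | l / 2 ≤ ‖y - x‖ ∧ ‖y - x‖ ≤ s} :=
    (isClosed_annulus x (l / 2) s).measurableSet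
  have i0 : ∀ r : ℝ, Integrable ((Metric.closedBall x r).indicator fun _ : ℂ => profK / r ^ 2) :=
    fun r => (integrable_indicator_iff measurableSet_closedBall).2
      (integrableOn_const (isCompact_closedBall x r).measure_lt_top.ne)
  have i1 : ∀ r : ℝ, 0 < r →
      ∫ y, (Metric.closedBall x r).indicator (fun _ : ℂ => profK / r ^ 2) y = Real.pi * profK :=
    fun r hr => by
      rw [integral_indicator measurableSet_closedBall, setIntegral_const, Measure.real,
        Complex.volume_closedBall]
      simp [hr.le]
      field_simp
  have i2 := (integrable_indicator_iff hm).2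
    ((integrableOn_annulus_inv_sq x (t := s) (half_pos hl)).const_mul 2)
  have i3 := ((i0 l).add (i0 s)).add i2
  refine (norm_integral_le_of_norm_le (i3.const_mul M) (Filter.Eventually.of_forall fun y => ?_)).trans
    (le_of_eq ?_)
  · rw [norm_mul]
    by_cases hy : y ∈ U
    · exact mul_le_mul (hM y hy) (norm_dz_ck_sub_le hl hls y) (norm_nonneg _) hM0
    · have : dz (fun y => ck x l y - ck x s y) y = 0 := by
        by_contra h
        exact hy (ht (tsupport_dz_subset _ (subset_tsupport _ h)))
      rw [this, norm_zero, mul_zero]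
      refine mul_nonneg hM0 (add_nonneg (add_nonneg ?_ ?_) ?_)
      all_goals
        have := profK_pos
        exact indicator_nonneg (fun _ _ => by positivity) _
  · rw [integral_const_mul, integral_add' ((i0 l).add (i0 s)) i2, integral_add' (i0 l) (i0 s),
      i1 l hl, i1 s hs, integral_indicator hm, integral_const_mul,
      integral_annulus_inv_sq x (half_pos hl) (by linarith)]
    rw [show s / (l / 2) = 2 * s / l by field_simp]
    ring

end annulus

namespace Geo
variable {Γ : Geo} {x : ℂ}
namespace IsSol
variable {q M N : ℝ} {f W g : ℂ → ℂ}

lemma db_dz_f (h : IsSol Γ q M N f W g) {y : ℂ} (hy : y ∈ Γ.dom) :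
    db (dz f) y = dz W y - deriv g y := by
  rw [db_dz_eq_dz_db Γ.isOpen_dom h.contDiff_f hy]
  have h1 := ((hasWirt_C1 h.contDiff_W hy).add (hasWirt_conj_holo Γ.isOpen_dom h.holo hy)).sub
    (hasWirt_holo h.holo hy)
  have h2 : db f =ᶠ[nhds y] fun z => W z + conj (g z) - g z := by
    filter_upwards [Γ.isOpen_dom.mem_nhds hy] with z hz using h.eqn z hz
  rw [(h1.congr_fun h2).dz_eq, add_zero]

/-- The innermost part of the singular integral is controlled by `‖∇W‖_q`. -/
lemma norm_integral_inner_le (h : IsSol Γ q M N f W g) {l : ℝ} (hl : 0 < l)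
    (hb : Metric.closedBall x l ⊆ Γ.dom) :
    Integrable (fun y => dz W y * cut x l y * (y - x)⁻¹) ∧
    ‖∫ y, dz W y * cut x l y * (y - x)⁻¹‖ ≤
      N * ((2 * Real.pi / (2 - q / (q - 1))) ^ (1 - 1 / q) * l ^ (1 - 2 / q)) := by
  have hq := h.two_lt
  have ht := (tsupport_cut_subset hl (x := x)).trans hb
  have hc : HasCompactSupport (cut x l) :=
    hasCompactSupport_of_ball fun _ h => cut_eq_zero hl h.le
  refine ⟨integrable_mul_inv (continuous_mul_of_tsupport Γ.isOpen_dom (continuousOn_dz Γ.isOpen_dom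
    h.contDiff_W) (contDiff_cut (n := 1)).continuous ht) hc.mul_left x, ?_⟩
  set p := q / (q - 1) with hp
  have hp0 : 0 < p := div_pos (by linarith) (by linarith)
  have hp2 : p < 2 := by rw [hp, div_lt_iff₀ (by linarith)]; linarith
  set φ : ℂ → ℝ := (Metric.ball x l).indicator fun y => ‖y - x‖⁻¹ with hφ
  have hφm : Measurable φ :=
    Measurable.indicator (by fun_prop) measurableSet_ball
  have hφ0 : ∀ y, 0 ≤ φ y := fun y => indicator_nonneg (fun y _ => by positivity) y
  have hφp : (fun y => φ y ^ p) = (Metric.ball x l).indicator fun y => ‖y - x‖ ^ (-p) := by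
    ext y
    by_cases hy : y ∈ Metric.ball x l
    · rw [hφ, indicator_of_mem hy, indicator_of_mem hy, Real.inv_rpow (norm_nonneg _),
        Real.rpow_neg (norm_nonneg _)]
    · rw [hφ, indicator_of_notMem hy, indicator_of_notMem hy, Real.zero_rpow hp0.ne']
  have hi : Integrable fun y => φ y ^ p := by
    rw [hφp]
    exact (integrableOn_ball_rpow hp2 x l).integrable_indicator measurableSet_ball
  obtain ⟨j1, j2⟩ := h.holder hφm hφ0 hi.integrableOn
  have e1 : ∫ y in Γ.dom, φ y ^ p ≤ 2 * Real.pi / (2 - p) * l ^ (2 - p) := by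
    refine (setIntegral_le_integral hi (Filter.Eventually.of_forall fun y => ?_)).trans (le_of_eq ?_)
    · exact Real.rpow_nonneg (hφ0 y) _
    · rw [hφp, integral_indicator measurableSet_ball, integral_ball_rpow hp2 x hl.le]
  have e2 : (∫ y in Γ.dom, φ y ^ p) ^ (1 - 1 / q) ≤
      (2 * Real.pi / (2 - p)) ^ (1 - 1 / q) * l ^ (1 - 2 / q) := by
    have hpi := Real.pi_pos
    have h2p : 0 < 2 - p := by linarith
    have h1q : 0 ≤ 1 - 1 / q := by
      rw [sub_nonneg, div_le_one (by linarith)]; linarith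
    calc _ ≤ (2 * Real.pi / (2 - p) * l ^ (2 - p)) ^ (1 - 1 / q) :=
          Real.rpow_le_rpow (integral_nonneg fun y => Real.rpow_nonneg (hφ0 y) _) e1 h1q
      _ = _ := by
          rw [Real.mul_rpow (by positivity) (by positivity), ← Real.rpow_mul hl.le]
          congr 2
          have : q - 1 ≠ 0 := by linarith
          have : q ≠ 0 := by linarith
          rw [hp]; field_simp; ring
  have e3 : ∫ y, dz W y * cut x l y * (y - x)⁻¹ = ∫ y in Γ.dom, dz W y * cut x l y * (y - x)⁻¹ := by
    rw [setIntegral_eq_integral_of_forall_compl_eq_zero]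
    intro y hy
    rw [image_eq_zero_of_notMem_tsupport fun hn => hy (ht hn)]; simp
  rw [e3]
  refine (norm_integral_le_of_norm_le j1 (Filter.Eventually.of_forall fun y => ?_)).trans
    (j2.trans (mul_le_mul_of_nonneg_left e2 h.nonneg))
  by_cases hy : y ∈ Metric.ball x l
  · rw [hφ, indicator_of_mem hy, norm_mul, norm_mul, norm_inv]
    gcongr
    calc _ ≤ ‖fderiv ℝ W y‖ * 1 := by gcongr; exacts [norm_dz_le _ _, norm_cut_le]
      _ = _ := mul_one _
  · rw [cut_eq_zero hl (by simpa [dist_eq] using hy)]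
    simp only [mul_zero, zero_mul, norm_zero]
    have := hφ0 y
    positivity

/-- Cauchy–Pompeiu estimate of `∂f` on an interior disc. -/
lemma norm_dz_f_le_aux (h : IsSol Γ q M N f W g) (hx : x ∈ Γ.dom) {F G l : ℝ}
    (hF : ∀ y, ‖y - x‖ ≤ Γ.rad x → ‖f y‖ ≤ F) (hG : ∀ y, ‖y - x‖ ≤ Γ.rad x → ‖deriv g y‖ ≤ G)
    (hl : 0 < l) (hls : l ≤ Γ.rad x) :
    Real.pi * ‖dz f x‖ ≤ 2 * Real.pi * profK * (F / Γ.rad x) + 2 * Real.pi * (G * Γ.rad x)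
      + N * ((2 * Real.pi / (2 - q / (q - 1))) ^ (1 - 1 / q) * l ^ (1 - 2 / q))
      + M * (2 * Real.pi * profK + 4 * Real.pi * Real.log (2 * Γ.rad x / l)) := by
  have hs := Γ.rad_pos hx
  have hb := Γ.closedBall_rad hx
  set s := Γ.rad x with hsd
  have hP := profK_pos
  have hpi := Real.pi_pos
  have hU := Γ.isOpen_dom
  have ht := (tsupport_cut_subset hs (x := x)).trans hb
  have hcc : HasCompactSupport (cut x s) :=
    hasCompactSupport_of_ball fun _ h => cut_eq_zero hs h.le
  have hdz := contDiffOn_dz hU h.contDiff_f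
  have hcut : ContDiff ℝ 1 (cut x s) := contDiff_cut (n := 1)
  have hcp := cauchy_pompeiu (contDiff_mul_of_tsupport hU hdz hcut ht) hcc.mul_left x
  rw [cut_eq_one hs (by simp; positivity), mul_one] at hcp
  obtain ⟨i1, b1⟩ := h.norm_integral_inner_le hl ((Metric.closedBall_subset_closedBall hls).trans hb)
  obtain ⟨i2, b2⟩ := norm_integral_annulus_le hU h.contDiff_W h.norm_W h.M_pos.le hl hls hb
  set X : ℂ → ℂ := fun y => (y - x) * ker2 x s y with hX
  have hXc : ContDiff ℝ 1 X := (contDiff_id.sub contDiff_const).mul contDiff_ker2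
  have hX0 : ∀ y, s < ‖y - x‖ → X y = 0 := fun y hy => by simp only [hX, ker2_eq_zero hs hy, mul_zero]
  have hXs := hasCompactSupport_of_ball hX0
  have hXt := (tsupport_subset_closedBall hX0).trans hb
  have hdX : ∀ y, HasWirt X (1 * ker2 x s y + (y - x) * dz (ker2 x s) y)
      (0 * ker2 x s y + (y - x) * db (ker2 x s) y) y := fun y => by
    have h1 := ((hasWirt_id y).sub (hasWirt_const x y)).mul
      (hasWirt_of_diff (contDiff_ker2.differentiable one_ne_zero y) (u := ker2 x s))
    exact h1.congr_coeff (by ring) (by ring)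
  have i3 : Integrable fun y => dz f y * X y :=
    (continuous_mul_of_tsupport hU (continuousOn_dz hU h.contDiff_one) hXc.continuous
      hXt).integrable_of_hasCompactSupport hXs.mul_left
  have b3 : ‖∫ y, dz f y * X y‖ ≤ 2 * Real.pi * profK * (F / s) := by
    rw [ibp_dz hU h.contDiff_one hXc hXs hXt, norm_neg]
    refine (norm_integral_le_of_ball (x := x) (s := s) (B := F * (2 * profK / s ^ 3))
      (fun y hy => ?_) (fun y hy => ?_) hs.le).trans (le_of_eq (by field_simp))
    · have : dz X y = 0 := by
        by_contra hn
        have := (tsupport_subset_closedBall hX0) (tsupport_dz_subset _ (subset_tsupport _ hn))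
        rw [Metric.mem_closedBall, dist_eq] at this
        linarith
      rw [this, mul_zero]
    · rw [norm_mul, (hdX y).dz_eq]
      have hF0 := (norm_nonneg _).trans (hF y hy)
      gcongr
      · exact hF y hy
      · refine (norm_add_le _ _).trans ?_
        rw [one_mul, norm_mul]
        calc _ ≤ profK / s ^ 3 + s * (profK / s ^ 4) := by
              gcongr; exacts [norm_ker2_le hs, norm_dz_ker2_le hs]
          _ = _ := by field_simp; ring
  have hg1 : ContinuousOn (deriv g) Γ.dom := h.continuousOn_deriv
  have hψg := continuous_mul_of_tsupport hU hg1 hcut.continuous ht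
  have i4 := integrable_mul_inv hψg hcc.mul_left x
  have b4 : ‖∫ y, deriv g y * cut x s y * (y - x)⁻¹‖ ≤ 2 * Real.pi * (G * s) := by
    have j := (integrableOn_ball_rpow (a := 1) (by norm_num) x s).const_mul G
    have e : ∫ y, deriv g y * cut x s y * (y - x)⁻¹ =
        ∫ y in Metric.ball x s, deriv g y * cut x s y * (y - x)⁻¹ := by
      rw [setIntegral_eq_integral_of_forall_compl_eq_zero]
      intro y hy
      rw [cut_eq_zero hs (by simpa [dist_eq] using hy)]; simp
    rw [e]
    refine (norm_integral_le_of_norm_le j ?_).trans (le_of_eq ?_)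
    · filter_upwards [ae_restrict_mem measurableSet_ball] with y hy
      rw [norm_mul, norm_mul, norm_inv, Real.rpow_neg_one]
      have hy' : ‖y - x‖ ≤ s := (by simpa [dist_eq] using hy : ‖y - x‖ < s).le
      have := hG y hy'
      have hG0 := (norm_nonneg _).trans this
      gcongr
      calc _ ≤ G * 1 := by gcongr; exact norm_cut_le
        _ = G := mul_one _
    · rw [integral_const_mul, integral_ball_rpow (by norm_num) x hs.le]
      norm_num
      ring
  have key : ∀ y, db (fun y => dz f y * cut x s y) y / (y - x) =
      dz f y * X y - deriv g y * cut x s y * (y - x)⁻¹ + (dz W y * cut x l y * (y - x)⁻¹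
        + dz W y * (ck x l y - ck x s y)) := fun y => by
    rw [db_mul_of_tsupport hU hdz hcut ht, (hasWirt_cut hs.ne').db_eq, hX]
    have h1 : db (dz f) y * cut x s y = (dz W y - deriv g y) * cut x s y := by
      by_cases hy : y ∈ Γ.dom
      · rw [h.db_dz_f hy]
      · rw [image_eq_zero_of_notMem_tsupport fun hn => hy (ht hn)]; simp
    rw [h1, ck, ck]
    rcases eq_or_ne y x with rfl | hne
    · simp
    · have := sub_ne_zero.2 hne
      field_simp
      ring
  simp_rw [key] at hcp
  have i5 : Integrable fun y => dz f y * X y - deriv g y * cut x s y * (y - x)⁻¹ := i3.sub i4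
  have i6 : Integrable fun y => dz W y * cut x l y * (y - x)⁻¹
    + dz W y * (ck x l y - ck x s y) := i1.add i2
  rw [integral_add i5 i6, integral_sub i3 i4, integral_add i1 i2] at hcp
  have h5 : Real.pi * ‖dz f x‖ = ‖-(Real.pi : ℂ) * dz f x‖ := by
    rw [norm_mul, norm_neg, norm_real, Real.norm_of_nonneg hpi.le]
  rw [h5, ← hcp]
  refine (norm_add_le _ _).trans ?_
  have := norm_sub_le (∫ y, dz f y * X y) (∫ y, deriv g y * cut x s y * (y - x)⁻¹)
  have := norm_add_le (∫ y, dz W y * cut x l y * (y - x)⁻¹) (∫ y, dz W y * (ck x l y - ck x s y))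
  linarith

end IsSol
end Geo

namespace Geo
variable {Γ : Geo} {x : ℂ}
namespace IsSol
variable {q M N : ℝ} {f W g : ℂ → ℂ}

/-- The logarithmic gradient bound in complex notation. -/
theorem norm_fderiv_le (Γ : Geo) {q : ℝ} (hq : 2 < q) : ∃ C > 0, ∀ {M N : ℝ} {f W g : ℂ → ℂ},
    IsSol Γ q M N f W g → ∀ z ∈ Γ.dom,
      ‖fderiv ℝ f z‖ ≤ C * (M * Real.log (Real.exp 1 + N)) := by
  have hL := Γ.L_pos
  have hP := profK_pos
  have hpi := Real.pi_pos
  obtain ⟨C1, hC1, h1⟩ := norm_db_f_le_log Γ hq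
  obtain ⟨C2, hC2, h2⟩ := norm_f_le Γ
  obtain ⟨B, hB1, hB⟩ := exists_δ_le Γ
  set α := 1 - 2 / q with hα
  have hα0 : 0 < α := by
    rw [hα, sub_pos, div_lt_one (by linarith)]; exact hq
  have hp2 : 0 < 2 - q / (q - 1) := by
    rw [sub_pos, div_lt_iff₀ (by linarith)]; linarith
  set H := (2 * Real.pi / (2 - q / (q - 1))) ^ (1 - 1 / q) with hH
  have hH0 : 0 ≤ H := by positivity
  set A1 := 2 * Real.pi * profK * (C2 * C1 * (8 * Γ.L)) with hA1
  set A2 := 4 * Real.pi * C1 with hA2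
  set A3 := H * B ^ α with hA3
  set A4 := 2 * Real.pi * profK + 4 * Real.pi * (1 + 1 / α) with hA4
  have hB0 : 0 < B := by linarith
  have p1 : 0 < A1 := by positivity
  have p2 : 0 < A2 := by positivity
  have p3 : 0 ≤ A3 := by positivity
  have p4 : 0 < A4 := by positivity
  refine ⟨(A1 + A2 + A3 + A4) / Real.pi + C1, by positivity, fun {M N f W g} h z hz => ?_⟩
  have hM := h.M_pos
  have hN := h.nonneg
  have hY := one_le_log hN
  set T := Real.exp 1 + N with hT
  set Y := Real.log T
  have hT0 : 0 < T := by positivity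
  have hT1 : 1 ≤ T := by
    have := Real.add_one_le_exp (1 : ℝ)
    linarith
  obtain ⟨d1, d2⟩ := h1 h
  have d3 := h2 h (by positivity) d2
  have hδ := Γ.δ_pos hz
  have hs := Γ.rad_pos hz
  set s := Γ.rad z with hsd
  have hδs := Γ.δ_eq_rad z
  have hMY : M ≤ M * Y := le_mul_of_one_le_right hM.le hY
  set l := s * T ^ (-(1 / α)) with hl
  have hTα : 0 < T ^ (-(1 / α)) := Real.rpow_pos_of_pos hT0 _
  have hl0 : 0 < l := by positivity
  have hls : l ≤ s := mul_le_of_le_one_right hs.le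
    (Real.rpow_le_one_of_one_le_of_nonpos hT1 (by
      have : 0 < 1 / α := by positivity
      linarith))
  have key := h.norm_dz_f_le_aux hz (F := C2 * (C1 * (M * Y)) * (2 * Γ.δ z))
    (G := C1 * M * (2 / Γ.δ z)) (fun y hy => (d3 y (Γ.mem_of_le_rad hz hy)).trans (by
      gcongr
      have := Γ.δ_le z y
      have : Γ.L * ‖y - z‖ ≤ Γ.L * s := by gcongr
      linarith)) (fun y hy => (d1 y (Γ.mem_of_le_rad hz hy)).trans (by
      gcongr
      have := Γ.half_le_δ hz hy
      rw [← inv_div]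
      gcongr)) hl0 hls
  rw [← hα, ← hH, ← hsd] at key
  have e1 : 2 * Real.pi * profK * (C2 * (C1 * (M * Y)) * (2 * Γ.δ z) / s) = A1 * (M * Y) := by
    rw [hδs, hA1]; field_simp; ring
  have e2 : 2 * Real.pi * (C1 * M * (2 / Γ.δ z) * s) ≤ A2 * (M * Y) := by
    have : 2 / Γ.δ z * s ≤ 2 := by
      have := Γ.rad_le hz
      rw [div_mul_eq_mul_div, div_le_iff₀ hδ]; linarith
    calc _ = 2 * Real.pi * C1 * M * (2 / Γ.δ z * s) := by ring
      _ ≤ 2 * Real.pi * C1 * M * 2 := by gcongr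
      _ = A2 * M := by rw [hA2]; ring
      _ ≤ _ := by gcongr
  have e3 : N * (H * l ^ α) ≤ A3 * (M * Y) := by
    have f1 : l ^ α ≤ B ^ α * T⁻¹ := by
      rw [hl, Real.mul_rpow hs.le hTα.le, ← Real.rpow_mul hT0.le,
        show -(1 / α) * α = -1 by field_simp, Real.rpow_neg_one]
      have := Γ.rad_le hz
      have := hB z hz
      gcongr
      linarith
    have f2 : N * T⁻¹ ≤ 1 := by
      rw [← div_eq_mul_inv, div_le_one hT0]
      have := Real.exp_pos 1
      linarith
    calc _ ≤ N * (H * (B ^ α * T⁻¹)) := by gcongr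
      _ = A3 * (N * T⁻¹) := by rw [hA3]; ring
      _ ≤ A3 * (M * Y) := by
          refine mul_le_mul_of_nonneg_left ?_ p3
          linarith [h.one_le]
  have e4 : M * (2 * Real.pi * profK + 4 * Real.pi * Real.log (2 * s / l)) ≤ A4 * (M * Y) := by
    have f1 : Real.log (2 * s / l) = Real.log 2 + 1 / α * Y := by
      rw [show 2 * s / l = 2 * T ^ (1 / α) by
        rw [hl, Real.rpow_neg hT0.le]; field_simp, Real.log_mul (by norm_num)
        (Real.rpow_pos_of_pos hT0 _).ne', Real.log_rpow hT0]
    have f2 : Real.log 2 ≤ 1 := by linarith [Real.log_two_lt_d9]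
    rw [f1]
    calc _ ≤ M * (2 * Real.pi * profK * Y + 4 * Real.pi * (1 * Y + 1 / α * Y)) := by
          have f3 : 2 * Real.pi * profK ≤ 2 * Real.pi * profK * Y :=
            le_mul_of_one_le_right (by positivity) hY
          refine mul_le_mul_of_nonneg_left (add_le_add f3 ?_) hM.le
          gcongr
          linarith
      _ = _ := by rw [hA4]; ring
  have e5 : ‖dz f z‖ ≤ (A1 + A2 + A3 + A4) / Real.pi * (M * Y) := by
    rw [div_mul_eq_mul_div, le_div_iff₀ hpi]
    linarith
  have := norm_fderiv_le_dz_add_db f z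
  have := d2 z hz
  linarith

end IsSol
end Geo

section strip
variable {r : ℂ → ℝ}

/-- A thin sublevel strip around a noncritical point has measure linear in its thickness. -/
lemma strip_local (hr : ContDiff ℝ 1 r) {z0 : ℂ} (hd : fderiv ℝ r z0 ≠ 0) :
    ∃ U, IsOpen U ∧ z0 ∈ U ∧ ∃ C : ℝ, 0 ≤ C ∧ ∀ t : ℝ, 0 < t →
      volume (U ∩ {z | -t < r z ∧ r z < 0}) ≤ ENNReal.ofReal (C * t) := by
  obtain ⟨v, hv⟩ : ∃ v, fderiv ℝ r z0 v ≠ 0 := by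
    by_contra! h; exact hd (by ext v; simp [h])
  set u : ℂ := (2 / fderiv ℝ r z0 v) • v with hu
  have hu2 : fderiv ℝ r z0 u = 2 := by
    rw [hu, map_smul, smul_eq_mul]; field_simp
  have hc : Continuous fun z => fderiv ℝ r z u := (hr.continuous_fderiv one_ne_zero).clm_apply
    continuous_const
  obtain ⟨ε, hε, hb⟩ := Metric.isOpen_iff.1 (isOpen_lt continuous_const hc : IsOpen
    {z | (1 : ℝ) < fderiv ℝ r z u}) z0 (by simp [hu2])
  refine ⟨Metric.ball z0 ε, Metric.isOpen_ball, Metric.mem_ball_self hε,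
    volume.real (Metric.ball z0 (ε + ‖u‖)), measureReal_nonneg, fun t ht => ?_⟩
  set S := Metric.ball z0 ε ∩ {z | -t < r z ∧ r z < 0} with hS
  have hSm : MeasurableSet S := (Metric.isOpen_ball.inter
    ((isOpen_lt continuous_const hr.continuous).inter
      (isOpen_lt hr.continuous continuous_const))).measurableSet
  have h1 : ∀ s : ℝ, volume S = ∫⁻ z : ℂ, S.indicator 1 (z + s * u) := fun s => by
    rw [lintegral_add_right_eq_self (S.indicator 1), lintegral_indicator_one hSm]
  have h2 : volume S = ∫⁻ s in Icc (0 : ℝ) 1, ∫⁻ z : ℂ, S.indicator 1 (z + s * u) := by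
    simp_rw [← h1]; simp
  have hm : Measurable (fun p : ℝ × ℂ => S.indicator (1 : ℂ → ℝ≥0∞) (p.2 + p.1 * u)) :=
    (measurable_one.indicator hSm).comp (by fun_prop)
  rw [h2, lintegral_lintegral_swap (f := fun (s : ℝ) (z : ℂ) => S.indicator 1 (z + s * u))
    hm.aemeasurable, ENNReal.ofReal_mul measureReal_nonneg, ofReal_measureReal
    Metric.isBounded_ball.measure_lt_top.ne, mul_comm,
    ← setLIntegral_const, ← lintegral_indicator measurableSet_ball]
  refine lintegral_mono fun z => ?_
  have h3 : ∀ s : ℝ, S.indicator (1 : ℂ → ℝ≥0∞) (z + s * u) =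
      {s : ℝ | z + s * u ∈ S}.indicator 1 s := fun s => by
    simp only [indicator, mem_ofPred_eq]
    rfl
  have hTm : MeasurableSet {s : ℝ | z + s * u ∈ S} := hSm.preimage (by fun_prop)
  simp only [h3]
  rw [lintegral_indicator_one hTm, Measure.restrict_apply hTm]
  by_cases hz : z ∈ Metric.ball z0 (ε + ‖u‖)
  · rw [indicator_of_mem hz]
    refine (measure_mono inter_subset_left).trans ((Real.volume_le_diam _).trans
      (Metric.ediam_le fun a ha b hb' => ?_))
    have key : ∀ {a b : ℝ}, a ≤ b → z + a * u ∈ S → z + b * u ∈ S → b - a ≤ t := by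
      intro a b hab ha hb'
      have hD : ∀ s : ℝ, HasDerivAt (fun s : ℝ => r (z + s * u)) (fderiv ℝ r (z + s * u) u) s :=
        fun s => by
          have e1 : HasDerivAt (fun s : ℝ => z + s * u) u s := by
            simpa using ((ofRealCLM.hasDerivAt (x := s)).mul_const u).const_add z
          exact ((hr.differentiable one_ne_zero _).hasFDerivAt).comp_hasDerivAt s e1
      have h5 := (convex_Icc a b).mul_sub_le_image_sub_of_le_deriv (C := 1)
        (f := fun s : ℝ => r (z + s * u))
        (fun s _ => (hD s).continuousAt.continuousWithinAt)
        (fun s _ => (hD s).differentiableAt.differentiableWithinAt) (fun s hs => by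
          rw [interior_Icc] at hs
          rw [(hD s).deriv]
          refine (hb ?_ : (1 : ℝ) < _).le
          have := (convex_ball z0 ε).segment_subset ha.1 hb'.1
          refine this ⟨(b - s) / (b - a), (s - a) / (b - a), ?_, ?_, ?_, ?_⟩
          · exact div_nonneg (by linarith [hs.2]) (by linarith)
          · exact div_nonneg (by linarith [hs.1]) (by linarith)
          · have : b - a ≠ 0 := by linarith [hs.1, hs.2]
            field_simp; ring
          · have : (b : ℂ) - a ≠ 0 := by
              rw [← ofReal_sub]; exact ofReal_ne_zero.2 (by linarith [hs.1, hs.2])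
            simp only [real_smul, ofReal_div, ofReal_sub]
            field_simp
            ring) a (left_mem_Icc.2 hab) b (right_mem_Icc.2 hab) hab
      have h6 := ha.2.1
      have h7 := hb'.2.2
      linarith
    rw [edist_dist, Real.dist_eq]
    refine ENNReal.ofReal_le_ofReal ?_
    rcases le_total a b with hab | hab
    · rw [abs_sub_comm, abs_of_nonneg (sub_nonneg.2 hab)]; exact key hab ha hb'
    · rw [abs_of_nonneg (sub_nonneg.2 hab)]; exact key hab hb' ha
  · rw [indicator_of_notMem hz, nonpos_iff_eq_zero]
    convert measure_empty (μ := volume)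
    ext s
    simp only [mem_inter_iff, mem_ofPred_eq, mem_empty_iff_false, iff_false, not_and]
    intro hs hs1
    refine hz ?_
    have h6 : ‖z + s * u - z0‖ < ε := mem_ball_iff_norm.1 hs.1
    rw [mem_ball_iff_norm]
    calc ‖z - z0‖ = ‖(z + s * u - z0) - s * u‖ := by congr 1; ring
      _ ≤ ‖z + s * u - z0‖ + ‖(s : ℂ) * u‖ := norm_sub_le _ _
      _ < ε + ‖u‖ := by
        refine add_lt_add_of_lt_of_le h6 ?_
        rw [norm_mul, norm_real, Real.norm_of_nonneg hs1.1]
        exact mul_le_of_le_one_left (norm_nonneg _) hs1.2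

lemma strip_compact (hr : ContDiff ℝ 1 r) {K : Set ℂ} (hK : IsCompact K)
    (hd : ∀ z ∈ K, fderiv ℝ r z ≠ 0) :
    ∃ U, IsOpen U ∧ K ⊆ U ∧ ∃ C : ℝ, 0 ≤ C ∧ ∀ t : ℝ, 0 < t →
      volume (U ∩ {z | -t < r z ∧ r z < 0}) ≤ ENNReal.ofReal (C * t) := by
  refine hK.induction_on (p := fun K => ∃ U, IsOpen U ∧ K ⊆ U ∧ ∃ C : ℝ, 0 ≤ C ∧ ∀ t : ℝ, 0 < t →
    volume (U ∩ {z | -t < r z ∧ r z < 0}) ≤ ENNReal.ofReal (C * t)) ?_ ?_ ?_ ?_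
  · exact ⟨∅, isOpen_empty, subset_rfl, 0, le_rfl, fun t _ => by simp⟩
  · rintro A B hAB ⟨U, h1, h2, h3⟩
    exact ⟨U, h1, hAB.trans h2, h3⟩
  · rintro A B ⟨U, h1, h2, C, hC, h3⟩ ⟨U', h1', h2', C', hC', h3'⟩
    refine ⟨U ∪ U', h1.union h1', union_subset_union h2 h2', C + C', by positivity, fun t ht => ?_⟩
    rw [union_inter_distrib_right, add_mul, ENNReal.ofReal_add (by positivity) (by positivity)]
    exact (measure_union_le _ _).trans (add_le_add (h3 t ht) (h3' t ht))
  · intro z hz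
    obtain ⟨U, h1, h2, h3⟩ := strip_local hr (hd z hz)
    exact ⟨U, mem_nhdsWithin_of_mem_nhds (h1.mem_nhds h2), U, h1, subset_rfl, h3⟩

end strip

section construction
variable {r : ℂ → ℝ}

/-- A defining function can be modified away from the domain to be constant at infinity. -/
lemma exists_modified_defining (hr : ContDiff ℝ 2 r) (hb : Bornology.IsBounded {z | r z < 0}) :
    ∃ r' : ℂ → ℝ, ContDiff ℝ 2 r' ∧ HasCompactSupport (fun z => r' z - 1) ∧
      {z | r' z < 0} = {z | r z < 0} ∧
      ∀ z ∈ closure {z | r z < 0}, fderiv ℝ r' z = fderiv ℝ r z := by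
  obtain ⟨D, hD0, hD⟩ := hb.subset_ball_lt 0 0
  let η : ContDiffBump (0 : ℂ) := ⟨D + 1, D + 2, by positivity, by linarith⟩
  have h1 : ∀ z, ‖z‖ ≤ D + 1 → η z * r z + (1 - η z) = r z := fun z hz => by
    rw [η.one_of_mem_closedBall (by simpa using hz)]; simp
  refine ⟨fun z => η z * r z + (1 - η z), (η.contDiff.mul hr).add (contDiff_const.sub η.contDiff),
    ?_, ?_, fun z hz => ?_⟩
  · have : (fun z => η z * r z + (1 - η z) - 1) = fun z => η z * (r z - 1) := by ext z; ring
    rw [this]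
    exact η.hasCompactSupport.mul_right
  · ext z
    simp only [mem_ofPred_eq]
    by_cases hz : ‖z‖ ≤ D + 1
    · rw [h1 z hz]
    · have h2 : 0 ≤ r z := by
        by_contra! h
        have := hD (show z ∈ {z | r z < 0} from h)
        rw [mem_ball_zero_iff] at this
        exact hz (by linarith)
      have h3 := mul_nonneg (η.nonneg' z) h2
      have h4 := η.le_one (x := z)
      simp only [h2.not_gt, iff_false, not_lt]
      linarith
  · refine Filter.EventuallyEq.fderiv_eq ?_
    have h2 : ‖z‖ ≤ D := by
      have := closure_mono hD hz
      simpa using Metric.closure_ball_subset_closedBall this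
    filter_upwards [Metric.ball_mem_nhds z one_pos] with y hy
    refine h1 y ?_
    have h3 := norm_add_le (y - z) z
    rw [sub_add_cancel] at h3
    have := mem_ball_iff_norm.1 hy
    linarith

lemma contDiff_dzr (hr : ContDiff ℝ 2 r) : ContDiff ℝ 1 (dzr r) := by
  have h : ∀ v, ContDiff ℝ 1 fun z => (fderiv ℝ r z v : ℂ) := fun v =>
    ofRealCLM.contDiff.comp ((hr.fderiv_right le_rfl).clm_apply contDiff_const)
  exact ((h 1).sub (contDiff_const.mul (h I))).div_const 2

lemma exists_V (hr : ContDiff ℝ 2 r) (hs : HasCompactSupport (fun z => r z - 1)) (c : ℝ)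
    (hc : 0 < c) : ∃ V : ℂ → ℂ, ContDiff ℝ 1 V ∧ HasCompactSupport V ∧
      ∀ z, c ≤ normSq (dzr r z) → dzr r z * V z = 1 := by
  have hp := contDiff_dzr hr
  have hn : ContDiff ℝ 1 fun z => normSq (dzr r z) := by
    simp only [normSq_eq_norm_sq]; exact hp.norm_sq ℝ
  have hpos : ∀ s : ℝ, 0 ≤ s → s + expNegInvGlue (c - s) ≠ 0 := fun s hs => by
    rcases hs.eq_or_lt with rfl | h
    · simpa using hc
    · have := expNegInvGlue.nonneg (c - s); positivity
  have hF : HasCompactSupport fun z => fderiv ℝ r z := by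
    rw [← show (fderiv ℝ fun z => r z - 1) = fun z => fderiv ℝ r z from
      funext fun z => fderiv_sub_const _]
    exact hs.fderiv ℝ
  refine ⟨fun z => conj (dzr r z) *
    ((normSq (dzr r z) + expNegInvGlue (c - normSq (dzr r z)) : ℝ) : ℂ)⁻¹, ?_, ?_, fun z hz => ?_⟩
  · refine (conjCLE.contDiff.comp hp).mul (ContDiff.inv (ofRealCLM.contDiff.comp
      (hn.add (expNegInvGlue.contDiff.comp (contDiff_const.sub hn)))) fun z => ?_)
    exact ofReal_ne_zero.2 (hpos _ (normSq_nonneg _))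
  · refine HasCompactSupport.mul_right ?_
    exact hF.comp_left (g := fun l : ℂ →L[ℝ] ℝ => conj (((l 1 : ℂ) - I * l I) / 2)) (by simp)
  · simp only
    rw [expNegInvGlue.zero_of_nonpos (by linarith), add_zero, ← mul_assoc, mul_conj,
      mul_inv_cancel₀ (ofReal_ne_zero.2 (hc.trans_le hz).ne')]

/-- A bounded regular domain carries the geometric data `Geo`. -/
lemma exists_geo (hr0 : ContDiff ℝ 2 r) (hb0 : Bornology.IsBounded {z | r z < 0})
    (hd0 : ∀ z ∈ frontier {z | r z < 0}, fderiv ℝ r z ≠ 0) :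
    ∃ Γ : Geo, Γ.dom = {z | r z < 0} := by
  obtain ⟨ρ, hρ, hsupp, hΩ, hder⟩ := exists_modified_defining hr0 hb0
  rw [← hΩ] at hb0 hd0 hder ⊢
  set Ω := {z | ρ z < 0} with hΩdef
  have hd : ∀ z ∈ frontier Ω, fderiv ℝ ρ z ≠ 0 := fun z hz => by
    rw [hder z (frontier_subset_closure hz)]; exact hd0 z hz
  have hΩo : IsOpen Ω := isOpen_lt hρ.continuous continuous_const
  have hcl : IsCompact (closure Ω) := hb0.isCompact_closure
  have hF : IsCompact (frontier Ω) := hcl.of_isClosed_subset isClosed_frontier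
    frontier_subset_closure
  have hp := contDiff_dzr hρ
  have hn : Continuous fun z => normSq (dzr ρ z) := continuous_normSq.comp hp.continuous
  obtain ⟨c, hc, hcF⟩ := hF.exists_forall_le' hn.continuousOn (a := 0) fun z hz => by
    rw [normSq_pos]
    intro h
    have := norm_fderiv_le_dzr ρ z
    rw [h, norm_zero, mul_zero] at this
    exact hd z hz (norm_le_zero_iff.1 this)
  obtain ⟨V, hV, hVs, hVi⟩ := exists_V hρ hsupp (c / 2) (by positivity)
  obtain ⟨e, he, heF⟩ := hF.exists_thickening_subset_open
    (isOpen_lt continuous_const hn : IsOpen {z | c / 2 < normSq (dzr ρ z)})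
    (fun z hz => (half_lt_self hc).trans_le (hcF z hz))
  obtain ⟨U, hUo, hFU, Cs, hCs, hU⟩ := strip_compact (hρ.of_le one_le_two) hF hd
  obtain ⟨d, hdpos, hdK⟩ := (hcl.diff (hUo.inter (Metric.isOpen_thickening (δ := e / 2)
    (E := frontier Ω)))).exists_forall_le' (f := fun z => -ρ z) (a := 0)
    hρ.continuous.neg.continuousOn (fun z hz => by
      have : z ∉ frontier Ω := fun h =>
        hz.2 ⟨hFU h, Metric.self_subset_thickening (by positivity) _ h⟩
      have h2 : z ∈ Ω := by
        by_contra h; exact this ⟨hz.1, by rwa [hΩo.interior_eq]⟩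
      exact neg_pos.2 h2)
  have hnear : ∀ x, ρ x < 0 → -d < ρ x → x ∈ U ∧ x ∈ Metric.thickening (e / 2) (frontier Ω) := by
    intro x h1 h2
    by_contra h
    have := hdK x ⟨subset_closure h1, h⟩
    linarith
  obtain ⟨L1, hL1⟩ := (hρ.sub contDiff_const).lipschitzWith_of_hasCompactSupport hsupp two_ne_zero
  have hfs : HasCompactSupport fun z => fderiv ℝ ρ z := by
    rw [← show (fderiv ℝ fun z => ρ z - 1) = fun z => fderiv ℝ ρ z from
      funext fun z => fderiv_sub_const _]
    exact hsupp.fderiv ℝ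
  obtain ⟨L2, hL2⟩ := (hρ.fderiv_right (m := 1) le_rfl).lipschitzWith_of_hasCompactSupport hfs
    one_ne_zero
  obtain ⟨L3, hL3⟩ := hV.lipschitzWith_of_hasCompactSupport hVs one_ne_zero
  obtain ⟨L4, hL4⟩ := hVs.exists_bound_of_continuous hV.continuous
  obtain ⟨D, hD⟩ := hb0.subset_closedBall 0
  have hL4' : 0 ≤ L4 := (norm_nonneg _).trans (hL4 0)
  set m := volume.real Ω / d
  have hm : 0 ≤ m := div_nonneg measureReal_nonneg hdpos.le
  set L : ℝ := 1 + L1 + L2 + L3 + L4 + Cs + m with hL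
  have hle : 1 ≤ L ∧ (L1 : ℝ) ≤ L ∧ (L2 : ℝ) ≤ L ∧ (L3 : ℝ) ≤ L ∧ L4 ≤ L ∧ Cs ≤ L ∧ m ≤ L := by
    have := L1.2; have := L2.2; have := L3.2
    simp only [hL]
    refine ⟨?_, ?_, ?_, ?_, ?_, ?_, ?_⟩ <;> linarith
  obtain ⟨l0, l1, l2, l3, l4, l5, l6⟩ := hle
  refine ⟨⟨ρ, V, L, min d 1, e / 2, D, l0, by positivity, by positivity, min_le_right _ _, fun x hx => by simpa using hD hx, hρ, hV, fun x y => ?_, fun x y => ?_,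
    fun x => (hL4 x).trans l4, fun x y => ?_, fun x y h1 h2 h3 => ?_, fun t ht => ?_⟩, rfl⟩
  · have := hL1.norm_sub_le y x
    simp only [sub_sub_sub_cancel_right, Real.norm_eq_abs] at this
    exact this.trans (by gcongr)
  · have := (convex_closedBall x ‖y - x‖).norm_image_sub_le_of_norm_fderiv_le' (𝕜 := ℝ) (f := ρ)
      (φ := fderiv ℝ ρ x) (C := L2 * ‖y - x‖) (fun z _ => hρ.differentiable two_ne_zero z)
      (fun z hz => (hL2.norm_sub_le z x).trans (by gcongr; exact mem_closedBall_iff_norm.1 hz))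
      (Metric.mem_closedBall_self (norm_nonneg _)) (mem_closedBall_iff_norm.2 le_rfl)
    rw [Real.norm_eq_abs] at this
    rw [sq, ← mul_assoc]
    exact this.trans (by gcongr)
  · exact (hL3.norm_sub_le y x).trans (by gcongr)
  · refine hVi y (le_of_lt ?_)
    obtain ⟨-, hx⟩ := hnear x h1 (by have := min_le_left d 1; linarith)
    obtain ⟨p, hp, hxp⟩ := Metric.mem_thickening_iff.1 hx
    refine heF (Metric.mem_thickening_iff.2 ⟨p, hp, ?_⟩)
    have := dist_triangle y x p
    rw [dist_eq_norm y x] at this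
    linarith
  · rcases le_or_gt t d with h | h
    · calc volume {z | -t < ρ z ∧ ρ z < 0} ≤ volume (U ∩ {z | -t < ρ z ∧ ρ z < 0}) :=
            measure_mono fun z hz => ⟨(hnear z hz.2 (by linarith [hz.1])).1, hz⟩
        _ ≤ _ := (hU t ht).trans (ENNReal.ofReal_le_ofReal (by gcongr))
    · calc volume {z | -t < ρ z ∧ ρ z < 0} ≤ volume Ω := measure_mono fun z hz => hz.2
        _ = ENNReal.ofReal (m * d) := by
          rw [div_mul_cancel₀ _ hdpos.ne', ofReal_measureReal hb0.measure_lt_top.ne]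
        _ ≤ _ := ENNReal.ofReal_le_ofReal (by gcongr)

end construction

section laplacian
variable {u : ℂ → ℂ} {U : Set ℂ} {z : ℂ}

/-- The Laplacian is four times the product of the two Wirtinger derivatives. -/
lemma four_db_dz (hU : IsOpen U) (hu : ContDiffOn ℝ 2 u U) (hz : z ∈ U) :
    4 * db (dz u) z = iteratedFDeriv ℝ 2 u z ![1, 1] + iteratedFDeriv ℝ 2 u z ![I, I] := by
  have hc := hu.contDiffAt (hU.mem_nhds hz)
  have hs : IsSymmSndFDerivAt ℝ u z := hc.isSymmSndFDerivAt (by simp)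
  have hd : DifferentiableAt ℝ (fderiv ℝ u) z :=
    (hc.fderiv_right (m := 1) (by norm_num)).differentiableAt one_ne_zero
  have h1 : ∀ v : ℂ, HasFDerivAt (fun y => fderiv ℝ u y v) ((fderiv ℝ (fderiv ℝ u) z).flip v) z :=
    fun v => by
      refine (hd.hasFDerivAt.clm_apply (hasFDerivAt_const v z)).congr_fderiv ?_
      ext w; simp
  have e1 : HasFDerivAt (dz u) _ z := ((h1 1).sub ((h1 I).const_mul I)).mul_const (2 : ℂ)⁻¹
  rw [db, e1.fderiv, iteratedFDeriv_two_apply, iteratedFDeriv_two_apply]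
  have := hs.eq 1 I
  simp
  rw [this]
  linear_combination (-(fderiv ℝ (fderiv ℝ u) z I I)) * I_sq

lemma differentiableOn_of_db_eq_zero (hU : IsOpen U) (hd : DifferentiableOn ℝ u U)
    (h : ∀ z ∈ U, db u z = 0) : DifferentiableOn ℂ u U := fun z hz => by
  have h1 := (hd.differentiableAt (hU.mem_nhds hz)).hasFDerivAt
  rw [fderiv_eq_wirtMap, h z hz] at h1
  have : HasFDerivAt u (dz u z • ContinuousLinearMap.id ℂ ℂ) z :=
    hasFDerivAt_of_restrictScalars ℝ h1 (by ext w; simp [wirtMap_apply])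
  exact this.differentiableAt.differentiableWithinAt

end laplacian

section transfer

/-- The standard identification of the complex plane with the Euclidean plane. -/
noncomputable def toVec : ℂ ≃ₗᵢ[ℝ] Vec2 := Complex.orthonormalBasisOneI.repr

lemma toVec_one : toVec 1 = e2 0 := by
  ext i; fin_cases i <;> simp [toVec, e2]

lemma toVec_I : toVec I = e2 1 := by
  ext i; fin_cases i <;> simp [toVec, e2]

lemma toVec_symm_apply (x : Vec2) : toVec.symm x = x 0 + x 1 * I :=
  Complex.orthonormalBasisOneI_repr_symm_apply x

/-- A planar vector field in complex notation. -/
noncomputable def cplx (v : Vec2 → Vec2) (z : ℂ) : ℂ := toVec.symm (v (toVec z))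

lemma fderiv_comp_toVec {F : Type*} [NormedAddCommGroup F] [NormedSpace ℝ F] (f : Vec2 → F)
    (z : ℂ) : fderiv ℝ (fun y => f (toVec y)) z = (fderiv ℝ f (toVec z)).comp
      (toVec : ℂ →L[ℝ] Vec2) :=
  toVec.toContinuousLinearEquiv.comp_right_fderiv

lemma fderiv_cplx (v : Vec2 → Vec2) (z h : ℂ) :
    fderiv ℝ (cplx v) z h = toVec.symm (fderiv ℝ v (toVec z) (toVec h)) := by
  have : cplx v = toVec.symm ∘ fun y => v (toVec y) := rfl
  rw [this, LinearIsometryEquiv.comp_fderiv, fderiv_comp_toVec]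
  rfl

lemma iteratedFDeriv_cplx (v : Vec2 → Vec2) (z a b : ℂ) :
    iteratedFDeriv ℝ 2 (cplx v) z ![a, b] =
      toVec.symm (iteratedFDeriv ℝ 2 v (toVec z) ![toVec a, toVec b]) := by
  have : cplx v = toVec.symm.toContinuousLinearEquiv ∘ (v ∘ toVec.toContinuousLinearEquiv) := rfl
  rw [this, ContinuousLinearEquiv.iteratedFDeriv_comp_left, ← iteratedFDerivWithin_univ,
    ← preimage_univ (f := toVec.toContinuousLinearEquiv),
    ContinuousLinearEquiv.iteratedFDerivWithin_comp_right _ _ uniqueDiffOn_univ (mem_univ _),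
    iteratedFDerivWithin_univ]
  simp only [ContinuousLinearMap.compContinuousMultilinearMap_coe, Function.comp_apply,
    ContinuousMultilinearMap.compContinuousLinearMap_apply]
  change toVec.symm _ = toVec.symm _
  congr 2
  ext i; fin_cases i <;> rfl

lemma dz_cplx (v : Vec2 → Vec2) (z : ℂ) :
    dz (cplx v) z = (div2 v (toVec z) + I * curl2 v (toVec z)) / 2 := by
  rw [dz, fderiv_cplx, fderiv_cplx, toVec_one, toVec_I, toVec_symm_apply, toVec_symm_apply]
  simp only [div2, curl2, pd, Fin.sum_univ_two]
  push_cast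
  linear_combination (-(fderiv ℝ v (toVec z) (e2 1) 1) / 2 : ℂ) * I_sq

lemma lapl_cplx {v : Vec2 → Vec2} {Ω : Set Vec2} (hΩ : IsOpen Ω) (hv : ContDiffOn ℝ 2 v Ω) {z : ℂ}
    (hz : toVec z ∈ Ω) : 4 * db (dz (cplx v)) z = toVec.symm (lapl v (toVec z)) := by
  have h : ContDiffOn ℝ 2 (cplx v) (toVec ⁻¹' Ω) :=
    toVec.symm.contDiff.comp_contDiffOn (hv.comp toVec.contDiff.contDiffOn fun _ h => h)
  rw [four_db_dz (hΩ.preimage toVec.continuous) h hz, iteratedFDeriv_cplx, iteratedFDeriv_cplx,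
    toVec_one, toVec_I, lapl, Fin.sum_univ_two, map_add]

lemma db_ofReal (p : Vec2 → ℝ) {z : ℂ} (hp : DifferentiableAt ℝ p (toVec z)) :
    2 * db (fun y => (p (toVec y) : ℂ)) z = pd 0 p (toVec z) + I * pd 1 p (toVec z) := by
  have h : HasFDerivAt (fun y => p (toVec y)) _ z :=
    hp.hasFDerivAt.comp z toVec.toContinuousLinearEquiv.hasFDerivAt
  have h1 : HasFDerivAt (fun y => (p (toVec y) : ℂ)) _ z := ofRealCLM.hasFDerivAt.comp z h
  rw [db, h1.fderiv]
  simp only [ContinuousLinearMap.comp_apply, ofRealCLM_apply]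
  change 2 * ((((fderiv ℝ p (toVec z)) (toVec 1) : ℝ) +
    I * ((fderiv ℝ p (toVec z)) (toVec I) : ℝ)) / 2) = _
  rw [toVec_one, toVec_I, pd, pd]
  ring

end transfer

section transfer

lemma exists_geo_of_isBoundedSmoothDomain {Ω : Set Vec2} (hΩ : IsBoundedSmoothDomain Ω) :
    ∃ Γ : Geo, Γ.dom = toVec ⁻¹' Ω := by
  obtain ⟨-, -, hb, ρ, hρ, rfl, hd⟩ := hΩ
  have h := LogStokes.exists_geo (r := fun z => ρ (toVec z))
    ((contDiff_infty.1 hρ 2).comp toVec.contDiff)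
    (toVec.isometry.antilipschitz.isBounded_preimage hb)
    fun z hz => ?_
  · exact h
  · have h1 : toVec z ∈ frontier {x | ρ x < 0} := by
      have := toVec.toHomeomorph.preimage_frontier {x | ρ x < 0}
      exact (this ▸ hz : z ∈ toVec.toHomeomorph ⁻¹' _)
    rw [fderiv_comp_toVec]
    intro h
    refine hd _ h1 ?_
    ext v
    have := DFunLike.congr_fun h (toVec.symm v)
    simpa using this

lemma norm_le_of_lpnorm_top {Ω : Set Vec2} (hΩ : IsOpen Ω) {w : Vec2 → ℝ} (hw : ContinuousOn w Ω)
    (hb : lpnorm Ω ⊤ w < ⊤) {x : Vec2} (hx : x ∈ Ω) : ‖w x‖ ≤ (lpnorm Ω ⊤ w).toReal := by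
  set A := (lpnorm Ω ⊤ w).toReal
  by_contra! h
  have hU : IsOpen (Ω ∩ (fun y => ‖w y‖) ⁻¹' Ioi A) := hw.norm.isOpen_inter_preimage hΩ isOpen_Ioi
  have h0 : volume (Ω ∩ (fun y => ‖w y‖) ⁻¹' Ioi A) = 0 := by
    have h1 : ∀ᵐ y ∂volume.restrict Ω, ‖w y‖ ≤ A := by
      have := ae_le_eLpNormEssSup (f := w) (μ := volume.restrict Ω)
      filter_upwards [this] with y hy
      rw [← eLpNorm_exponent_top, ← lpnorm] at hy
      simpa [A] using ENNReal.toReal_mono hb.ne hy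
    rw [ae_restrict_iff' hΩ.measurableSet, ae_iff] at h1
    refine measure_mono_null (fun y hy => ?_) h1
    simp only [mem_ofPred_eq, Classical.not_imp, not_le]
    exact hy
  have := (hU.measure_eq_zero_iff volume).1 h0
  exact (this ▸ (⟨hx, h⟩ : x ∈ Ω ∩ (fun y => ‖w y‖) ⁻¹' Ioi A) : x ∈ (∅ : Set Vec2))

lemma eLpNorm_comp_toVec {Ω : Set Vec2} (hΩ : IsOpen Ω) (w : Vec2 → ℝ) (q : ℝ≥0∞) :
    eLpNorm (fun z => fderiv ℝ w (toVec z)) q (volume.restrict (toVec ⁻¹' Ω)) =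
      lpnorm Ω q (fun x => fderiv ℝ w x) :=
  eLpNorm_comp_measurePreserving (measurable_fderiv ℝ w).aestronglyMeasurable
    (toVec.measurePreserving.restrict_preimage hΩ.measurableSet)

lemma Geo.vanish_of_continuousOn (Γ : Geo) {u : ℂ → ℂ} (hu : ContinuousOn u (closure Γ.dom))
    (h0 : ∀ z ∈ frontier Γ.dom, u z = 0) : Γ.Vanish u := by
  intro τ hτ
  have hb : Bornology.IsBounded Γ.dom := Metric.isBounded_closedBall.subset Γ.dom_subset
  obtain ⟨ε, hε, h⟩ := (hb.isCompact_closure.of_isClosed_subset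
    (hu.norm.preimage_isClosed_of_isClosed isClosed_closure (isClosed_Ici (a := τ)))
    inter_subset_left).exists_forall_le' (f := Γ.δ) (a := 0) Γ.continuous_δ.continuousOn
    (fun z hz => by
      rw [← Γ.mem_dom]
      by_contra h
      have h1 : τ ≤ ‖u z‖ := hz.2
      rw [h0 z ⟨hz.1, by rwa [Γ.isOpen_dom.interior_eq]⟩, norm_zero] at h1
      linarith)
  refine ⟨ε, hε, fun z hz hd => ?_⟩
  by_contra! h1
  have := h z ⟨subset_closure hz, h1.le⟩
  linarith

/-- The Stokes system in complex form: the conjugate of the velocity solves the conjugate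
Cauchy–Riemann system driven by the source and a holomorphic function. -/
lemma isSol_of_isStokesSol {Ω : Set Vec2} (hΩ : IsOpen Ω) {Γ : Geo} (hΓ : Γ.dom = toVec ⁻¹' Ω)
    {c : ℝ} (hc : |c| ≤ 2) {q : ℝ≥0∞} (hq1 : 2 < q) (hq2 : q < ⊤) {w : Vec2 → ℝ}
    {v : Vec2 → Vec2} {p : Vec2 → ℝ} (hw : ContDiffOn ℝ 1 w Ω) (hwb : lpnorm Ω ⊤ w < ⊤)
    (hwq : lpnorm Ω q (fun x => fderiv ℝ w x) < ⊤)
    (hs : IsStokesSol Ω (fun x => c • perpGrad w x) v p) (hv : ContDiffOn ℝ 2 v Ω)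
    (hp : ContDiffOn ℝ 1 p Ω) (hvc : ContinuousOn v (closure Ω)) :
    Geo.IsSol Γ q.toReal (1 + (lpnorm Ω ⊤ w).toReal)
      (lpnorm Ω q (fun x => fderiv ℝ w x)).toReal (fun z => conj (cplx v z))
      (fun z => I / 2 * c * w (toVec z))
      (fun z => -(p (toVec z) - 2 * dz (cplx v) z - I * c * w (toVec z)) / 4) := by
  obtain ⟨h1, h2, h3⟩ := hs
  have hdo : IsOpen (toVec ⁻¹' Ω) := hΩ.preimage toVec.continuous
  have hcomp : ∀ {n : ℕ∞} {f : Vec2 → ℝ}, ContDiffOn ℝ n f Ω →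
      ContDiffOn ℝ n (fun z => (f (toVec z) : ℂ)) (toVec ⁻¹' Ω) := fun hf =>
    ofRealCLM.contDiff.comp_contDiffOn (hf.comp toVec.contDiff.contDiffOn fun _ h => h)
  have hu : ContDiffOn ℝ 2 (cplx v) (toVec ⁻¹' Ω) :=
    toVec.symm.contDiff.comp_contDiffOn (hv.comp toVec.contDiff.contDiffOn fun _ h => h)
  have hdz := contDiffOn_dz hdo hu
  have hW : ContDiffOn ℝ 1 (fun z => (w (toVec z) : ℂ)) (toVec ⁻¹' Ω) := hcomp hw
  have hP : ContDiffOn ℝ 1 (fun z => (p (toVec z) : ℂ)) (toVec ⁻¹' Ω) := hcomp hp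
  have hcz : ‖I / 2 * (c : ℂ)‖ ≤ 1 := by
    rw [norm_mul, norm_div, norm_I, norm_real, Real.norm_eq_abs]; norm_num; linarith
  have hdiv : ∀ z ∈ toVec ⁻¹' Ω, dz (cplx v) z = I * curl2 v (toVec z) / 2 := fun z hz => by
    rw [dz_cplx, h2 _ hz]; simp
  have hdiff : ∀ {f : ℂ → ℂ}, ContDiffOn ℝ 1 f (toVec ⁻¹' Ω) → ∀ z ∈ toVec ⁻¹' Ω,
      DifferentiableAt ℝ f z := fun hf z hz =>
    (hf.differentiableOn one_ne_zero).differentiableAt (hdo.mem_nhds hz)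
  refine ⟨?_, ?_, ENNReal.toReal_nonneg, ?_, ?_, ?_, fun z hz => ?_, fun z _ => ?_,
    fun z hz => ?_, ?_, ?_⟩
  · have := (ENNReal.toReal_lt_toReal (by simp) hq2.ne).2 hq1
    simpa using this
  · have := ENNReal.toReal_nonneg (a := lpnorm Ω ⊤ w); linarith
  · rw [hΓ]; exact conjCLE.contDiff.comp_contDiffOn hu
  · rw [hΓ]; exact contDiffOn_const.mul hW
  · rw [hΓ]
    have hG : ContDiffOn ℝ 1
        (fun z => -((p (toVec z) : ℂ) - 2 * dz (cplx v) z - I * c * w (toVec z)) / 4)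
        (toVec ⁻¹' Ω) :=
      (((hP.sub (contDiffOn_const.mul hdz)).sub (contDiffOn_const.mul hW)).neg).div_const 4
    refine differentiableOn_of_db_eq_zero hdo (hG.differentiableOn one_ne_zero) fun z hz => ?_
    have a1 := hasWirt_of_diff (hdiff hP z hz)
    have a2 := hasWirt_of_diff (hdiff hdz z hz)
    have a3 := hasWirt_of_diff (hdiff hW z hz)
    have := (((a1.sub ((hasWirt_const 2 z).mul a2)).sub
      ((hasWirt_const (I * c) z).mul a3)).neg.mul (hasWirt_const (4 : ℂ)⁻¹ z)).db_eq
    simp only [div_eq_mul_inv]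
    rw [this]
    have e1 := db_ofReal p ((hp.differentiableOn one_ne_zero).differentiableAt (hΩ.mem_nhds hz))
    have e2 := db_ofReal w ((hw.differentiableOn one_ne_zero).differentiableAt (hΩ.mem_nhds hz))
    have e3 := lapl_cplx hΩ hv hz
    have e4 := congrArg toVec.symm (h1 _ hz)
    rw [map_add, map_neg, ← e3, map_smul, toVec_symm_apply, toVec_symm_apply] at e4
    simp [grad2, perpGrad] at e4
    linear_combination (-1 / 8) * e1 + (I * c / 8) * e2 - e4 / 8 +
      (c * pd 1 w (toVec z) / 8 : ℂ) * I_sq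
  · rw [hΓ] at hz
    have hf := (hasWirt_of_diff
      ((hu.differentiableOn two_ne_zero).differentiableAt (hdo.mem_nhds hz))).conjugate.db_eq
    rw [hf, hdiv z hz]
    simp [map_ofNat]
    ring
  · simp
  · rw [hΓ] at hz
    rw [norm_mul, norm_real]
    have := norm_le_of_lpnorm_top hΩ hw.continuousOn hwb hz
    nlinarith [norm_nonneg (w (toVec z))]
  · rw [ENNReal.ofReal_toReal hq2.ne, ENNReal.ofReal_toReal hwq.ne, hΓ]
    have h := eLpNorm_le_mul_eLpNorm_of_ae_le_mul (c := 1) (μ := volume.restrict (toVec ⁻¹' Ω))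
      (f := fun z => fderiv ℝ (fun z => I / 2 * (c : ℂ) * w (toVec z)) z)
      (g := fun z => fderiv ℝ w (toVec z)) ?_ q
    · rwa [ENNReal.ofReal_one, one_mul, eLpNorm_comp_toVec hΩ] at h
    · rw [ae_restrict_iff' hdo.measurableSet]
      refine Filter.Eventually.of_forall fun z hz => ?_
      have e0 := ((hw.differentiableOn one_ne_zero).differentiableAt (hΩ.mem_nhds hz)).hasFDerivAt
      have e1 : HasFDerivAt (fun y => (w (toVec y) : ℂ)) _ z := ofRealCLM.hasFDerivAt.comp z
        (e0.comp z toVec.toContinuousLinearEquiv.hasFDerivAt)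
      rw [(e1.const_mul _).fderiv, norm_smul]
      refine mul_le_mul hcz ?_ (norm_nonneg _) zero_le_one
      refine ContinuousLinearMap.opNorm_le_bound _ (norm_nonneg _) fun y => ?_
      have := (fderiv ℝ w (toVec z)).le_opNorm (toVec y)
      rw [toVec.norm_map] at this
      simpa using this
  · have hcl : closure (toVec ⁻¹' Ω) = toVec ⁻¹' closure Ω :=
      (toVec.toHomeomorph.preimage_closure Ω).symm
    have hfr : frontier (toVec ⁻¹' Ω) = toVec ⁻¹' frontier Ω :=
      (toVec.toHomeomorph.preimage_frontier Ω).symm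
    refine Γ.vanish_of_continuousOn ?_ ?_
    · rw [hΓ, hcl]
      exact continuous_conj.comp_continuousOn (toVec.symm.continuous.comp_continuousOn
        (hvc.comp toVec.continuous.continuousOn fun _ h => h))
    · rw [hΓ, hfr]
      intro z hz
      simp [cplx, h3 _ hz]

lemma norm_fderiv_le_conj_cplx (v : Vec2 → Vec2) (z : ℂ) :
    ‖fderiv ℝ v (toVec z)‖ ≤ ‖fderiv ℝ (fun y => conj (cplx v y)) z‖ := by
  refine ContinuousLinearMap.opNorm_le_bound _ (norm_nonneg _) fun x => ?_
  have h : fderiv ℝ (fun y => conj (cplx v y)) z (toVec.symm x) =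
      conj (toVec.symm (fderiv ℝ v (toVec z) x)) := by
    have := conjCLE.comp_fderiv (f := cplx v) (x := z)
    rw [show (fun y => conj (cplx v y)) = conjCLE ∘ cplx v from rfl, this]
    simp [fderiv_cplx]
  have := (fderiv ℝ (fun y => conj (cplx v y)) z).le_opNorm (toVec.symm x)
  rwa [h, RCLike.norm_conj, LinearIsometryEquiv.norm_map, LinearIsometryEquiv.norm_map] at this

end transfer

end LogStokes

/-- **Logarithmic `L^∞` gradient bound for the auxiliary Stokes field.**
Let `Ω ⊂ ℝ²` be a bounded domain with smooth boundary, `ν, κ > 0`, `q ∈ (2,∞)`, and let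
`w ∈ L^∞(Ω)` with `∇w ∈ L^q(Ω)`.  If `v` solves the stationary Stokes system
`−Δv + ∇π = −(2κ/(ν+κ)) ∇^⊥w`, `∇·v = 0` in `Ω`, `v = 0` on `∂Ω`, then
`‖∇v‖_{L^∞(Ω)} ≤ C (1 + ‖w‖_{L^∞(Ω)}) ln(e + ‖∇w‖_{L^q(Ω)})` with `C = C(Ω, q, ν, κ)`. -/
theorem aux_field_log_gradient_bound (Ω : Set Vec2) (hΩ : IsBoundedSmoothDomain Ω)
    (ν κ : ℝ) (hν : 0 < ν) (hκ : 0 < κ)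
    (q : ℝ≥0∞) (hq1 : 2 < q) (hq2 : q < ⊤) :
    ∃ C > (0 : ℝ), ∀ w : Vec2 → ℝ, ∀ v : Vec2 → Vec2, ∀ π : Vec2 → ℝ,
      ContDiffOn ℝ 1 w (closure Ω) →
      lpnorm Ω ⊤ w < ⊤ → lpnorm Ω q (fun x => fderiv ℝ w x) < ⊤ →
      IsStokesSol Ω (fun x => (-(2 * κ) / (ν + κ)) • perpGrad w x) v π →
      ContDiffOn ℝ 2 v Ω → ContDiffOn ℝ 1 π Ω → ContinuousOn v (closure Ω) →
      lpnorm Ω ⊤ (fun x => fderiv ℝ v x) ≤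
        ENNReal.ofReal (C * (1 + (lpnorm Ω ⊤ w).toReal)
          * Real.log (Real.exp 1 + (lpnorm Ω q (fun x => fderiv ℝ w x)).toReal)) := by
  obtain ⟨Γ, hΓ⟩ := LogStokes.exists_geo_of_isBoundedSmoothDomain hΩ
  have hq : 2 < q.toReal := by
    simpa using (ENNReal.toReal_lt_toReal (by simp) hq2.ne).2 hq1
  obtain ⟨C, hC, hbound⟩ := LogStokes.Geo.IsSol.norm_fderiv_le Γ hq
  refine ⟨C, hC, fun w v π hw hwb hwq hs hv hπ hvc => ?_⟩
  have hc : |-(2 * κ) / (ν + κ)| ≤ 2 := by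
    rw [abs_div, abs_neg, abs_of_pos (by positivity), abs_of_pos (by positivity),
      div_le_iff₀ (by positivity)]
    linarith
  have hsol := LogStokes.isSol_of_isStokesSol hΩ.1 hΓ hc hq1 hq2 (hw.mono subset_closure) hwb hwq hs
    hv hπ hvc
  rw [lpnorm, eLpNorm_exponent_top]
  refine eLpNormEssSup_le_of_ae_bound ((ae_restrict_iff' hΩ.1.measurableSet).2
    (Filter.Eventually.of_forall fun x hx => ?_))
  have h := hbound hsol (LogStokes.toVec.symm x) (by rw [hΓ]; simpa using hx)
  have h1 := LogStokes.norm_fderiv_le_conj_cplx v (LogStokes.toVec.symm x)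
  rw [LinearIsometryEquiv.apply_symm_apply] at h1
  rw [mul_assoc]
  exact h1.trans h
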